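/- arXiv:2112.13405 — 6 statements merged into one kernel-verified Lean document; each statement's English description precedes it below -/
import Mathlib

section
/- The module Sym^k Ai_n is irreducible as a module over the Weyl algebra ℂ[z]⟨∂_z⟩: the only ℂ[z]-submodules N of Sym^k Ai_n satisfying D(N) ⊆ N are N = 0 and N = Sym^k Ai_n. -/
open Polynomial

/-- The index set `P(n,k) = {a ∈ ℤ_{≥0}^n : a_0 + ⋯ + a_{n−1} = k}` of the basis
`u_a = v_0^{a_0}⋯v_{n−1}^{a_{n−1}}` of `Sym^k Ai_n` (each `a_i ≤ k` automatically). -/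
abbrev PIdx (n k : ℕ) := {a : Fin n → Fin (k + 1) // ∑ i, (a i : ℕ) = k}

/-- The underlying space of `Sym^k Ai_n`: the free `ℂ[z]`-module on the basis `(u_a)`,
an element being recorded by its coefficient function `P(n,k) → ℂ[z]`. -/
abbrev AiSym (n k : ℕ) := PIdx n k → Polynomial ℂ

/-- The action of `∂_z` on `Sym^k Ai_n`, determined by the Leibniz rule
`D(p·u_a) = p′·u_a + p·(Σ_{i=0}^{n−2} a_i·u_{a−δ_i+δ_{i+1}} + a_{n−1}·z·u_{a−δ_{n−1}+δ_0})`.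
The coefficient of `u_b` in `D f` is `(f b)′` plus, for each `a` and each `i` with
`a_i ≥ 1` and `a − δ_i + δ_{(i+1) mod n} = b`, the term `a_i·(z if i = n−1)·f a`. -/
noncomputable def AiD (n k : ℕ) : AiSym n k →ₗ[ℂ] AiSym n k :=
  LinearMap.pi fun b =>
    (Polynomial.derivative).comp (LinearMap.proj b) +
    ∑ a : PIdx n k, ∑ i : Fin n,
      if 1 ≤ (a.1 i : ℕ) ∧
          (fun l : Fin n => (a.1 l : ℕ) + (if (l : ℕ) = ((i : ℕ) + 1) % n then 1 else 0)
            - (if l = i then 1 else 0)) = (fun l : Fin n => (b.1 l : ℕ)) then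
        (LinearMap.mulLeft ℂ
          (((a.1 i : ℕ) : Polynomial ℂ) * (if (i : ℕ) = n - 1 then X else 1))).comp
          (LinearMap.proj a)
      else 0

section TensorAction

variable {β ι R : Type*} [DecidableEq β] [Fintype ι] [CommRing R]

/-- The matrix `A` acting on the tensor factor with label `b` of a tensor given by its
coordinates `f : (β → ι) → R`. -/
def slotAct (A : Matrix ι ι R) (b : β) : Module.End R ((β → ι) → R) where
  toFun f s := ∑ j, A (s b) j * f (Function.update s b j)
  map_add' f g := by ext s; simp [mul_add, Finset.sum_add_distrib]
  map_smul' c f := by ext s; simp [Finset.mul_sum, mul_left_comm]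

/-- The matrix `A` acting as a derivation on tensors. -/
def derivAct [Fintype β] (A : Matrix ι ι R) : Module.End R ((β → ι) → R) := ∑ b, slotAct A b

lemma slotAct_apply (A : Matrix ι ι R) (b : β) (f : (β → ι) → R) (s : β → ι) :
    slotAct A b f s = ∑ j, A (s b) j * f (Function.update s b j) := rfl

lemma derivAct_apply [Fintype β] (A : Matrix ι ι R) (f : (β → ι) → R) (s : β → ι) :
    derivAct A f s = ∑ b, ∑ j, A (s b) j * f (Function.update s b j) := by
  simp [derivAct, slotAct_apply]

lemma slotAct_mul (A B : Matrix ι ι R) (b : β) :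
    slotAct A b * slotAct B b = slotAct (A * B) b := by
  refine LinearMap.ext fun f => funext fun s => ?_
  simp only [Module.End.mul_apply, slotAct_apply, Function.update_self, Function.update_idem,
    Matrix.mul_apply, Finset.mul_sum, Finset.sum_mul]
  rw [Finset.sum_comm]
  simp [mul_assoc]

lemma slotAct_comm (A B : Matrix ι ι R) {b c : β} (h : b ≠ c) :
    slotAct A b * slotAct B c = slotAct B c * slotAct A b := by
  refine LinearMap.ext fun f => funext fun s => ?_
  simp only [Module.End.mul_apply, slotAct_apply, Function.update_of_ne h,
    Function.update_of_ne h.symm, Finset.mul_sum]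
  rw [Finset.sum_comm]
  refine Finset.sum_congr rfl fun i _ => Finset.sum_congr rfl fun j _ => ?_
  rw [Function.update_comm h]
  ring

lemma slotAct_add (A B : Matrix ι ι R) (b : β) :
    slotAct (A + B) b = slotAct A b + slotAct B b := by
  refine LinearMap.ext fun f => funext fun s => ?_
  simp [slotAct_apply, add_mul, Finset.sum_add_distrib]

lemma slotAct_sub (A B : Matrix ι ι R) (b : β) :
    slotAct (A - B) b = slotAct A b - slotAct B b := by
  refine LinearMap.ext fun f => funext fun s => ?_
  simp [slotAct_apply, sub_mul, Finset.sum_sub_distrib]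

lemma derivAct_add [Fintype β] (A B : Matrix ι ι R) :
    (derivAct (A + B) : Module.End R ((β → ι) → R)) = derivAct A + derivAct B := by
  simp [derivAct, slotAct_add, Finset.sum_add_distrib]

lemma derivAct_commutator [Fintype β] (A B : Matrix ι ι R) :
    (derivAct (A * B - B * A) : Module.End R ((β → ι) → R)) =
      derivAct A * derivAct B - derivAct B * derivAct A := by
  simp only [derivAct, Finset.sum_mul_sum]
  rw [Finset.sum_comm (f := fun b c => slotAct B b * slotAct A c), ← Finset.sum_sub_distrib]
  refine Finset.sum_congr rfl fun b _ => ?_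
  rw [← Finset.sum_sub_distrib, Finset.sum_eq_single b]
  · rw [slotAct_mul, slotAct_mul, slotAct_sub]
  · intro c _ hc
    rw [slotAct_comm A B hc.symm, sub_self]
  · simp

lemma derivAct_commutator_apply [Fintype β] (A B : Matrix ι ι R) (f : (β → ι) → R) :
    derivAct (A * B - B * A) f = derivAct A (derivAct B f) - derivAct B (derivAct A f) := by
  rw [derivAct_commutator]
  rfl

lemma derivAct_diagonal [Fintype β] [DecidableEq ι] (d : ι → R) (f : (β → ι) → R) (s : β → ι) :
    derivAct (Matrix.diagonal d) f s = (∑ b, d (s b)) * f s := by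
  simp [derivAct_apply, Matrix.diagonal_apply, Finset.sum_mul]

lemma derivAct_adjoint [Fintype β] (ω : ι → R) {A B : Matrix ι ι R}
    (h : ∀ i j, ω i * A i j = ω j * B j i) (f g : (β → ι) → R) :
    ∑ s, (∏ b, ω (s b)) * derivAct A f s * g s =
      ∑ s, (∏ b, ω (s b)) * f s * derivAct B g s := by
  simp only [derivAct_apply, Finset.mul_sum, Finset.sum_mul]
  rw [Finset.sum_comm, Finset.sum_comm (s := Finset.univ (α := β → ι))]
  refine Finset.sum_congr rfl fun b _ => ?_
  rw [← Finset.sum_product', ← Finset.sum_product']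
  refine Finset.sum_nbij' (fun x => (Function.update x.1 b x.2, x.1 b))
    (fun x => (Function.update x.1 b x.2, x.1 b)) (by simp) (by simp) (by simp) (by simp) ?_
  rintro ⟨s, j⟩ -
  have h1 : ∏ c, ω (s c) = ω (s b) * ∏ c ∈ Finset.univ.erase b, ω (s c) :=
    (Finset.mul_prod_erase _ _ (Finset.mem_univ b)).symm
  have h2 : ∏ c, ω (Function.update s b j c) = ω j * ∏ c ∈ Finset.univ.erase b, ω (s c) := by
    rw [← Finset.mul_prod_erase _ _ (Finset.mem_univ b), Function.update_self]
    congr 1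
    refine Finset.prod_congr rfl fun c hc => ?_
    rw [Function.update_of_ne (Finset.ne_of_mem_erase hc)]
  simp only [Function.update_self, Function.update_idem, Function.update_eq_self, h1, h2]
  linear_combination (∏ c ∈ Finset.univ.erase b, ω (s c)) * f (Function.update s b j) * g s *
    h (s b) j

end TensorAction

section AiryMatrices

/-- The regular nilpotent matrix `v_j ↦ v_{j+1}`, `v_{n-1} ↦ 0`. -/
def shiftMat (n : ℕ) : Matrix (Fin n) (Fin n) ℂ :=
  Matrix.of fun i j => if (i : ℕ) = j + 1 then 1 else 0

/-- The matrix unit `v_{n-1} ↦ v_0`. -/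
def cornerMat (n : ℕ) : Matrix (Fin n) (Fin n) ℂ :=
  Matrix.of fun i j => if (i : ℕ) = 0 ∧ (j : ℕ) + 1 = n then 1 else 0

/-- The matrix `v_j ↦ j (n - j) v_{j-1}` completing `shiftMat n` to a principal `sl₂`-triple. -/
def lowerMat (n : ℕ) : Matrix (Fin n) (Fin n) ℂ :=
  Matrix.of fun i j => if (j : ℕ) = i + 1 then ((j : ℕ) : ℂ) * ((n : ℂ) - (j : ℕ)) else 0

/-- The connection matrix of the generalized Airy connection. -/
noncomputable def airyMat (n : ℕ) : Matrix (Fin n) (Fin n) ℂ[X] :=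
  Matrix.of fun i j =>
    if (i : ℕ) = ((j : ℕ) + 1) % n then (if (j : ℕ) = n - 1 then X else 1) else 0

variable {n : ℕ}

lemma airyMat_apply (i j : Fin n) :
    airyMat n i j = C (shiftMat n i j) + X * C (cornerMat n i j) := by
  have hi := i.isLt
  have hj := j.isLt
  simp only [airyMat, shiftMat, cornerMat, Matrix.of_apply]
  by_cases h : (j : ℕ) + 1 = n
  · have h1 : (j : ℕ) = n - 1 := by omega
    have h2 : (i : ℕ) ≠ j + 1 := by omega
    rw [if_neg h2, h, Nat.mod_self, if_pos h1]
    by_cases h0 : (i : ℕ) = 0 <;> simp [h0]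
  · have h1 : (j : ℕ) ≠ n - 1 := by omega
    rw [Nat.mod_eq_of_lt (by omega), if_neg h1]
    by_cases h0 : (i : ℕ) = j + 1 <;> simp [h0, h]

lemma shiftMat_lowerMat_commutator :
    shiftMat n * lowerMat n - lowerMat n * shiftMat n =
      Matrix.diagonal fun i : Fin n => 2 * ((i : ℕ) : ℂ) - ((n : ℂ) - 1) := by
  ext i j
  have hi := i.isLt
  have h1 : (shiftMat n * lowerMat n) i j = if i = j then ((j : ℕ) : ℂ) * (n - (j : ℕ)) else 0 := by
    simp only [Matrix.mul_apply, shiftMat, lowerMat, Matrix.of_apply, ite_mul, one_mul, zero_mul]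
    by_cases h0 : (i : ℕ) = 0
    · rw [Finset.sum_eq_zero]
      · split_ifs with h
        · rw [← h, h0]; simp
        · rfl
      · intro k _
        rw [if_neg (by omega)]
    · rw [Finset.sum_eq_single ⟨i - 1, by omega⟩]
      · rw [if_pos (by simp only []; omega)]
        congr 1
        rw [Fin.ext_iff]
        simp only [eq_iff_iff]
        omega
      · intro k _ hk
        rw [if_neg]
        intro h
        apply hk
        ext
        simp only []
        omega
      · simp
  have h2 : (lowerMat n * shiftMat n) i j =
      if i = j then (((i : ℕ) + 1 : ℕ) : ℂ) * (n - ((i : ℕ) + 1 : ℕ)) else 0 := by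
    simp only [Matrix.mul_apply, shiftMat, lowerMat, Matrix.of_apply, mul_ite, mul_one, mul_zero]
    by_cases h0 : (i : ℕ) + 1 = n
    · rw [Finset.sum_eq_zero]
      · rw [h0]; simp
      · intro k _
        rw [if_neg (c := (k : ℕ) = (i : ℕ) + 1) (by have := k.isLt; omega)]
        simp
    · rw [Finset.sum_eq_single ⟨i + 1, by omega⟩]
      · simp only [Fin.ext_iff]
        by_cases h : (i : ℕ) = j <;> simp [h]
      · intro k _ hk
        rw [if_neg (c := (k : ℕ) = (i : ℕ) + 1)]
        · simp
        · intro h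
          exact hk (Fin.ext h)
      · simp
  rw [Matrix.sub_apply, h1, h2, Matrix.diagonal_apply]
  split_ifs with h
  · subst h
    push_cast
    ring
  · simp

lemma cornerMat_mul_lowerMat : cornerMat n * lowerMat n = 0 := by
  ext i j
  simp only [Matrix.mul_apply, cornerMat, lowerMat, Matrix.of_apply, Matrix.zero_apply]
  refine Finset.sum_eq_zero fun k _ => ?_
  have := j.isLt
  by_cases h : (j : ℕ) = k + 1
  · rw [if_neg (by omega), zero_mul]
  · rw [if_neg h, mul_zero]

lemma lowerMat_mul_cornerMat : lowerMat n * cornerMat n = 0 := by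
  ext i j
  simp only [Matrix.mul_apply, cornerMat, lowerMat, Matrix.of_apply, Matrix.zero_apply]
  refine Finset.sum_eq_zero fun k _ => ?_
  by_cases h : (k : ℕ) = i + 1
  · rw [if_neg (c := (k : ℕ) = 0 ∧ _) (by omega), mul_zero]
  · rw [if_neg h, zero_mul]

lemma shift_add_corner_eq_permMatrix :
    shiftMat n + cornerMat n = ((finRotate n).permMatrix ℂ).transpose := by
  ext i j
  have hi := i.isLt
  have hj := j.isLt
  obtain _ | d := n
  · exact i.elim0
  rw [Matrix.add_apply, Matrix.transpose_apply, Equiv.Perm.permMatrix, PEquiv.toMatrix_apply]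
  simp only [shiftMat, cornerMat, Matrix.of_apply, Equiv.toPEquiv_apply, Option.mem_some_iff,
    finRotate_apply, Fin.ext_iff, Fin.val_add_one]
  by_cases h : j = Fin.last d
  · subst h
    have : (i : ℕ) ≠ d + 1 := by omega
    simp [this, eq_comm]
  · have : (j : ℕ) ≠ d := fun h' => h (Fin.ext h')
    simp [this, eq_comm]

lemma shift_add_corner_normal :
    (shiftMat n + cornerMat n) * (shiftMat n + cornerMat n).transpose =
      (shiftMat n + cornerMat n).transpose * (shiftMat n + cornerMat n) := by
  rw [shift_add_corner_eq_permMatrix, Matrix.transpose_transpose, Matrix.transpose_permMatrix,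
    ← Matrix.permMatrix_mul, ← Matrix.permMatrix_mul, mul_inv_cancel, inv_mul_cancel]

/-- Weights for which `shiftMat n` and `lowerMat n` are adjoint. -/
def airyWeight (n : ℕ) (i : Fin n) : ℕ := (i : ℕ).factorial * (n - 1).descFactorial i

lemma airyWeight_pos (i : Fin n) : 0 < airyWeight n i :=
  Nat.mul_pos (Nat.factorial_pos _) (Nat.descFactorial_pos.2 (by omega))

lemma airyWeight_adjoint (i j : Fin n) :
    (airyWeight n i : ℂ) * shiftMat n i j = (airyWeight n j : ℂ) * lowerMat n j i := by
  simp only [shiftMat, lowerMat, Matrix.of_apply]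
  by_cases h : (i : ℕ) = j + 1
  · have hi := i.isLt
    rw [if_pos h, if_pos h, airyWeight, airyWeight, h, Nat.descFactorial_succ, Nat.factorial_succ]
    push_cast [Nat.cast_sub (show (j : ℕ) ≤ n - 1 by omega), Nat.cast_sub (show 1 ≤ n by omega)]
    ring
  · simp [h]

end AiryMatrices

section HermitianForms

variable {β : Type*} [Fintype β] [DecidableEq β] {ι : Type*} [Fintype ι]

lemma eq_zero_of_sum_weight_mul_star_eq_zero {α : Type*} [Fintype α] {w : α → ℕ}
    (hw : ∀ a, 0 < w a) {f : α → ℂ} (h : ∑ a, (w a : ℂ) * f a * star (f a) = 0) : f = 0 := by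
  have h1 : ∑ a, (w a : ℝ) * Complex.normSq (f a) = 0 := by
    rw [← Complex.ofReal_eq_zero, ← h]
    push_cast
    refine Finset.sum_congr rfl fun a _ => ?_
    rw [mul_assoc, Complex.star_def, Complex.mul_conj]
  rw [Finset.sum_eq_zero_iff_of_nonneg fun a _ =>
    mul_nonneg (Nat.cast_nonneg _) (Complex.normSq_nonneg _)] at h1
  funext a
  have h2 := h1 a (Finset.mem_univ a)
  have h3 : (w a : ℝ) ≠ 0 := by exact_mod_cast (hw a).ne'
  simpa [h3] using h2

lemma eq_zero_of_sum_mul_star_eq_zero {α : Type*} [Fintype α] {f : α → ℂ}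
    (h : ∑ a, f a * star (f a) = 0) : f = 0 :=
  eq_zero_of_sum_weight_mul_star_eq_zero (w := fun _ => 1) (fun _ => one_pos) (by simpa using h)

lemma derivAct_star {B : Matrix ι ι ℂ} (hB : ∀ i j, star (B i j) = B i j)
    (f : (β → ι) → ℂ) : derivAct B (star f) = star (derivAct B f) := by
  funext s
  simp only [derivAct_apply, Pi.star_apply, star_sum, star_mul', hB]

lemma sum_weight_derivAct_mul_star (ω : ι → ℕ) {A B : Matrix ι ι ℂ}
    (h : ∀ i j, (ω i : ℂ) * A i j = ω j * B j i) (hB : ∀ i j, star (B i j) = B i j)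
    (f g : (β → ι) → ℂ) :
    ∑ s, ((∏ b, ω (s b) : ℕ) : ℂ) * derivAct A f s * star (g s) =
      ∑ s, ((∏ b, ω (s b) : ℕ) : ℂ) * f s * star (derivAct B g s) := by
  have h1 := derivAct_adjoint (fun i => (ω i : ℂ)) h f (star g)
  rw [derivAct_star hB] at h1
  push_cast
  exact h1

lemma sum_derivAct_mul_star {A : Matrix ι ι ℂ} (hA : ∀ i j, star (A i j) = A i j)
    (f g : (β → ι) → ℂ) :
    ∑ s, derivAct A f s * star (g s) = ∑ s, f s * star (derivAct A.transpose g s) := by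
  simpa using sum_weight_derivAct_mul_star (fun _ => 1) (A := A) (B := A.transpose)
    (by simp) (fun i j => hA j i) f g

/-- A normal matrix and its adjoint have the same kernel on tensors. -/
lemma derivAct_transpose_eq_zero {A : Matrix ι ι ℂ} (hA : ∀ i j, star (A i j) = A i j)
    (hn : A * A.transpose = A.transpose * A) {f : (β → ι) → ℂ} (hf : derivAct A f = 0) :
    derivAct A.transpose f = 0 := by
  apply eq_zero_of_sum_mul_star_eq_zero
  have h1 := derivAct_commutator_apply A A.transpose f
  rw [hn, sub_self, hf, map_zero, sub_zero] at h1
  have h2 : derivAct A (derivAct A.transpose f) = 0 := by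
    rw [← h1]
    funext s
    simp [derivAct_apply]
  rw [← sum_derivAct_mul_star hA, h2]
  simp

end HermitianForms

section Rigidity

variable {β : Type*} [Fintype β] [DecidableEq β] {n : ℕ}

lemma star_shiftMat (i j : Fin n) : star (shiftMat n i j) = shiftMat n i j := by
  simp only [shiftMat, Matrix.of_apply]
  split_ifs <;> simp

lemma star_cornerMat (i j : Fin n) : star (cornerMat n i j) = cornerMat n i j := by
  simp only [cornerMat, Matrix.of_apply]
  split_ifs <;> simp

lemma star_lowerMat (i j : Fin n) : star (lowerMat n i j) = lowerMat n i j := by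
  simp only [lowerMat, Matrix.of_apply]
  split_ifs <;> simp

lemma star_shift_add_corner (i j : Fin n) :
    star ((shiftMat n + cornerMat n) i j) = (shiftMat n + cornerMat n) i j := by
  rw [Matrix.add_apply, star_add, star_shiftMat, star_cornerMat]

/-- The total degree of an index of a tensor coordinate. -/
def idxWeight (s : β → Fin n) : ℕ := ∑ b, (s b : ℕ)

lemma sum_update_add {γ : Type*} (w : γ → ℕ) (s : β → γ) (b : β) (j : γ) :
    ∑ c, w (Function.update s b j c) + w (s b) = ∑ c, w (s c) + w j := by
  have h1 := (Finset.add_sum_erase Finset.univ (fun c => w (s c)) (Finset.mem_univ b))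
  have h2 := (Finset.add_sum_erase Finset.univ
    (fun c => w (Function.update s b j c)) (Finset.mem_univ b))
  have h3 : ∑ c ∈ Finset.univ.erase b, w (Function.update s b j c) =
      ∑ c ∈ Finset.univ.erase b, w (s c) :=
    Finset.sum_congr rfl fun c hc => by rw [Function.update_of_ne (Finset.ne_of_mem_erase hc)]
  simp only [Function.update_self] at h2
  omega

lemma idxWeight_update (s : β → Fin n) (b : β) (j : Fin n) :
    idxWeight (Function.update s b j) + s b = idxWeight s + j :=
  sum_update_add (fun i : Fin n => (i : ℕ)) s b j

lemma shiftMat_lowerMat_commutator_apply (f : (β → Fin n) → ℂ) (s : β → Fin n) :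
    derivAct (shiftMat n) (derivAct (lowerMat n) f) s -
      derivAct (lowerMat n) (derivAct (shiftMat n) f) s =
      (2 * (idxWeight s : ℂ) - Fintype.card β * ((n : ℂ) - 1)) * f s := by
  have h := congrFun (derivAct_commutator_apply (shiftMat n) (lowerMat n) f) s
  rw [shiftMat_lowerMat_commutator, derivAct_diagonal] at h
  rw [Pi.sub_apply] at h
  rw [← h, idxWeight]
  congr 1
  simp only [Finset.sum_sub_distrib, Finset.mul_sum, Finset.sum_const, Finset.card_univ,
    nsmul_eq_mul, Nat.cast_sum]
  ring

lemma cornerMat_lowerMat_comm (f : (β → Fin n) → ℂ) :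
    derivAct (lowerMat n) (derivAct (cornerMat n) f) =
      derivAct (cornerMat n) (derivAct (lowerMat n) f) := by
  have h := derivAct_commutator_apply (lowerMat n) (cornerMat n) f
  rw [cornerMat_mul_lowerMat, lowerMat_mul_cornerMat, sub_zero] at h
  rw [← sub_eq_zero, ← h]
  funext s
  simp [derivAct_apply]

/-- The traceless grading operator has zero expectation on the kernel of the cyclic matrix. -/
lemma sum_idxWeight_mul_star_eq_zero {x : (β → Fin n) → ℂ}
    (hx : derivAct (shiftMat n + cornerMat n) x = 0) :
    ∑ s, (2 * (idxWeight s : ℂ) - Fintype.card β * ((n : ℂ) - 1)) * x s * star (x s) = 0 := by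
  have hT := derivAct_transpose_eq_zero star_shift_add_corner shift_add_corner_normal hx
  have h1 : ∀ s, (2 * (idxWeight s : ℂ) - Fintype.card β * ((n : ℂ) - 1)) * x s =
      derivAct (shiftMat n + cornerMat n) (derivAct (lowerMat n) x) s := by
    intro s
    have h2 := shiftMat_lowerMat_commutator_apply x s
    have h3 := congrFun (cornerMat_lowerMat_comm x) s
    have h4 := congrFun (congrArg (derivAct (lowerMat n)) hx) s
    rw [derivAct_add, LinearMap.add_apply, map_add, map_zero] at h4
    rw [derivAct_add, LinearMap.add_apply]
    simp only [Pi.add_apply, Pi.zero_apply] at h4 ⊢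
    linear_combination -h2 + h3 - h4
  simp only [h1]
  rw [sum_derivAct_mul_star star_shift_add_corner, hT]
  simp

/-- The part of `x` of weight `w`. -/
def weightPart (x : (β → Fin n) → ℂ) (w : ℕ) : (β → Fin n) → ℂ :=
  fun s => if idxWeight s = w then x s else 0

lemma derivAct_weightPart {A : Matrix (Fin n) (Fin n) ℂ} {p q : ℕ}
    (hA : ∀ i j, A i j ≠ 0 → (i : ℕ) + q = j + p) (x : (β → Fin n) → ℂ) (w : ℕ)
    (s : β → Fin n) :
    derivAct A (weightPart x w) s = if idxWeight s + q = w + p then derivAct A x s else 0 := by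
  have h : ∀ b j, A (s b) j * weightPart x w (Function.update s b j) =
      if idxWeight s + q = w + p then A (s b) j * x (Function.update s b j) else 0 := by
    intro b j
    by_cases h0 : A (s b) j = 0
    · simp [h0]
    · have h1 := hA _ _ h0
      have h2 := idxWeight_update s b j
      unfold weightPart
      by_cases h3 : idxWeight s + q = w + p
      · rw [if_pos h3, if_pos (by omega)]
      · rw [if_neg h3, if_neg (by omega), mul_zero]
  simp only [derivAct_apply, h]
  split_ifs <;> simp

lemma shift_weightPart_add_corner_weightPart (hn : 0 < n) {x : (β → Fin n) → ℂ}
    (hx : derivAct (shiftMat n + cornerMat n) x = 0) (w : ℕ) :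
    derivAct (shiftMat n) (weightPart x w) + derivAct (cornerMat n) (weightPart x (w + n)) = 0 := by
  funext s
  have h1 := congrFun hx s
  rw [derivAct_add, LinearMap.add_apply] at h1
  simp only [Pi.add_apply, Pi.zero_apply] at h1 ⊢
  have h2 : derivAct (shiftMat n) (weightPart x w) s =
      if idxWeight s = w + 1 then derivAct (shiftMat n) x s else 0 := by
    rw [derivAct_weightPart (p := 1) (q := 0), add_zero]
    intro i j hij
    by_contra h
    exact hij (if_neg h)
  have h3 : derivAct (cornerMat n) (weightPart x (w + n)) s =
      if idxWeight s = w + 1 then derivAct (cornerMat n) x s else 0 := by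
    rw [derivAct_weightPart (p := 0) (q := n - 1)]
    · congr 1
      rw [eq_iff_iff]
      omega
    · intro i j hij
      by_contra h
      exact hij (if_neg (by omega))
  rw [h2, h3]
  split_ifs
  · exact h1
  · simp

lemma prod_airyWeight_pos {γ : Type*} [Fintype γ] (s : γ → Fin n) : 0 < ∏ b, airyWeight n (s b) :=
  Finset.prod_pos fun _ _ => airyWeight_pos _

/-- A vector of weight `w ≤ 0` (for the traceless grading) with `e⁺ e y = 0` is killed by `e` and
by `e⁺`, and it vanishes if `w < 0`. -/
lemma weight_vector_of_lower_shift_eq_zero {y : (β → Fin n) → ℂ} {w : ℕ}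
    (hw : 2 * (w : ℝ) ≤ Fintype.card β * ((n : ℝ) - 1))
    (hy : ∀ s, y s ≠ 0 → idxWeight s = w)
    (h : derivAct (lowerMat n) (derivAct (shiftMat n) y) = 0) :
    derivAct (shiftMat n) y = 0 ∧ derivAct (lowerMat n) y = 0 ∧
      (2 * (w : ℝ) < Fintype.card β * ((n : ℝ) - 1) → y = 0) := by
  have he : derivAct (shiftMat n) y = 0 := by
    apply eq_zero_of_sum_weight_mul_star_eq_zero prod_airyWeight_pos
    rw [sum_weight_derivAct_mul_star (airyWeight n) airyWeight_adjoint star_lowerMat, h]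
    simp
  have h1 : ∀ s, derivAct (shiftMat n) (derivAct (lowerMat n) y) s =
      ((2 * (w : ℝ) - Fintype.card β * ((n : ℝ) - 1) : ℝ) : ℂ) * y s := by
    intro s
    have h2 := shiftMat_lowerMat_commutator_apply y s
    rw [he, map_zero, Pi.zero_apply, sub_zero] at h2
    rw [h2]
    by_cases h3 : y s = 0
    · simp [h3]
    · rw [hy s h3]
      push_cast
      rfl
  have h2 := sum_weight_derivAct_mul_star (airyWeight n) airyWeight_adjoint star_lowerMat
    (derivAct (lowerMat n) y) y
  simp only [h1] at h2
  have h3 : ∑ s : β → Fin n, ((∏ b, airyWeight n (s b) : ℕ) : ℝ) *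
        Complex.normSq (derivAct (lowerMat n) y s) =
      (2 * (w : ℝ) - Fintype.card β * ((n : ℝ) - 1)) *
        ∑ s : β → Fin n, ((∏ b, airyWeight n (s b) : ℕ) : ℝ) * Complex.normSq (y s) := by
    rw [← Complex.ofReal_inj, Complex.ofReal_mul, Complex.ofReal_sum, Complex.ofReal_sum,
      Finset.mul_sum]
    simp only [Complex.ofReal_mul (_ : ℝ) (Complex.normSq _), ← Complex.mul_conj,
      Complex.ofReal_natCast, ← Complex.star_def]
    simp only [← mul_assoc]
    rw [← h2]
    exact Finset.sum_congr rfl fun s _ => by ring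
  have hz : ∀ f : (β → Fin n) → ℂ, ∑ s, ((∏ b, airyWeight n (s b) : ℕ) : ℝ) *
      Complex.normSq (f s) = 0 → f = 0 := by
    intro f hf
    apply eq_zero_of_sum_weight_mul_star_eq_zero (prod_airyWeight_pos (γ := β) (n := n))
    have h4 := congrArg (fun r : ℝ => (r : ℂ)) hf
    simpa only [Complex.ofReal_sum, Complex.ofReal_mul (_ : ℝ) (Complex.normSq _),
      ← Complex.mul_conj, Complex.ofReal_natCast, ← Complex.star_def, ← mul_assoc,
      Complex.ofReal_zero] using h4
  have hnn : ∀ f : (β → Fin n) → ℂ, 0 ≤ ∑ s, ((∏ b, airyWeight n (s b) : ℕ) : ℝ) *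
      Complex.normSq (f s) := fun f =>
    Finset.sum_nonneg fun s _ => mul_nonneg (Nat.cast_nonneg _) (Complex.normSq_nonneg _)
  refine ⟨he, hz _ ?_, fun hlt => hz _ ?_⟩
  · nlinarith [hnn y, hnn (derivAct (lowerMat n) y)]
  · nlinarith [hnn y, hnn (derivAct (lowerMat n) y)]

lemma weightPart_weight {γ : Type*} [Fintype γ] {x : (γ → Fin n) → ℂ} {w : ℕ} {s : γ → Fin n}
    (h : weightPart x w s ≠ 0) : idxWeight s = w := by
  by_contra h'
  exact h (if_neg h')

/-- A vector of nonpositive weights in the kernel of the cyclic matrix has weight zero, and is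
killed by the two pieces of the cyclic matrix. -/
lemma weight_zero_of_cyclic_eq_zero (hn : 0 < n) {x : (β → Fin n) → ℂ}
    (hx : derivAct (shiftMat n + cornerMat n) x = 0) {M : ℕ}
    (hM : 2 * (M : ℝ) = Fintype.card β * ((n : ℝ) - 1)) (hxM : ∀ s, x s ≠ 0 → idxWeight s ≤ M) :
    (∀ s, x s ≠ 0 → idxWeight s = M) ∧ derivAct (shiftMat n) x = 0 ∧
      derivAct (cornerMat n) x = 0 := by
  have hbig : ∀ w, M < w → weightPart x w = 0 := by
    intro w hw
    funext s
    by_contra h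
    have h1 := weightPart_weight h
    have h2 : x s ≠ 0 := by
      rintro h3
      exact h (by simp [weightPart, h3])
    have := hxM s h2
    omega
  have key : ∀ d w, M < w + d → derivAct (lowerMat n) (weightPart x w) = 0 ∧
      (w < M → weightPart x w = 0) := by
    intro d
    induction d with
    | zero =>
      intro w hw
      rw [hbig w hw]
      simp
    | succ d ih =>
      intro w hw
      by_cases hwM : w ≤ M
      · have h1 := (ih (w + n) (by omega)).1
        have h2 := shift_weightPart_add_corner_weightPart hn hx w
        have h3 := congrArg (derivAct (lowerMat n)) h2
        rw [map_add, cornerMat_lowerMat_comm, h1, map_zero, map_zero, add_zero] at h3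
        have hw' : (w : ℝ) ≤ M := by exact_mod_cast hwM
        obtain ⟨-, h4, h5⟩ := weight_vector_of_lower_shift_eq_zero (w := w) (by linarith)
          (fun s => weightPart_weight) h3
        refine ⟨h4, fun hlt => h5 ?_⟩
        have : (w : ℝ) < M := by exact_mod_cast hlt
        linarith
      · rw [hbig w (by omega)]
        simp
  have hxe : x = weightPart x M := by
    funext s
    unfold weightPart
    split_ifs with h
    · rfl
    · by_contra h1
      have h2 := hxM s h1
      have h3 := congrFun ((key (M + 1) (idxWeight s) (by omega)).2 (by omega)) s
      simp only [weightPart, if_true, Pi.zero_apply] at h3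
      exact h1 h3
  have he : derivAct (shiftMat n) x = 0 := by
    have h2 := shift_weightPart_add_corner_weightPart hn hx M
    rwa [hbig (M + n) (by omega), map_zero, add_zero, ← hxe] at h2
  refine ⟨fun s hs => weightPart_weight (x := x) (by rwa [← hxe]), he, ?_⟩
  rw [derivAct_add, LinearMap.add_apply, he, zero_add] at hx
  exact hx

end Rigidity

section ConstantSolutions

variable {β : Type*} [Fintype β] [DecidableEq β] {n : ℕ}

lemma coeff_derivAct_map_C {ι : Type*} [Fintype ι] (A : Matrix ι ι ℂ) (p : (β → ι) → ℂ[X])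
    (s : β → ι) (N : ℕ) :
    (derivAct (A.map C) p s).coeff N = derivAct A (fun t => (p t).coeff N) s := by
  simp [derivAct_apply]

/-- The substitution `z = X ^ n` with the gauge transformation that makes the generalized Airy
connection homogeneous. -/
noncomputable def cyclicGauge (l : (β → Fin n) → ℂ[X]) (s : β → Fin n) : ℂ[X] :=
  X ^ idxWeight s * expand ℂ n (l s)

lemma expand_airyMat_mul (s : β → Fin n) (b : β) (j : Fin n) :
    X ^ idxWeight s * expand ℂ n (airyMat n (s b) j) =
      X * (C ((shiftMat n + cornerMat n) (s b) j) * X ^ idxWeight (Function.update s b j)) := by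
  have h := idxWeight_update s b j
  rw [airyMat_apply, Matrix.add_apply, map_add, map_mul, expand_C, expand_C, expand_X, C_add]
  by_cases h1 : ((s b : Fin n) : ℕ) = j + 1
  · have h2 : idxWeight s = idxWeight (Function.update s b j) + 1 := by omega
    have h3 : cornerMat n (s b) j = 0 := if_neg (by omega)
    rw [h2, h3]
    simp only [C_0]
    ring
  · have h3 : shiftMat n (s b) j = 0 := if_neg h1
    rw [h3]
    by_cases h4 : ((s b : Fin n) : ℕ) = 0 ∧ (j : ℕ) + 1 = n
    · have h2 : idxWeight s + n = idxWeight (Function.update s b j) + 1 := by omega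
      simp only [C_0, zero_add]
      linear_combination C (cornerMat n (s b) j) * congrArg (fun m => (X : ℂ[X]) ^ m) h2
    · have h5 : cornerMat n (s b) j = 0 := if_neg h4
      simp [h5]

lemma cyclicGauge_equation (hn : 0 < n) {l : (β → Fin n) → ℂ[X]} {τ : ℂ[X]}
    (hl : ∀ s, derivative (l s) + derivAct (airyMat n) l s = τ * l s) (s : β → Fin n) :
    X * derivative (cyclicGauge l s) + (n : ℂ[X]) * derivAct ((shiftMat n + cornerMat n).map C)
      (fun t => X ^ (n + 1) * cyclicGauge l t) s =
    (idxWeight s : ℂ[X]) * cyclicGauge l s +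
      (n : ℂ[X]) * (X ^ n * (expand ℂ n τ * cyclicGauge l s)) := by
  have h1 : X ^ idxWeight s * expand ℂ n (derivAct (airyMat n) l s) * X ^ n =
      derivAct ((shiftMat n + cornerMat n).map C) (fun t => X ^ (n + 1) * cyclicGauge l t) s := by
    simp only [derivAct_apply, map_sum, Finset.mul_sum, Finset.sum_mul, map_mul]
    refine Finset.sum_congr rfl fun b _ => Finset.sum_congr rfl fun j _ => ?_
    rw [Matrix.map_apply, cyclicGauge]
    linear_combination expand ℂ n (l (Function.update s b j)) * X ^ n * expand_airyMat_mul s b j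
  have h2 := congrArg (expand ℂ n) (hl s)
  rw [map_add, map_mul] at h2
  have h3 : (X : ℂ[X]) * X ^ (n - 1) = X ^ n := mul_pow_sub_one hn.ne' X
  have h4 : X * derivative ((X : ℂ[X]) ^ idxWeight s) =
      (idxWeight s : ℂ[X]) * X ^ idxWeight s := by
    rcases Nat.eq_zero_or_pos (idxWeight s) with h | h
    · simp [h]
    · rw [derivative_X_pow, ← mul_pow_sub_one h.ne' (X : ℂ[X])]
      simp only [map_natCast]
      ring
  rw [← h1, cyclicGauge, derivative_mul, derivative_expand]
  linear_combination expand ℂ n (l s) * h4 + (n : ℂ[X]) * X ^ n * X ^ idxWeight s * h2 +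
    (n : ℂ[X]) * X ^ idxWeight s * expand ℂ n (derivative (l s)) * h3

lemma cyclicGauge_top_degree (hn : 2 ≤ n) {l : (β → Fin n) → ℂ[X]} {τ : ℂ[X]}
    (hl : ∀ s, derivative (l s) + derivAct (airyMat n) l s = τ * l s) {M : ℕ}
    (hM : ∀ s N, M < N → (cyclicGauge l s).coeff N = 0)
    (hM0 : (fun s => (cyclicGauge l s).coeff M) ≠ 0) :
    τ = 0 ∧ derivAct (shiftMat n + cornerMat n) (fun s => (cyclicGauge l s).coeff M) = 0 ∧
      2 * (M : ℝ) = Fintype.card β * ((n : ℝ) - 1) := by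
  set x : (β → Fin n) → ℂ := fun s => (cyclicGauge l s).coeff M with hx
  have hn0 : (n : ℂ) ≠ 0 := by exact_mod_cast (show n ≠ 0 by omega)
  have key : ∀ (N : ℕ) s, (N : ℂ) * (cyclicGauge l s).coeff N + n * derivAct (shiftMat n + cornerMat n)
      (fun t => (X ^ (n + 1) * cyclicGauge l t).coeff N) s =
      idxWeight s * (cyclicGauge l s).coeff N +
        n * (X ^ n * (expand ℂ n τ * cyclicGauge l s)).coeff N := by
    intro N s
    have h1 := congrArg (fun q : ℂ[X] => q.coeff N) (cyclicGauge_equation (by omega) hl s)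
    simp only [coeff_add, coeff_natCast_mul, coeff_derivAct_map_C] at h1
    rw [← h1]
    congr 1
    rcases N with _ | N
    · simp
    · rw [coeff_X_mul, coeff_derivative]
      push_cast
      ring
  have hzero : ∀ m N, M + m < N → (fun t : β → Fin n => (X ^ m * cyclicGauge l t).coeff N) = 0 := by
    intro m N hN
    funext t
    rw [coeff_X_pow_mul', if_pos (by omega), hM _ _ (by omega)]
    rfl
  have hdeg : τ.natDegree = 0 := by
    by_contra hd
    apply hM0
    funext s
    have hG : n ≤ (expand ℂ n τ).natDegree := by
      rw [natDegree_expand]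
      exact Nat.le_mul_of_pos_left _ (Nat.pos_of_ne_zero hd)
    have h1 := key (M + n + (expand ℂ n τ).natDegree) s
    rw [hM _ _ (by omega), hzero _ _ (by omega), map_zero, Pi.zero_apply, mul_zero, mul_zero,
      mul_zero, zero_add, zero_add, show M + n + (expand ℂ n τ).natDegree =
      ((expand ℂ n τ).natDegree + M) + n by omega, coeff_X_pow_mul,
      coeff_mul_add_eq_of_natDegree_le le_rfl (natDegree_le_iff_coeff_eq_zero.2 (hM s))] at h1
    have h2 : expand ℂ n τ ≠ 0 := by
      rw [Ne, expand_eq_zero (by omega)]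
      rintro rfl
      simp at hd
    simpa [hn0, h2] using h1.symm
  obtain ⟨t, rfl⟩ := natDegree_eq_zero.1 hdeg
  simp only [expand_C, mul_left_comm _ (C t), coeff_C_mul] at key
  have hcx : derivAct (shiftMat n + cornerMat n) x = 0 := by
    funext s
    have h1 := key (M + (n + 1)) s
    simp only [coeff_X_pow_mul] at h1
    have h2 : (X ^ n * cyclicGauge l s).coeff (M + (n + 1)) = 0 :=
      congrFun (hzero n (M + (n + 1)) (by omega)) s
    rw [hM _ _ (by omega), h2] at h1
    simpa [hn0] using h1
  have hnx : ∑ s, x s * star (x s) ≠ 0 := fun h => hM0 (eq_zero_of_sum_mul_star_eq_zero h)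
  have hT := derivAct_transpose_eq_zero star_shift_add_corner shift_add_corner_normal hcx
  have hpair : ∀ y : (β → Fin n) → ℂ,
      ∑ s, derivAct (shiftMat n + cornerMat n) y s * star (x s) = 0 := by
    intro y
    rw [sum_derivAct_mul_star star_shift_add_corner, hT]
    simp
  have ht : t = 0 := by
    have h1 := hpair fun u => (X ^ (n + 1) * cyclicGauge l u).coeff (M + n)
    have h2 : ∀ s, derivAct (shiftMat n + cornerMat n)
        (fun u => (X ^ (n + 1) * cyclicGauge l u).coeff (M + n)) s = t * x s := by
      intro s
      have h3 := key (M + n) s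
      rw [hM _ _ (by omega), coeff_X_pow_mul] at h3
      apply mul_left_cancel₀ hn0
      linear_combination h3
    simp only [h2, mul_assoc, ← Finset.mul_sum] at h1
    exact (mul_eq_zero.1 h1).resolve_right hnx
  subst ht
  refine ⟨C_0, hcx, ?_⟩
  have h1 := hpair fun u => (n : ℂ) * (X ^ (n + 1) * cyclicGauge l u).coeff M
  have h2 : ∀ s, derivAct (shiftMat n + cornerMat n)
      (fun u => (n : ℂ) * (X ^ (n + 1) * cyclicGauge l u).coeff M) s =
      ((idxWeight s : ℂ) - M) * x s := by
    intro s
    have h3 := key M s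
    have h4 := congrFun (map_smul (derivAct (shiftMat n + cornerMat n)) (n : ℂ)
      fun u : β → Fin n => (X ^ (n + 1) * cyclicGauge l u).coeff M) s
    change _ = (n : ℂ) * _ at h4
    refine h4.trans ?_
    linear_combination h3
  simp only [h2] at h1
  have h3 := sum_idxWeight_mul_star_eq_zero hcx
  have h4 : (2 * (M : ℂ) - Fintype.card β * ((n : ℂ) - 1)) * ∑ s, x s * star (x s) = 0 := by
    rw [← h3, ← sub_eq_zero, Finset.mul_sum, ← Finset.sum_sub_distrib, ← mul_zero (-2 : ℂ), ← h1,
      Finset.mul_sum]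
    exact Finset.sum_congr rfl fun s _ => by ring
  have h5 := sub_eq_zero.1 ((mul_eq_zero.1 h4).resolve_right hnx)
  exact_mod_cast h5

lemma exists_cyclicGauge_top (hn : 0 < n) {l : (β → Fin n) → ℂ[X]} (hl : l ≠ 0) :
    ∃ M, (∀ s N, M < N → (cyclicGauge l s).coeff N = 0) ∧
      (fun s => (cyclicGauge l s).coeff M) ≠ 0 := by
  obtain ⟨s₀, hs₀⟩ := Function.ne_iff.1 hl
  have hg : ∀ s, cyclicGauge l s = 0 → l s = 0 := fun s h => by
    rcases mul_eq_zero.1 h with h1 | h1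
    · exact absurd h1 (pow_ne_zero _ X_ne_zero)
    · exact (expand_eq_zero hn).1 h1
  obtain ⟨s, -, hs⟩ := Finset.exists_max_image Finset.univ
    (fun s => (cyclicGauge l s).degree) ⟨s₀, Finset.mem_univ _⟩
  have hs1 : cyclicGauge l s ≠ 0 := by
    intro h
    have h1 := hs s₀ (Finset.mem_univ _)
    rw [h, degree_zero, le_bot_iff, degree_eq_bot] at h1
    exact hs₀ (hg _ h1)
  refine ⟨(cyclicGauge l s).natDegree, fun t N hN => ?_, fun h => ?_⟩
  · exact coeff_eq_zero_of_degree_lt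
      (((hs t (Finset.mem_univ _)).trans degree_le_natDegree).trans_lt (by exact_mod_cast hN))
  · have h1 := congrFun h s
    rw [Pi.zero_apply, coeff_natDegree, leadingCoeff_eq_zero] at h1
    exact hs1 h1

lemma cyclicGauge_coeff_eq_zero {γ : Type*} [Fintype γ] (l : (γ → Fin n) → ℂ[X]) (s : γ → Fin n)
    {N : ℕ}
    (hN : N < idxWeight s) : (cyclicGauge l s).coeff N = 0 := by
  rw [cyclicGauge, coeff_X_pow_mul', if_neg (by omega)]

lemma derivAct_airyMat_C (x : (β → Fin n) → ℂ) (s : β → Fin n) :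
    derivAct (airyMat n) (fun t => C (x t)) s =
      C (derivAct (shiftMat n) x s) + X * C (derivAct (cornerMat n) x s) := by
  simp only [derivAct_apply, airyMat_apply, map_sum, C_mul, Finset.mul_sum]
  rw [← Finset.sum_add_distrib]
  refine Finset.sum_congr rfl fun b _ => ?_
  rw [← Finset.sum_add_distrib]
  exact Finset.sum_congr rfl fun j _ => by ring

/-- A rank one submodule of a tensor power of the generalized Airy connection that is stable under
the connection is spanned by a constant vector. -/
theorem exists_eq_C_of_airy_eigenvector (hn : 2 ≤ n) {l : (β → Fin n) → ℂ[X]} {τ : ℂ[X]}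
    (hl : ∀ s, derivative (l s) + derivAct (airyMat n) l s = τ * l s) :
    ∃ x : (β → Fin n) → ℂ, ∀ s, l s = C (x s) := by
  by_cases hl0 : l = 0
  · exact ⟨0, by simp [hl0]⟩
  obtain ⟨M, hM, hM0⟩ := exists_cyclicGauge_top (by omega) hl0
  obtain ⟨hτ, hcx, hMn⟩ := cyclicGauge_top_degree hn hl hM hM0
  set x : (β → Fin n) → ℂ := fun s => (cyclicGauge l s).coeff M with hx
  obtain ⟨hw, he, hF⟩ := weight_zero_of_cyclic_eq_zero (by omega) hcx hMn fun s hs => by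
    by_contra h
    exact hs (cyclicGauge_coeff_eq_zero l s (by omega))
  have hgx : ∀ s, cyclicGauge (fun t => C (x t)) s = X ^ M * C (x s) := by
    intro s
    rw [cyclicGauge, expand_C]
    by_cases h : x s = 0
    · simp [h]
    · rw [hw s h]
  have hgl : ∀ s, cyclicGauge (fun t => l t - C (x t)) s = cyclicGauge l s - X ^ M * C (x s) := by
    intro s
    rw [← hgx]
    simp only [cyclicGauge, map_sub, mul_sub]
  refine ⟨x, ?_⟩
  by_contra! hne
  have hd0 : (fun t => l t - C (x t)) ≠ 0 := by
    obtain ⟨s, hs⟩ := hne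
    exact fun h => hs (sub_eq_zero.1 (congrFun h s))
  have hd : ∀ s, derivative (l s - C (x s)) + derivAct (airyMat n) (fun t => l t - C (x t)) s =
      0 * (l s - C (x s)) := by
    intro s
    have h1 := congrFun (map_sub (derivAct (airyMat n)) l fun t => C (x t)) s
    change derivAct (airyMat n) (fun t => l t - C (x t)) s = _ at h1
    rw [h1, Pi.sub_apply, derivAct_airyMat_C, he, hF]
    have h2 := hl s
    rw [hτ] at h2
    simpa using h2
  obtain ⟨M', hM', hM0'⟩ := exists_cyclicGauge_top (by omega) hd0
  obtain ⟨-, -, hMn'⟩ := cyclicGauge_top_degree hn hd hM' hM0'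
  have hMM : M' = M := by
    have : (M' : ℝ) = M := by linarith
    exact_mod_cast this
  subst hMM
  apply hM0'
  funext s
  rw [hgl, coeff_sub, coeff_X_pow_mul', if_pos le_rfl, Nat.sub_self, coeff_C_zero]
  exact sub_self _

end ConstantSolutions

section Determinants

variable {m : Type*} [Fintype m] [DecidableEq m]

lemma Matrix.det_updateRow_apply {R : Type*} [CommRing R] (M : Matrix m m R) (p : m) (v : m → R) :
    (M.updateRow p v).det = ∑ j, M.adjugate j p * v j := by
  rw [← Matrix.cramer_transpose_apply, Matrix.cramer_eq_adjugate_mulVec,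
    ← Matrix.adjugate_transpose]
  rfl

lemma Matrix.sum_det_updateRow_mul {R : Type*} [CommRing R] (M B : Matrix m m R) :
    ∑ p, (M.updateRow p ((M * B) p)).det = B.trace * M.det := by
  simp only [Matrix.det_updateRow_apply]
  rw [Finset.sum_comm]
  change (M.adjugate * (M * B)).trace = _
  rw [← Matrix.mul_assoc, Matrix.adjugate_mul, Matrix.smul_mul, Matrix.one_mul, Matrix.trace_smul,
    smul_eq_mul, mul_comm]

lemma Matrix.derivative_det_eq_sum (M : Matrix m m ℂ[X]) :
    derivative M.det = ∑ p, (M.updateRow p fun j => derivative (M p j)).det := by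
  have h : ∀ A : Matrix m m ℂ[X], A.det =
      ∑ σ : Equiv.Perm m, ((Equiv.Perm.sign σ : ℤ) : ℂ[X]) * ∏ i, A i (σ i) := fun A => by
    rw [← Matrix.det_transpose, Matrix.det_apply']
    rfl
  simp only [h, derivative_sum]
  rw [Finset.sum_comm]
  refine Finset.sum_congr rfl fun σ _ => ?_
  rw [derivative_intCast_mul, derivative_prod_finset, Finset.mul_sum]
  refine Finset.sum_congr rfl fun p _ => ?_
  rw [← Finset.mul_prod_erase _ _ (Finset.mem_univ p), Matrix.updateRow_self, mul_comm (derivative _)]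
  congr 2
  refine Finset.prod_congr rfl fun i hi => ?_
  rw [Matrix.updateRow_ne (Finset.ne_of_mem_erase hi)]

lemma Matrix.exists_det_submatrix_ne_zero {K S : Type*} [Field K] [Fintype S]
    {A : Matrix S m K} (hA : LinearIndependent K A.col) : ∃ σ : m → S, (A.submatrix σ id).det ≠ 0 := by
  classical
  obtain ⟨g, hg⟩ := LinearMap.exists_leftInverse_of_injective (Matrix.toLin' A)
    (LinearMap.ker_eq_bot.2 (Matrix.mulVec_injective_iff.2 hA))
  have hL : LinearMap.toMatrix' g * A = 1 := by
    rw [← LinearMap.toMatrix'_toLin' A, ← LinearMap.toMatrix'_comp, hg, LinearMap.toMatrix'_id]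
  set L := LinearMap.toMatrix' g
  by_contra! h
  have h1 : (L * A).det = ∑ σ : m → S, (∏ i, L i (σ i)) * (A.submatrix σ id).det := by
    have h2 : L * A = Matrix.of fun i => ∑ s, L i s • A s := by
      ext i j
      simp [Matrix.mul_apply]
    rw [h2]
    have h3 := (Matrix.detRowAlternating (R := K) (n := m)).toMultilinearMap.map_sum
      fun i s => L i s • A s
    refine h3.trans (Finset.sum_congr rfl fun σ _ => ?_)
    exact (Matrix.detRowAlternating (R := K) (n := m)).toMultilinearMap.map_smul_univ _ _
  rw [hL, Matrix.det_one] at h1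
  simp [h] at h1

lemma exists_det_ne_zero_of_linearIndependent {R S : Type*} [CommRing R] [IsDomain R] [Fintype S]
    {q : m → S → R} (hq : LinearIndependent R q) :
    ∃ σ : m → S, (Matrix.of fun p j => q j (σ p)).det ≠ 0 := by
  have h1 : LinearIndependent (FractionRing R)
      fun j s => algebraMap R (FractionRing R) (q j s) := by
    rw [← LinearIndependent.iff_fractionRing R]
    refine hq.map' ((Algebra.linearMap R (FractionRing R)).compLeft S) ?_
    rw [LinearMap.ker_eq_bot]
    exact (IsFractionRing.injective R (FractionRing R)).comp_left
  obtain ⟨σ, hσ⟩ := Matrix.exists_det_submatrix_ne_zero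
    (A := Matrix.of fun s j => algebraMap R (FractionRing R) (q j s)) h1
  refine ⟨σ, fun h => hσ ?_⟩
  have h2 := congrArg (algebraMap R (FractionRing R)) h
  rw [RingHom.map_det, map_zero] at h2
  exact h2

end Determinants

section PluckerCoordinates

variable {β ι m : Type*} [Fintype β] [DecidableEq β] [Fintype ι] [Fintype m] [DecidableEq m]

/-- The Plücker coordinates of a family of tensors. -/
noncomputable def plucker {R : Type*} [CommRing R] (q : m → (β → ι) → R) (t : m × β → ι) : R :=
  (Matrix.of fun p j => q j fun b => t (p, b)).det

lemma curry_update {β ι m : Type*} [DecidableEq β] [DecidableEq m] (t : m × β → ι) (p p' : m) (b : β) (i : ι) :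
    (fun c => Function.update t (p, b) i (p', c)) =
      Function.update (fun p c => t (p, c)) p (Function.update (fun c => t (p, c)) b i) p' := by
  funext c
  by_cases h : p' = p
  · subst h
    by_cases h1 : c = b
    · subst h1
      simp
    · simp [h1]
  · simp [h]

lemma plucker_update {R β ι : Type*} [CommRing R] (q : m → (β → ι) → R) (t : m → β → ι)
    (p : m) (s : β → ι) : plucker q (fun x => Function.update t p s x.1 x.2) =
      ((Matrix.of fun p j => q j (t p)).updateRow p fun j => q j s).det := by
  unfold plucker
  congr 1
  ext p' j
  by_cases h : p' = p
  · subst h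
    simp
  · simp [h]

lemma derivAct_plucker {R : Type*} [CommRing R] (E : Matrix ι ι R) (q : m → (β → ι) → R)
    (t : m × β → ι) :
    derivAct E (plucker q) t = ∑ p, ((Matrix.of fun p j => q j fun b => t (p, b)).updateRow p
      fun j => derivAct E (q j) fun b => t (p, b)).det := by
  rw [derivAct_apply, Fintype.sum_prod_type]
  refine Finset.sum_congr rfl fun p _ => ?_
  rw [Matrix.det_updateRow_apply]
  simp only [derivAct_apply, Finset.mul_sum]
  refine Eq.trans ?_ Finset.sum_comm
  refine Finset.sum_congr rfl fun b _ => ?_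
  refine Eq.trans ?_ Finset.sum_comm
  refine Finset.sum_congr rfl fun i _ => ?_
  have h := plucker_update q (fun p c => t (p, c)) p (Function.update (fun c => t (p, c)) b i)
  have h1 : (fun x : m × β => Function.update (fun p c => t (p, c)) p
      (Function.update (fun c => t (p, c)) b i) x.1 x.2) = Function.update t (p, b) i := by
    funext x
    exact (congrFun (curry_update t p x.1 b i) x.2).symm
  rw [h1, Matrix.det_updateRow_apply] at h
  rw [h, Finset.mul_sum]
  exact Finset.sum_congr rfl fun j _ => by ring

lemma plucker_equation (E : Matrix ι ι ℂ[X]) {q : m → (β → ι) → ℂ[X]} {B : Matrix m m ℂ[X]}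
    (hq : ∀ j s, derivative (q j s) + derivAct E (q j) s = ∑ i, q i s * B i j) (t : m × β → ι) :
    derivative (plucker q t) + derivAct E (plucker q) t = B.trace * plucker q t := by
  rw [derivAct_plucker, plucker, Matrix.derivative_det_eq_sum, ← Finset.sum_add_distrib,
    ← Matrix.sum_det_updateRow_mul]
  refine Finset.sum_congr rfl fun p _ => ?_
  simp only [Matrix.det_updateRow_apply]
  rw [← Finset.sum_add_distrib]
  refine Finset.sum_congr rfl fun j _ => ?_
  rw [← mul_add, Matrix.of_apply, hq, Matrix.mul_apply]
  rfl

end PluckerCoordinates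

section ConstantTensors

variable {β : Type*} [Fintype β] [DecidableEq β] {n : ℕ}

/-- The constant vectors in a submodule. -/
def constantPart {S : Type*} (N : Submodule ℂ[X] (S → ℂ[X])) : Submodule ℂ (S → ℂ) where
  carrier := {y | (fun s => C (y s)) ∈ N}
  add_mem' {y z} hy hz := by
    change (fun s => C ((y + z) s)) ∈ N
    simp only [Pi.add_apply, C_add]
    exact N.add_mem hy hz
  zero_mem' := by
    change (fun s => C ((0 : S → ℂ) s)) ∈ N
    simp only [Pi.zero_apply, C_0]
    exact N.zero_mem
  smul_mem' c y hy := by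
    change (fun s => C ((c • y) s)) ∈ N
    simp only [Pi.smul_apply, smul_eq_mul, C_mul]
    exact N.smul_mem (C c) hy

lemma mem_constantPart {S : Type*} {N : Submodule ℂ[X] (S → ℂ[X])} {y : S → ℂ} :
    y ∈ constantPart N ↔ (fun s => C (y s)) ∈ N := Iff.rfl

/-- A submodule of a tensor power of the generalized Airy connection that is stable under the
connection is generated by constant vectors. -/
theorem le_span_constantPart (hn : 2 ≤ n) {N : Submodule ℂ[X] ((β → Fin n) → ℂ[X])}
    (hN : ∀ f ∈ N, (fun s => derivative (f s) + derivAct (airyMat n) f s) ∈ N) :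
    N ≤ Submodule.span ℂ[X] ((fun y s => C (y s)) '' (constantPart N : Set ((β → Fin n) → ℂ))) := by
  obtain ⟨r, ⟨b⟩⟩ := Submodule.nonempty_basis_of_pid (Pi.basisFun ℂ[X] (β → Fin n)) N
  set q : Fin r → (β → Fin n) → ℂ[X] := fun j => b j with hqdef
  have hq : LinearIndependent ℂ[X] q :=
    b.linearIndependent.map' N.subtype (Submodule.ker_subtype N)
  set B : Matrix (Fin r) (Fin r) ℂ[X] := fun i j => b.repr ⟨_, hN (q j) (b j).2⟩ i with hB
  have hqB : ∀ j s, derivative (q j s) + derivAct (airyMat n) (q j) s = ∑ i, q i s * B i j := by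
    intro j s
    have h1 := congrArg (fun v : N => (v : (β → Fin n) → ℂ[X]) s)
      (b.sum_repr ⟨_, hN (q j) (b j).2⟩)
    simp only [AddSubmonoidClass.coe_finsetSum, Submodule.coe_smul, Finset.sum_apply,
      Pi.smul_apply, smul_eq_mul] at h1
    rw [← h1]
    exact Finset.sum_congr rfl fun i _ => mul_comm _ _
  obtain ⟨x, hx⟩ := exists_eq_C_of_airy_eigenvector hn (plucker_equation (airyMat n) hqB)
  obtain ⟨σ, hσ⟩ := exists_det_ne_zero_of_linearIndependent hq
  set M : Matrix (Fin r) (Fin r) ℂ[X] := Matrix.of fun p j => q j (σ p) with hM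
  set y : Fin r → (β → Fin n) → ℂ := fun i s => x fun t => Function.update σ i s t.1 t.2 with hy
  have hyq : ∀ i s, C (y i s) = ∑ j, M.adjugate j i * q j s := by
    intro i s
    rw [hy, ← hx, plucker_update, Matrix.det_updateRow_apply]
  have hyN : ∀ i, y i ∈ constantPart N := by
    intro i
    rw [mem_constantPart]
    have h1 : (fun s => C (y i s)) = ∑ j, M.adjugate j i • q j := by
      funext s
      rw [hyq]
      simp
    rw [h1]
    exact N.sum_mem fun j _ => N.smul_mem _ (b j).2
  have hdet : M.det = C (x fun t => σ t.1 t.2) := by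
    rw [← hx]
    rfl
  set c := x fun t => σ t.1 t.2
  have hc : c ≠ 0 := by
    intro h
    rw [h, C_0] at hdet
    exact hσ hdet
  have hqy : ∀ j, q j = ∑ i, (C c⁻¹ * M i j) • fun s => C (y i s) := by
    intro j
    funext s
    simp only [Finset.sum_apply, Pi.smul_apply, smul_eq_mul, hyq, Finset.mul_sum]
    rw [Finset.sum_comm]
    have h1 : ∀ j', ∑ i, M.adjugate j' i * M i j = C c * (1 : Matrix (Fin r) (Fin r) ℂ[X]) j' j := by
      intro j'
      rw [← Matrix.mul_apply, Matrix.adjugate_mul, hdet]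
      rfl
    have h2 : ∀ j', ∑ i, C c⁻¹ * M i j * (M.adjugate j' i * q j' s) =
        (1 : Matrix (Fin r) (Fin r) ℂ[X]) j' j * q j' s := by
      intro j'
      have h3 : C c⁻¹ * C c = 1 := by rw [← C_mul, inv_mul_cancel₀ hc, C_1]
      calc _ = C c⁻¹ * (∑ i, M.adjugate j' i * M i j) * q j' s := by
            rw [Finset.mul_sum, Finset.sum_mul]
            exact Finset.sum_congr rfl fun i _ => by ring
        _ = _ := by
            rw [h1]
            linear_combination (1 : Matrix (Fin r) (Fin r) ℂ[X]) j' j * q j' s * h3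
    simp only [h2]
    simp [Matrix.one_apply]
  intro f hf
  have h1 := congrArg (N.subtype) (b.sum_repr ⟨f, hf⟩)
  rw [map_sum] at h1
  change _ = f at h1
  rw [← h1]
  refine Submodule.sum_mem _ fun j _ => ?_
  rw [map_smul]
  refine Submodule.smul_mem _ _ ?_
  change q j ∈ _
  rw [hqy]
  exact Submodule.sum_mem _ fun i _ =>
    Submodule.smul_mem _ _ (Submodule.subset_span ⟨y i, hyN i, rfl⟩)

/-- The coefficients of the elements of a stable submodule are constant vectors of it. -/
lemma coeff_mem_constantPart (hn : 2 ≤ n) {N : Submodule ℂ[X] ((β → Fin n) → ℂ[X])}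
    (hN : ∀ f ∈ N, (fun s => derivative (f s) + derivAct (airyMat n) f s) ∈ N)
    {f : (β → Fin n) → ℂ[X]} (hf : f ∈ N) (d : ℕ) : (fun s => (f s).coeff d) ∈ constantPart N := by
  have h := le_span_constantPart hn hN hf
  clear hf
  induction h using Submodule.span_induction generalizing d with
  | mem f hf =>
    obtain ⟨y, hy, rfl⟩ := hf
    by_cases hd : d = 0
    · simpa [hd] using hy
    · simp only [coeff_C, if_neg hd]
      exact (constantPart N).zero_mem
  | zero => exact (constantPart N).zero_mem
  | add f g _ _ hf hg =>
    simp only [Pi.add_apply, coeff_add]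
    exact (constantPart N).add_mem (hf d) (hg d)
  | smul p f _ hf =>
    have h1 : (fun s => ((p • f) s).coeff d) =
        ∑ x ∈ Finset.HasAntidiagonal.antidiagonal d, p.coeff x.1 • fun s => (f s).coeff x.2 := by
      funext s
      simp [coeff_mul]
    rw [h1]
    exact Submodule.sum_mem _ fun x _ => Submodule.smul_mem _ _ (hf _)

lemma derivAct_mem_constantPart (hn : 2 ≤ n) {N : Submodule ℂ[X] ((β → Fin n) → ℂ[X])}
    (hN : ∀ f ∈ N, (fun s => derivative (f s) + derivAct (airyMat n) f s) ∈ N)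
    {y : (β → Fin n) → ℂ} (hy : y ∈ constantPart N) :
    derivAct (shiftMat n) y ∈ constantPart N ∧ derivAct (cornerMat n) y ∈ constantPart N := by
  have h := hN _ hy
  simp only [derivAct_airyMat_C, derivative_C, zero_add] at h
  have h0 := coeff_mem_constantPart hn hN h 0
  have h1 := coeff_mem_constantPart hn hN h 1
  constructor
  · simpa [coeff_C] using h0
  · simpa [coeff_C, coeff_X_mul] using h1

lemma constantPart_ne_bot (hn : 2 ≤ n) {N : Submodule ℂ[X] ((β → Fin n) → ℂ[X])}
    (hN : ∀ f ∈ N, (fun s => derivative (f s) + derivAct (airyMat n) f s) ∈ N) (h0 : N ≠ ⊥) :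
    constantPart N ≠ ⊥ := by
  obtain ⟨f, hf, hf0⟩ := N.ne_bot_iff.1 h0
  intro h
  apply hf0
  funext s
  ext d
  have h1 := coeff_mem_constantPart hn hN hf d
  rw [h, Submodule.mem_bot] at h1
  exact congrFun h1 s

end ConstantTensors

section SymmetricTensors

variable {β : Type*} [Fintype β] [DecidableEq β] {n : ℕ}

/-- Invariance under permutations of the tensor factors. -/
def IsSymmTensor {β ι R : Type*} (f : (β → ι) → R) : Prop :=
  ∀ (σ : Equiv.Perm β) (s : β → ι), f (s ∘ σ) = f s

lemma IsSymmTensor.update_eq {β ι R : Type*} [DecidableEq β] {f : (β → ι) → R}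
    (hf : IsSymmTensor f) {s : β → ι} {b c : β} (h : s b = s c) (i : ι) :
    f (Function.update s c i) = f (Function.update s b i) := by
  rw [← hf (Equiv.swap b c) (Function.update s b i)]
  congr 1
  funext d
  rw [Function.comp_apply]
  by_cases h1 : d = c
  · subst h1
    simp
  · rw [Function.update_of_ne h1]
    by_cases h2 : d = b
    · subst h2
      rw [Equiv.swap_apply_left, Function.update_of_ne (Ne.symm h1), h]
    · rw [Equiv.swap_apply_of_ne_of_ne h2 h1, Function.update_of_ne h2]

lemma IsSymmTensor.derivAct {ι R : Type*} [Fintype ι] [CommRing R] {f : (β → ι) → R}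
    (hf : IsSymmTensor f) (A : Matrix ι ι R) : IsSymmTensor (derivAct A f) := by
  intro σ s
  rw [derivAct_apply, derivAct_apply]
  refine Eq.trans ?_ (Equiv.sum_comp σ _)
  refine Finset.sum_congr rfl fun b _ => Finset.sum_congr rfl fun j _ => ?_
  rw [Function.comp_apply, ← hf σ (Function.update s (σ b) j), Function.update_comp_equiv,
    Equiv.symm_apply_apply]

/-- The matrices obtained from `cornerMat n` by repeated commutators with `shiftMat n`. -/
def adMat (n j : ℕ) : Matrix (Fin n) (Fin n) ℂ :=
  Matrix.of fun a b =>
    if (a : ℕ) + (n - 1) = b + j then (-1) ^ (n - 1 - (b : ℕ)) * (j.choose (n - 1 - b) : ℂ) else 0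

lemma adMat_zero : adMat n 0 = cornerMat n := by
  ext a b
  have := b.isLt
  simp only [adMat, cornerMat, Matrix.of_apply]
  by_cases h : (a : ℕ) = 0 ∧ (b : ℕ) + 1 = n
  · rw [if_pos h, if_pos (by omega), show n - 1 - (b : ℕ) = 0 by omega]
    simp
  · rw [if_neg h, if_neg (by omega)]

lemma shiftMat_mul_apply (A : Matrix (Fin n) (Fin n) ℂ) (a b : Fin n) :
    (shiftMat n * A) a b = if h : (a : ℕ) = 0 then 0 else A ⟨a - 1, by omega⟩ b := by
  simp only [Matrix.mul_apply, shiftMat, Matrix.of_apply, ite_mul, one_mul, zero_mul]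
  split_ifs with h
  · exact Finset.sum_eq_zero fun k _ => if_neg (by omega)
  · rw [Finset.sum_eq_single ⟨a - 1, by omega⟩]
    · exact if_pos (by simp only []; omega)
    · intro k _ hk
      refine if_neg fun h1 => hk (Fin.ext ?_)
      simp only []
      omega
    · simp

lemma mul_shiftMat_apply (A : Matrix (Fin n) (Fin n) ℂ) (a b : Fin n) :
    (A * shiftMat n) a b = if h : (b : ℕ) + 1 < n then A a ⟨b + 1, h⟩ else 0 := by
  simp only [Matrix.mul_apply, shiftMat, Matrix.of_apply, mul_ite, mul_one, mul_zero]
  split_ifs with h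
  · rw [Finset.sum_eq_single ⟨b + 1, h⟩]
    · simp
    · intro k _ hk
      exact if_neg fun h1 => hk (Fin.ext h1)
    · simp
  · exact Finset.sum_eq_zero fun k _ => if_neg (by omega)

lemma adMat_succ (j : ℕ) :
    adMat n (j + 1) = shiftMat n * adMat n j - adMat n j * shiftMat n := by
  ext a b
  have ha := a.isLt
  have hb := b.isLt
  rw [Matrix.sub_apply, shiftMat_mul_apply, mul_shiftMat_apply]
  simp only [adMat, Matrix.of_apply]
  by_cases h : (a : ℕ) + (n - 1) = b + (j + 1)
  · rw [if_pos h]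
    have h1 : (if h0 : (a : ℕ) = 0 then (0 : ℂ) else
        if (a : ℕ) - 1 + (n - 1) = b + j then
          (-1) ^ (n - 1 - (b : ℕ)) * (j.choose (n - 1 - b) : ℂ) else 0) =
        (-1) ^ (n - 1 - (b : ℕ)) * (j.choose (n - 1 - b) : ℂ) := by
      split_ifs with h0 h2
      · rw [Nat.choose_eq_zero_of_lt (by omega)]
        simp
      · rfl
      · omega
    rw [h1]
    obtain ⟨m, hm⟩ : ∃ m, m = n - 1 - (b : ℕ) := ⟨_, rfl⟩
    rw [← hm]
    rcases m with _ | m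
    · rw [dif_neg (by omega)]
      simp
    · rw [dif_pos (by omega), if_pos (by omega)]
      rw [show n - 1 - ((b : ℕ) + 1) = m by omega, Nat.choose_succ_succ]
      push_cast
      ring
  · rw [if_neg h]
    split_ifs <;> first | omega | simp

variable {V : Submodule ℂ ((β → Fin n) → ℂ)}

lemma derivAct_adMat_mem (he : ∀ y ∈ V, derivAct (shiftMat n) y ∈ V)
    (hF : ∀ y ∈ V, derivAct (cornerMat n) y ∈ V) (j : ℕ) :
    ∀ y ∈ V, derivAct (adMat n j) y ∈ V := by
  induction j with
  | zero =>
    rw [adMat_zero]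
    exact hF
  | succ j ih =>
    intro y hy
    rw [adMat_succ, derivAct_commutator_apply]
    exact V.sub_mem (he _ (ih _ hy)) (ih _ (he _ hy))

/-- Lowering the largest index that occurs in the support of a symmetric tensor. -/
lemma exists_mem_support_lt (he : ∀ y ∈ V, derivAct (shiftMat n) y ∈ V)
    (hF : ∀ y ∈ V, derivAct (cornerMat n) y ∈ V) (hV : ∀ y ∈ V, IsSymmTensor y)
    {v : ℕ} (hv : 0 < v) (hvn : v < n) (c : ℕ) :
    ∀ f ∈ V, f ≠ 0 → (∀ s, f s ≠ 0 → ∀ b, (s b : ℕ) ≤ v) →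
      (∀ s, f s ≠ 0 → ∑ b, (if (s b : ℕ) = v then 1 else 0) ≤ c) →
      ∃ g ∈ V, g ≠ 0 ∧ ∀ s, g s ≠ 0 → ∀ b, (s b : ℕ) < v := by
  induction c with
  | zero =>
    intro f hf hf0 hfv hfc
    refine ⟨f, hf, hf0, fun s hs b => lt_of_le_of_ne (hfv s hs b) fun h => ?_⟩
    have h1 := hfc s hs
    rw [Nat.le_zero, Finset.sum_eq_zero_iff] at h1
    have h2 := h1 b (Finset.mem_univ b)
    rw [if_pos h] at h2
    omega
  | succ c ih =>
    intro f hf hf0 hfv hfc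
    set z : Fin n := ⟨0, by omega⟩ with hz
    set w : Fin n := ⟨v, hvn⟩ with hw
    have hT : ∀ s, derivAct (adMat n (n - 1 - v)) f s = (-1) ^ (n - 1 - v) *
        ∑ b, if s b = z then f (Function.update s b w) else 0 := by
      intro s
      rw [derivAct_apply, Finset.mul_sum]
      refine Finset.sum_congr rfl fun b _ => ?_
      rw [Finset.sum_eq_single w]
      · simp only [adMat, Matrix.of_apply, hw, hz, Fin.ext_iff]
        by_cases h : (s b : ℕ) = 0
        · rw [if_pos (by omega), if_pos h]
          simp
        · rw [if_neg (by omega), if_neg h]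
          simp
      · intro j _ hj
        have hj' : (j : ℕ) ≠ v := fun h => hj (Fin.ext h)
        by_cases h : f (Function.update s b j) = 0
        · rw [h, mul_zero]
        · have h1 := hfv _ h b
          rw [Function.update_self] at h1
          simp only [adMat, Matrix.of_apply]
          rw [if_neg (by omega), zero_mul]
      · simp
    by_cases hT0 : derivAct (adMat n (n - 1 - v)) f = 0
    · refine ⟨f, hf, hf0, fun s hs b => lt_of_le_of_ne (hfv s hs b) fun h => hs ?_⟩
      have h1 := congrFun hT0 (Function.update s b z)
      have h2 : ∀ c, (if Function.update s b z c = z then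
          f (Function.update (Function.update s b z) c w) else 0) =
          if Function.update s b z c = z then f s else 0 := by
        intro c
        split_ifs with h3
        · rw [(hV f hf).update_eq (b := b) (by rw [h3, Function.update_self]),
            Function.update_idem, show w = s b from Fin.ext h.symm, Function.update_eq_self]
        · rfl
      simp only [hT, h2, Pi.zero_apply, ← Finset.sum_filter, Finset.sum_const, nsmul_eq_mul] at h1
      have h3 : (Finset.univ.filter fun c => Function.update s b z c = z).card ≠ 0 :=
        Finset.card_ne_zero_of_mem (a := b) (by simp)
      simpa [h3] using h1
    · refine ih _ (derivAct_adMat_mem he hF _ f hf) hT0 ?_ ?_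
      · intro s hs b
        rw [hT] at hs
        obtain ⟨b', -, hb'⟩ := Finset.exists_ne_zero_of_sum_ne_zero (right_ne_zero_of_mul hs)
        have h1 : s b' = z := by
          by_contra h
          exact hb' (if_neg h)
        rw [if_pos h1] at hb'
        by_cases h2 : b = b'
        · rw [h2, h1]
          exact Nat.zero_le _
        · have h3 := hfv _ hb' b
          rwa [Function.update_of_ne h2] at h3
      · intro s hs
        rw [hT] at hs
        obtain ⟨b', -, hb'⟩ := Finset.exists_ne_zero_of_sum_ne_zero (right_ne_zero_of_mul hs)
        have h1 : s b' = z := by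
          by_contra h
          exact hb' (if_neg h)
        rw [if_pos h1] at hb'
        have h2 := hfc _ hb'
        have h3 := sum_update_add (fun i : Fin n => if (i : ℕ) = v then 1 else 0) s b' w
        simp only [h1, hz, hw, if_neg hv.ne, if_true] at h3 h2
        omega

lemma exists_mem_support_zero (he : ∀ y ∈ V, derivAct (shiftMat n) y ∈ V)
    (hF : ∀ y ∈ V, derivAct (cornerMat n) y ∈ V) (hV : ∀ y ∈ V, IsSymmTensor y)
    (hV0 : V ≠ ⊥) (j : ℕ) (hj : j < n) :
    ∃ g ∈ V, g ≠ 0 ∧ ∀ s, g s ≠ 0 → ∀ b, (s b : ℕ) + j < n := by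
  induction j with
  | zero =>
    obtain ⟨f, hf, hf0⟩ := V.ne_bot_iff.1 hV0
    exact ⟨f, hf, hf0, fun s _ b => (s b).isLt⟩
  | succ j ih =>
    obtain ⟨f, hf, hf0, hfs⟩ := ih (by omega)
    obtain ⟨g, hg, hg0, hgs⟩ := exists_mem_support_lt he hF hV (v := n - 1 - j) (by omega)
      (by omega) (Fintype.card β) f hf hf0 (fun s hs b => by have := hfs s hs b; omega)
      fun s _ => by
        rw [← Finset.card_filter]
        exact Finset.card_le_univ _
    exact ⟨g, hg, hg0, fun s hs b => by have := hgs s hs b; omega⟩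

/-- A symmetric tensor orthogonal to `V` vanishes. -/
lemma eq_zero_of_orthogonal (hn : 0 < n) (he : ∀ y ∈ V, derivAct (shiftMat n) y ∈ V)
    (hF : ∀ y ∈ V, derivAct (cornerMat n) y ∈ V) (hV : ∀ y ∈ V, IsSymmTensor y)
    (hV0 : V ≠ ⊥) (d : ℕ) :
    ∀ g : (β → Fin n) → ℂ, IsSymmTensor g → (∀ f ∈ V, ∑ s, f s * g s = 0) →
      ∀ s, ∑ b, (if (s b : ℕ) = 0 then 0 else 1) ≤ d → g s = 0 := by
  induction d with
  | zero =>
    intro g _ hgV s hs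
    obtain ⟨f, hf, hf0, hfs⟩ := exists_mem_support_zero he hF hV hV0 (n - 1) (by omega)
    have hs0 : ∀ b, (s b : ℕ) = 0 := by
      intro b
      rw [Nat.le_zero, Finset.sum_eq_zero_iff] at hs
      have h1 := hs b (Finset.mem_univ b)
      by_contra h
      rw [if_neg h] at h1
      omega
    have hf1 : ∀ t, t ≠ s → f t = 0 := by
      intro t ht
      by_contra h
      refine ht (funext fun b => Fin.ext ?_)
      have h1 := hfs t h b
      have h2 := hs0 b
      omega
    have h1 := hgV f hf
    rw [Finset.sum_eq_single s (fun t _ ht => by rw [hf1 t ht, zero_mul]) (by simp)] at h1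
    refine (mul_eq_zero.1 h1).resolve_left fun h => hf0 (funext fun t => ?_)
    by_cases ht : t = s
    · rw [ht, h]
      rfl
    · exact hf1 t ht
  | succ d ih =>
    intro g hg hgV s hs
    by_cases hex : ∀ b, (s b : ℕ) = 0
    · refine ih g hg hgV s ?_
      simp [hex]
    · push Not at hex
      obtain ⟨b, hb⟩ := hex
      set z : Fin n := ⟨0, hn⟩ with hz
      set j := n - 1 + (s b : ℕ) with hj
      set A := adMat n j with hA
      set s' := Function.update s b z with hs'
      have hcount : ∀ c : β, ∀ i : Fin n, (s' c = z → i = z) →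
          ∑ b, (if (Function.update s' c i b : ℕ) = 0 then 0 else 1) ≤ d := by
        intro c i hi
        have h1 := sum_update_add (fun i : Fin n => if (i : ℕ) = 0 then 0 else 1) s b z
        have h2 := sum_update_add (fun i : Fin n => if (i : ℕ) = 0 then 0 else 1) s' c i
        have hz0 : (z : ℕ) = 0 := rfl
        simp only [← hs', if_neg hb, if_pos hz0] at h1
        by_cases h3 : (s' c : ℕ) = 0
        · rw [if_pos h3, hi (Fin.ext h3), if_pos hz0] at h2
          rw [hi (Fin.ext h3)]
          omega
        · rw [if_neg h3] at h2
          split_ifs at h2 <;> omega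
      have h1 : derivAct A.transpose g s' = 0 := by
        refine ih _ (hg.derivAct _) (fun f hf => ?_) s' ?_
        · have h2 := derivAct_adjoint (fun _ => (1 : ℂ)) (A := A) (B := A.transpose)
            (fun i j => by simp) f g
          simp only [Finset.prod_const_one, one_mul] at h2
          rw [← h2]
          exact hgV _ (derivAct_adMat_mem he hF _ f hf)
        · have h2 := hcount b z fun _ => rfl
          rwa [hs', Function.update_idem] at h2
      have h2 : derivAct A.transpose g s' =
          ∑ c, if s' c = z then ((-1) ^ (n - 1) * (j.choose (n - 1) : ℂ)) * g s else 0 := by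
        rw [derivAct_apply]
        refine Finset.sum_congr rfl fun c _ => ?_
        split_ifs with h3
        · rw [Finset.sum_eq_single (s b)]
          · rw [hg.update_eq (b := b) (by rw [h3, hs', Function.update_self]), hs',
              Function.update_idem, Function.update_eq_self, ← hs', h3, Matrix.transpose_apply, hA]
            simp only [adMat, Matrix.of_apply, hz]
            rw [if_pos (by omega), Nat.sub_zero]
          · intro i _ hi
            have : (i : ℕ) ≠ s b := fun h => hi (Fin.ext h)
            rw [h3, Matrix.transpose_apply, hA]
            simp only [adMat, Matrix.of_apply, hz]
            rw [if_neg (by omega), zero_mul]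
          · simp
        · refine Finset.sum_eq_zero fun i _ => ?_
          rw [ih g hg hgV _ (hcount c i fun h => absurd h h3), mul_zero]
      rw [h2, ← Finset.sum_filter, Finset.sum_const, nsmul_eq_mul] at h1
      have h3 : (Finset.univ.filter fun c => s' c = z).card ≠ 0 :=
        Finset.card_ne_zero_of_mem (a := b) (by simp [hs'])
      have h4 : j.choose (n - 1) ≠ 0 := (Nat.choose_pos (by omega)).ne'
      simpa [h3, h4] using h1

/-- A nonzero space of symmetric tensors that is stable under `shiftMat n` and `cornerMat n`
contains all symmetric tensors. -/
theorem mem_of_isSymmTensor (hn : 0 < n) (he : ∀ y ∈ V, derivAct (shiftMat n) y ∈ V)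
    (hF : ∀ y ∈ V, derivAct (cornerMat n) y ∈ V) (hV : ∀ y ∈ V, IsSymmTensor y)
    (hV0 : V ≠ ⊥) {f : (β → Fin n) → ℂ} (hf : IsSymmTensor f) : f ∈ V := by
  by_contra hfV
  obtain ⟨φ, hφf, hφV⟩ := Submodule.exists_le_ker_of_notMem hfV
  set g : (β → Fin n) → ℂ := fun s => φ (Pi.single s 1) with hg
  have hφ : ∀ u : (β → Fin n) → ℂ, φ u = ∑ s, u s * g s := by
    intro u
    conv_lhs => rw [pi_eq_sum_univ' u]
    rw [map_sum]
    simp [hg]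
  set g' : (β → Fin n) → ℂ := fun s => ∑ σ : Equiv.Perm β, g (s ∘ σ) with hg'
  have hg's : IsSymmTensor g' := by
    intro σ s
    exact Equiv.sum_comp (Equiv.mulLeft σ) fun τ : Equiv.Perm β => g (s ∘ τ)
  have hpair : ∀ u, IsSymmTensor u → ∑ s, u s * g' s = (Fintype.card (Equiv.Perm β)) * φ u := by
    intro u hu
    simp only [hg', Finset.mul_sum]
    rw [Finset.sum_comm]
    have h1 : ∀ σ : Equiv.Perm β, ∑ s, u s * g (s ∘ σ) = φ u := by
      intro σ
      rw [hφ]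
      refine Eq.trans ?_ (Equiv.sum_comp (Equiv.arrowCongr σ.symm (Equiv.refl (Fin n))) _)
      refine Finset.sum_congr rfl fun s _ => ?_
      rw [← hu σ s]
      rfl
    simp [h1]
  have hzero : g' = 0 := by
    funext s
    refine eq_zero_of_orthogonal hn he hF hV hV0 _ g' hg's (fun u hu => ?_) s le_rfl
    rw [hpair u (hV u hu), LinearMap.mem_ker.1 (hφV hu), mul_zero]
  have h1 := hpair f hf
  rw [hzero] at h1
  simp only [Pi.zero_apply, mul_zero, Finset.sum_const_zero] at h1
  rcases mul_eq_zero.1 h1.symm with h2 | h2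
  · exact Fintype.card_ne_zero (by exact_mod_cast h2)
  · exact hφf h2

/-- Irreducibility, in terms of tensors. -/
theorem mem_of_airy_stable (hn : 2 ≤ n) {N : Submodule ℂ[X] ((β → Fin n) → ℂ[X])}
    (hN : ∀ f ∈ N, (fun s => derivative (f s) + derivAct (airyMat n) f s) ∈ N)
    (hsymm : ∀ f ∈ N, IsSymmTensor f) (h0 : N ≠ ⊥) {f : (β → Fin n) → ℂ[X]}
    (hf : IsSymmTensor f) : f ∈ N := by
  have hV : ∀ y ∈ constantPart N, IsSymmTensor y := fun y hy σ s => C_injective (hsymm _ hy σ s)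
  obtain ⟨D, hD⟩ : ∃ D, ∀ s, (f s).natDegree < D :=
    ⟨Finset.univ.sup (fun s => (f s).natDegree) + 1, fun s =>
      Nat.lt_succ_of_le (Finset.le_sup (f := fun s => (f s).natDegree) (Finset.mem_univ s))⟩
  have h1 : f = ∑ d ∈ Finset.range D, (X ^ d : ℂ[X]) • fun s => C ((f s).coeff d) := by
    funext s
    rw [Finset.sum_apply]
    conv_lhs => rw [(f s).as_sum_range' D (hD s)]
    refine Finset.sum_congr rfl fun d _ => ?_
    rw [Pi.smul_apply, smul_eq_mul, mul_comm, C_mul_X_pow_eq_monomial]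
  rw [h1]
  refine N.sum_mem fun d _ => N.smul_mem _ (mem_constantPart.1 ?_)
  refine mem_of_isSymmTensor (by omega) (fun y hy => (derivAct_mem_constantPart hn hN hy).1)
    (fun y hy => (derivAct_mem_constantPart hn hN hy).2) hV (constantPart_ne_bot hn hN h0) ?_
  exact fun σ s => congrArg (fun p => p.coeff d) (hf σ s)

end SymmetricTensors

section SymmetricPowers

lemma prod_factorial_mul_eq {ι : Type*} [Fintype ι] [DecidableEq ι] {p q : ι → ℕ} {j m : ι}
    (hjm : j ≠ m)
    (h : ∀ i, p i + (if i = m then 1 else 0) = q i + (if i = j then 1 else 0)) :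
    (∏ i, (p i).factorial) * q m = (∏ i, (q i).factorial) * p j := by
  have h1 : ∀ (r c : ι → ℕ) (l : ι),
      (∏ i, r i) * c l = ∏ i, (r i * if i = l then c i else 1) := by
    intro r c l
    rw [Finset.prod_mul_distrib, Finset.prod_ite_eq' Finset.univ l c, if_pos (Finset.mem_univ l)]
  rw [h1, h1]
  refine Finset.prod_congr rfl fun i _ => ?_
  have h2 := h i
  by_cases him : i = m
  · have hij : i ≠ j := fun h3 => hjm (h3.symm.trans him)
    rw [if_pos him, if_neg hij] at h2
    rw [if_pos him, if_neg hij, ← h2.trans (add_zero _), Nat.factorial_succ]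
    ring
  · by_cases hij : i = j
    · rw [if_neg him, if_pos hij] at h2
      rw [if_pos hij, if_neg him, (add_zero (p i)).symm.trans h2, Nat.factorial_succ]
      ring
    · rw [if_neg him, if_neg hij] at h2
      rw [if_neg hij, if_neg him, (add_zero (p i)).symm.trans h2]
      rfl

variable {n k : ℕ}

/-- The number of tensor factors equal to the basis vector `i`. -/
def slotCount (s : Fin k → Fin n) (i : Fin n) : ℕ := ∑ b, if s b = i then 1 else 0

lemma sum_slotCount (s : Fin k → Fin n) : ∑ i, slotCount s i = k := by
  simp only [slotCount]
  rw [Finset.sum_comm]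
  simp

lemma slotCount_le (s : Fin k → Fin n) (i : Fin n) : slotCount s i ≤ k :=
  (Finset.single_le_sum (fun _ _ => Nat.zero_le _) (Finset.mem_univ i)).trans
    (sum_slotCount s).le

lemma slotCount_comp_perm (s : Fin k → Fin n) (σ : Equiv.Perm (Fin k)) :
    slotCount (s ∘ σ) = slotCount s :=
  funext fun i => Equiv.sum_comp σ fun b => if s b = i then 1 else 0

lemma slotCount_update (s : Fin k → Fin n) (b : Fin k) (j i : Fin n) :
    slotCount (Function.update s b j) i + (if i = s b then 1 else 0) =
      slotCount s i + (if i = j then 1 else 0) := by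
  have h := sum_update_add (fun l => if l = i then 1 else 0) s b j
  simpa only [slotCount, eq_comm (a := i)] using h

/-- The multi-index of the monomial obtained by multiplying the tensor factors. -/
def slotType (s : Fin k → Fin n) : PIdx n k :=
  ⟨fun i => ⟨slotCount s i, Nat.lt_succ_of_le (slotCount_le s i)⟩, sum_slotCount s⟩

lemma slotType_eq_iff (s : Fin k → Fin n) (a : PIdx n k) :
    a = slotType s ↔ ∀ i, (a.1 i : ℕ) = slotCount s i := by
  simp only [Subtype.ext_iff, funext_iff, Fin.ext_iff, slotType]

lemma slotType_surjective : Function.Surjective (slotType : (Fin k → Fin n) → PIdx n k) := by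
  intro a
  have hcard : Fintype.card (Σ i : Fin n, Fin (a.1 i)) = Fintype.card (Fin k) := by
    simp [a.2]
  let e := Fintype.equivOfCardEq hcard
  refine ⟨fun b => (e.symm b).1, ((slotType_eq_iff _ _).2 fun i => ?_).symm⟩
  have h := Equiv.sum_comp e.symm fun x : Σ i : Fin n, Fin (a.1 i) => if x.1 = i then 1 else 0
  rw [slotCount, h, Fintype.sum_sigma]
  have h1 : ∀ x : Fin n, (∑ _ : Fin (a.1 x), if x = i then 1 else 0) =
      if x = i then (a.1 x : ℕ) else 0 := by
    intro x
    split_ifs <;> simp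
  refine Eq.symm ((Finset.sum_congr rfl fun x _ => h1 x).trans ?_)
  rw [Finset.sum_ite_eq' Finset.univ, if_pos (Finset.mem_univ i)]

/-- The embedding of the symmetric power into the tensor power, sending a monomial to a multiple
of the sum of the tensors lying over it. -/
noncomputable def symmToTensor (n k : ℕ) :
    AiSym n k →ₗ[ℂ[X]] ((Fin k → Fin n) → ℂ[X]) where
  toFun x s := ((∏ i, (slotCount s i).factorial : ℕ) : ℂ[X]) * x (slotType s)
  map_add' x y := by ext1 s; simp [mul_add]
  map_smul' c x := by ext1 s; simp [mul_left_comm]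

lemma symmToTensor_apply (x : AiSym n k) (s : Fin k → Fin n) :
    symmToTensor n k x s =
      ((∏ i, (slotCount s i).factorial : ℕ) : ℂ[X]) * x (slotType s) := rfl

lemma isSymmTensor_symmToTensor (x : AiSym n k) : IsSymmTensor (symmToTensor n k x) := by
  intro σ s
  simp only [symmToTensor_apply, slotType, slotCount_comp_perm]

lemma symmToTensor_injective : Function.Injective (symmToTensor n k) := by
  intro x y h
  funext a
  obtain ⟨s, rfl⟩ := slotType_surjective a
  have h1 := congrFun h s
  rw [symmToTensor_apply, symmToTensor_apply] at h1
  refine mul_left_cancel₀ ?_ h1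
  exact Nat.cast_ne_zero.2 (Finset.prod_ne_zero_iff.2 fun i _ => Nat.factorial_ne_zero _)

lemma AiD_apply (x : AiSym n k) (b : PIdx n k) :
    AiD n k x b = derivative (x b) + ∑ a : PIdx n k, ∑ i : Fin n,
      if 1 ≤ (a.1 i : ℕ) ∧
          (fun l : Fin n => (a.1 l : ℕ) + (if (l : ℕ) = ((i : ℕ) + 1) % n then 1 else 0)
            - (if l = i then 1 else 0)) = (fun l : Fin n => (b.1 l : ℕ)) then
        ((a.1 i : ℕ) : ℂ[X]) * (if (i : ℕ) = n - 1 then X else 1) * x a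
      else 0 := by
  simp only [AiD, LinearMap.pi_apply, LinearMap.add_apply, LinearMap.comp_apply,
    LinearMap.proj_apply, LinearMap.sum_apply]
  congr 1
  refine Finset.sum_congr rfl fun a _ => Finset.sum_congr rfl fun i _ => ?_
  split_ifs <;> simp [mul_assoc]

lemma sum_update_symmToTensor (x : AiSym n k) (s : Fin k → Fin n) {j m : Fin n} (hjm : j ≠ m) :
    ∑ b, (if s b = m then symmToTensor n k x (Function.update s b j) else 0) =
      ((∏ i, (slotCount s i).factorial : ℕ) : ℂ[X]) * ∑ a : PIdx n k,
        if 1 ≤ (a.1 j : ℕ) ∧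
            (fun l : Fin n => (a.1 l : ℕ) + (if l = m then 1 else 0)
              - (if l = j then 1 else 0)) = (fun l : Fin n => ((slotType s).1 l : ℕ)) then
          ((a.1 j : ℕ) : ℂ[X]) * x a
        else 0 := by
  by_cases hm : ∃ b, s b = m
  · obtain ⟨c, hc⟩ := hm
    have hup : ∀ i, slotCount (Function.update s c j) i + (if i = m then 1 else 0) =
        slotCount s i + (if i = j then 1 else 0) := fun i => by
      rw [← hc]
      exact slotCount_update s c j i
    have h1 : ∀ b, (if s b = m then symmToTensor n k x (Function.update s b j) else 0) =
        ((if s b = m then 1 else 0 : ℕ) : ℂ[X]) *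
          symmToTensor n k x (Function.update s c j) := by
      intro b
      split_ifs with hb
      · rw [(isSymmTensor_symmToTensor x).update_eq (hc.trans hb.symm), Nat.cast_one, one_mul]
      · rw [Nat.cast_zero, zero_mul]
    have h2 : ∀ a : PIdx n k, (1 ≤ (a.1 j : ℕ) ∧
        (fun l : Fin n => (a.1 l : ℕ) + (if l = m then 1 else 0)
          - (if l = j then 1 else 0)) = (fun l : Fin n => ((slotType s).1 l : ℕ))) ↔
        a = slotType (Function.update s c j) := by
      intro a
      rw [slotType_eq_iff]
      constructor
      · rintro ⟨h3, h4⟩ i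
        have h5 := congrFun h4 i
        have h6 := hup i
        simp only [slotType] at h5
        by_cases hij : i = j
        · subst hij
          simp only [if_true, if_neg hjm] at h5 h6
          omega
        · simp only [if_neg hij] at h5 h6
          omega
      · intro h3
        have h4 := hup j
        simp only [if_true, if_neg hjm] at h4
        refine ⟨by rw [h3]; omega, funext fun i => ?_⟩
        have h6 := hup i
        simp only [slotType, h3, h6, Nat.add_sub_cancel]
    simp only [h1, h2]
    rw [← Finset.sum_mul, ← Nat.cast_sum, Finset.sum_ite_eq' Finset.univ,
      if_pos (Finset.mem_univ _), symmToTensor_apply, ← mul_assoc, ← mul_assoc, ← Nat.cast_mul,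
      ← Nat.cast_mul]
    congr 2
    rw [mul_comm]
    exact prod_factorial_mul_eq hjm hup
  · push Not at hm
    have h0 : slotCount s m = 0 := Finset.sum_eq_zero fun b _ => if_neg (hm b)
    rw [Finset.sum_eq_zero fun b _ => if_neg (hm b), Finset.sum_eq_zero, mul_zero]
    intro a _
    refine if_neg fun h => ?_
    have h1 := congrFun h.2 m
    simp [slotType, h0, hjm.symm] at h1

lemma symmToTensor_AiD (hn : 2 ≤ n) (x : AiSym n k) :
    symmToTensor n k (AiD n k x) = fun s =>
      derivative (symmToTensor n k x s) + derivAct (airyMat n) (symmToTensor n k x) s := by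
  funext s
  rw [derivAct_apply, symmToTensor_apply, symmToTensor_apply, AiD_apply, mul_add,
    ← nsmul_eq_mul, ← nsmul_eq_mul _ (x _), derivative_smul]
  congr 1
  rw [Finset.sum_comm, Finset.sum_comm (s := Finset.univ (α := Fin k)),
    Finset.mul_sum]
  refine Finset.sum_congr rfl fun j _ => ?_
  obtain ⟨m, hm⟩ : ∃ m : Fin n, (m : ℕ) = ((j : ℕ) + 1) % n :=
    ⟨⟨_, Nat.mod_lt _ (by omega)⟩, rfl⟩
  have hjm : j ≠ m := by
    intro h
    rw [← h] at hm
    have hj := j.2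
    by_cases h1 : (j : ℕ) + 1 = n
    · rw [h1, Nat.mod_self] at hm
      omega
    · rw [Nat.mod_eq_of_lt (by omega)] at hm
      omega
  have h1 := congrArg (fun y => (if (j : ℕ) = n - 1 then X else 1 : ℂ[X]) * y)
    (sum_update_symmToTensor x s hjm)
  simp only [airyMat, Matrix.of_apply, ← hm, ← Fin.ext_iff]
  simp only [Finset.mul_sum, mul_ite, mul_zero] at h1 ⊢
  simp only [ite_mul, zero_mul]
  refine Eq.trans ?_ (h1.symm.trans ?_)
  · refine Finset.sum_congr rfl fun a _ => ?_
    split_ifs <;> ring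
  · refine Finset.sum_congr rfl fun a _ => ?_
    split_ifs <;> ring

end SymmetricPowers

/-- `Sym^k Ai_n` is irreducible over the Weyl algebra `ℂ[z]⟨∂_z⟩`: the only
`ℂ[z]`-submodules `N` with `D(N) ⊆ N` are `0` and the whole module. -/
theorem stmt_2 (n k : ℕ) (hn : 2 ≤ n) (hk : 1 ≤ k) :
    ∀ N : Submodule (Polynomial ℂ) (AiSym n k),
      (∀ x ∈ N, AiD n k x ∈ N) → N = ⊥ ∨ N = ⊤ := by
  intro N hN
  refine or_iff_not_imp_left.2 fun h0 => (Submodule.eq_top_iff').2 fun x => ?_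
  have h1 : symmToTensor n k x ∈ N.map (symmToTensor n k) := by
    refine mem_of_airy_stable hn ?_ ?_ ?_ (isSymmTensor_symmToTensor x)
    · rintro _ ⟨y, hy, rfl⟩
      exact ⟨AiD n k y, hN y hy, symmToTensor_AiD hn y⟩
    · rintro _ ⟨y, -, rfl⟩
      exact isSymmTensor_symmToTensor y
    · rw [Ne, ← Submodule.map_bot (symmToTensor n k)]
      exact fun h => h0 (Submodule.map_injective_of_injective symmToTensor_injective h)
  obtain ⟨y, hy, hyx⟩ := h1
  rwa [← symmToTensor_injective hyx]
end

section
/- The module Ai_n is irreducible as a module over the Weyl algebra ℂ[z]⟨∂_z⟩: the only ℂ[z]-submodules N of Ai_n satisfying D_n(N) ⊆ N are N = 0 and N = Ai_n. -/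
open Polynomial

/-- The underlying space of the generalized Airy connection `Ai_n`: the free `ℂ[z]`-module
`⊕_{i=0}^{n−1} ℂ[z]·v_i`, an element being recorded by its coefficient function. -/
abbrev AiMod (n : ℕ) := Fin n → Polynomial ℂ

/-- The action of `∂_z` on `Ai_n`: `D_n(p·v_i) = p′·v_i + p·v_{i+1}` for `0 ≤ i ≤ n−2` and
`D_n(p·v_{n−1}) = p′·v_{n−1} + z·p·v_0`.  The coefficient of `v_j` in `D_n f` is thus
`(f j)′ + f (j−1)` for `j ≥ 1`, and `(f 0)′ + z·f (n−1)` for `j = 0`. -/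
noncomputable def AiDn (n : ℕ) : AiMod n →ₗ[ℂ] AiMod n :=
  LinearMap.pi fun j =>
    (Polynomial.derivative).comp (LinearMap.proj j) +
    if (j : ℕ) = 0 then
      (LinearMap.mulLeft ℂ (X : Polynomial ℂ)).comp
        (LinearMap.proj ⟨n - 1, by have := j.pos; omega⟩)
    else
      LinearMap.proj (R := ℂ) (φ := fun _ : Fin n => Polynomial ℂ)
        ⟨(j : ℕ) - 1, by have := j.isLt; omega⟩

theorem AiDn_apply (n : ℕ) (x : AiMod n) (j : Fin n) :
    AiDn n x j = derivative (x j) +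
      if (j : ℕ) = 0 then X * x ⟨n - 1, by have := j.pos; omega⟩
      else x ⟨(j : ℕ) - 1, by have := j.isLt; omega⟩ := by
  unfold AiDn
  split_ifs with h <;> simp [h]

/-- Leibniz rule for the connection. -/
theorem AiDn_smul (n : ℕ) (p : Polynomial ℂ) (x : AiMod n) :
    AiDn n (p • x) = derivative p • x + p • AiDn n x := by
  ext1 j
  simp only [AiDn_apply, Pi.add_apply, Pi.smul_apply, smul_eq_mul, derivative_mul]
  split_ifs <;> ring

theorem AiDn_single_succ (n i : ℕ) (hi : i + 1 < n) :
    AiDn n (Pi.single ⟨i, by omega⟩ 1) = Pi.single ⟨i + 1, hi⟩ 1 := by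
  ext1 j
  simp only [AiDn_apply, Pi.single_apply, Fin.ext_iff]
  split_ifs <;> first | omega | simp

theorem AiDn_single_last (n : ℕ) (hn : 2 ≤ n) :
    AiDn n (Pi.single ⟨n - 1, by omega⟩ 1) =
      (X : Polynomial ℂ) • (Pi.single ⟨0, by omega⟩ 1 : AiMod n) := by
  ext1 j
  simp only [AiDn_apply, Pi.smul_apply, Pi.single_apply, Fin.ext_iff]
  split_ifs <;> first | omega | simp

theorem AiDn_pow_single_zero (n : ℕ) (hn : 2 ≤ n) (i : ℕ) (hi : i < n) :
    (AiDn n ^ i) (Pi.single ⟨0, by omega⟩ 1) = Pi.single ⟨i, hi⟩ 1 := by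
  induction i with
  | zero => simp
  | succ i ih => rw [pow_succ', Module.End.mul_apply, ih (by omega), AiDn_single_succ n i hi]

theorem AiDn_pow_self_single_zero (n : ℕ) (hn : 2 ≤ n) :
    (AiDn n ^ n) (Pi.single ⟨0, by omega⟩ 1) =
      (X : Polynomial ℂ) • (Pi.single ⟨0, by omega⟩ 1 : AiMod n) := by
  obtain ⟨m, rfl⟩ : ∃ m, n = m + 1 := ⟨n - 1, by omega⟩
  rw [pow_succ', Module.End.mul_apply, AiDn_pow_single_zero (m + 1) hn m (by omega)]
  exact AiDn_single_last (m + 1) hn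

/-- The map `p ↦ p(D_n) v_0`, which identifies `Ai_n` with its Fourier transform. -/
noncomputable def aiFourier (n : ℕ) (hn : 2 ≤ n) : Polynomial ℂ →ₗ[ℂ] AiMod n :=
  (LinearMap.applyₗ (Pi.single ⟨0, by omega⟩ 1 : AiMod n)).comp (aeval (AiDn n)).toLinearMap

theorem aiFourier_apply (n : ℕ) (hn : 2 ≤ n) (p : Polynomial ℂ) :
    aiFourier n hn p = aeval (AiDn n) p (Pi.single ⟨0, by omega⟩ 1) := rfl

theorem aiFourier_X_mul (n : ℕ) (hn : 2 ≤ n) (p : Polynomial ℂ) :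
    aiFourier n hn (X * p) = AiDn n (aiFourier n hn p) := by
  simp [aiFourier_apply]

/-- Under the Fourier transform, `z` acts as `p ↦ X ^ n * p - derivative p`. -/
theorem X_smul_aiFourier (n : ℕ) (hn : 2 ≤ n) (p : Polynomial ℂ) :
    (X : Polynomial ℂ) • aiFourier n hn p = aiFourier n hn (X ^ n * p - derivative p) := by
  have step (q : Polynomial ℂ)
      (hq : (X : Polynomial ℂ) • aiFourier n hn q = aiFourier n hn (X ^ n * q - derivative q)) :
      (X : Polynomial ℂ) • aiFourier n hn (X * q) =
        aiFourier n hn (X ^ n * (X * q) - derivative (X * q)) := by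
    have h := AiDn_smul n X (aiFourier n hn q)
    rw [hq, ← aiFourier_X_mul, ← aiFourier_X_mul, derivative_X, one_smul] at h
    rw [← sub_eq_iff_eq_add'.2 h, ← map_sub]
    congr 1
    rw [derivative_mul, derivative_X]
    ring
  induction p using Polynomial.induction_on with
  | C a =>
    have h := AiDn_pow_self_single_zero n hn
    have hC : (C a : Polynomial ℂ) = a • 1 := by rw [smul_eq_C_mul, mul_one]
    rw [derivative_C, sub_zero, hC, mul_smul_comm, map_smul, map_smul, smul_comm, mul_one]
    simp only [aiFourier_apply, map_one, map_pow, aeval_X, h, Module.End.one_apply]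
  | add p q hp hq =>
    rw [map_add, smul_add, hp, hq, ← map_add, derivative_add]
    congr 1
    ring
  | monomial k a h =>
    have e : C a * X ^ (k + 1) = X * (C a * X ^ k) := by ring
    rw [e]
    exact step _ h

theorem smul_mem_range_aiFourier (n : ℕ) (hn : 2 ≤ n) (q : Polynomial ℂ) (x : AiMod n)
    (hx : x ∈ LinearMap.range (aiFourier n hn)) :
    q • x ∈ LinearMap.range (aiFourier n hn) := by
  induction q using Polynomial.induction_on generalizing x with
  | C a =>
    have e : C a • x = a • x := by
      ext1 j
      simp [smul_eq_C_mul]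
    rw [e]
    exact Submodule.smul_mem _ _ hx
  | add p q hp hq =>
    rw [add_smul]
    exact add_mem (hp x hx) (hq x hx)
  | monomial k a h =>
    rw [pow_succ, ← mul_assoc, mul_smul]
    obtain ⟨p, rfl⟩ := hx
    exact h _ ⟨_, (X_smul_aiFourier n hn p).symm⟩

theorem eq_sum_smul_single {n : ℕ} (x : AiMod n) :
    x = ∑ i, x i • (Pi.single i 1 : AiMod n) := by
  simpa [← Pi.single_smul] using (Finset.univ_sum_single x).symm

theorem aiFourier_surjective (n : ℕ) (hn : 2 ≤ n) : Function.Surjective (aiFourier n hn) := by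
  intro x
  change x ∈ LinearMap.range (aiFourier n hn)
  rw [eq_sum_smul_single x]
  refine sum_mem fun i _ => smul_mem_range_aiFourier n hn _ _ ⟨X ^ (i : ℕ), ?_⟩
  simpa [aiFourier_apply] using AiDn_pow_single_zero n hn i i.isLt

theorem Polynomial.one_mem_of_derivative_mem {K : Type*} [Field K] [CharZero K]
    (M : Submodule K (Polynomial K)) (hM : ∀ p ∈ M, derivative p ∈ M) (p : Polynomial K)
    (hp : p ∈ M) (h0 : p ≠ 0) : 1 ∈ M := by
  induction h : p.natDegree using Nat.strong_induction_on generalizing p with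
  | _ d ih =>
    by_cases hd : p.natDegree = 0
    · obtain ⟨a, rfl⟩ := natDegree_eq_zero.1 hd
      have ha : a ≠ 0 := fun ha => h0 (by simp [ha])
      have := M.smul_mem a⁻¹ hp
      rwa [smul_C, smul_eq_mul, inv_mul_cancel₀ ha, C_1] at this
    · exact ih _ (h ▸ natDegree_derivative_lt hd) _ (hM p hp)
        (fun hz => hd (derivative_eq_zero.1 hz)) rfl

/-- `Ai_n` is irreducible over the Weyl algebra `ℂ[z]⟨∂_z⟩`: the only `ℂ[z]`-submodules `N`
with `D_n(N) ⊆ N` are `0` and the whole module. -/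
theorem stmt_3 (n : ℕ) (hn : 2 ≤ n) :
    ∀ N : Submodule (Polynomial ℂ) (AiMod n),
      (∀ x ∈ N, AiDn n x ∈ N) → N = ⊥ ∨ N = ⊤ := by
  intro N hN
  refine or_iff_not_imp_left.2 fun hbot => ?_
  obtain ⟨x, hx, hx0⟩ := N.exists_mem_ne_zero_of_ne_bot hbot
  obtain ⟨p, rfl⟩ := aiFourier_surjective n hn x
  have hpow (k : ℕ) (y : AiMod n) (hy : y ∈ N) : (AiDn n ^ k) y ∈ N := by
    induction k with
    | zero => simpa using hy
    | succ k ih =>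
      rw [pow_succ', Module.End.mul_apply]
      exact hN _ ih
  have h1 : (1 : Polynomial ℂ) ∈ (N.restrictScalars ℂ).comap (aiFourier n hn) := by
    refine one_mem_of_derivative_mem _ (fun q hq => ?_) p hx fun hp => hx0 (by simp [hp])
    change aiFourier n hn q ∈ N at hq
    change aiFourier n hn (derivative q) ∈ N
    have hmul : aiFourier n hn (X ^ n * q) ∈ N := by
      simpa [aiFourier_apply] using hpow n _ hq
    have e : derivative q = X ^ n * q - (X ^ n * q - derivative q) := by ring
    rw [e, map_sub, ← X_smul_aiFourier]
    exact sub_mem hmul (N.smul_mem _ hq)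
  have hv : (Pi.single ⟨0, by omega⟩ 1 : AiMod n) ∈ N := by
    simpa [aiFourier_apply] using h1
  refine eq_top_iff.2 fun y _ => ?_
  rw [eq_sum_smul_single y]
  refine sum_mem fun i _ => N.smul_mem _ ?_
  have h := hpow i _ hv
  rwa [AiDn_pow_single_zero n hn i i.isLt] at h
end

section
/- The cokernel of D is a free ℂ[z]-module of rank n with basis the classes [1], [x], …, [x^{n−1}]; in this cokernel [x^n] = z·[1], the formula ∂_z[P] = [∂P/∂z − x·P] gives a well-defined ℂ-linear operator (i.e., D's image is preserved), and ∂_z[x^ℓ] = −[x^{ℓ+1}] for all ℓ ≥ 0, so that ∂_z^n[1] = (−1)^n·z·[1] (the generalized Airy equation of order n). -/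
open Polynomial

/-- `ℂ[z]`, the coefficient ring. -/
abbrev Rz : Type := Polynomial ℂ

/-- `ℂ[z][x]`, polynomials in `x` with coefficients in `ℂ[z]`. -/
abbrev Azx : Type := Polynomial Rz

/-- The `ℂ[z]`-linear operator `D(P) = ∂P/∂x + (xⁿ − z)·P` on `ℂ[z][x]`, whose cokernel
presents the generalized Airy connection `Ai_n`. -/
noncomputable def D4 (n : ℕ) : Azx →ₗ[Rz] Azx :=
  Polynomial.derivative + LinearMap.mulLeft Rz ((X : Azx) ^ n - Polynomial.C (X : Rz))

/-- The partial derivative `∂/∂z` on `ℂ[z][x]`, applied coefficientwise. -/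
noncomputable def dzA (P : Azx) : Azx :=
  P.sum fun i c => Polynomial.C (Polynomial.derivative c) * (X : Azx) ^ i

theorem coeff_dzA (P : Azx) (i : ℕ) : (dzA P).coeff i = derivative (P.coeff i) := by
  simp only [dzA, Polynomial.sum_def, finsetSum_coeff, coeff_C_mul_X_pow]
  rw [Finset.sum_ite_eq]
  split_ifs with h
  · rfl
  · rw [notMem_support_iff.mp h, derivative_zero]

/-- The partial derivative `∂/∂z` as a `ℂ`-linear map. -/
noncomputable def dzLinear : Azx →ₗ[ℂ] Azx where
  toFun := dzA
  map_add' P Q := by ext1 i; simp [coeff_dzA]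
  map_smul' c P := by ext1 i; simp [coeff_dzA]

theorem dzA_sub (P Q : Azx) : dzA (P - Q) = dzA P - dzA Q := map_sub dzLinear P Q

theorem dzA_add (P Q : Azx) : dzA (P + Q) = dzA P + dzA Q := map_add dzLinear P Q

theorem dzA_X_pow_mul (n : ℕ) (P : Azx) : dzA (X ^ n * P) = X ^ n * dzA P := by
  ext1 i
  simp only [coeff_dzA, coeff_X_pow_mul']
  split_ifs <;> simp

theorem dzA_C_mul (c : Rz) (P : Azx) :
    dzA (C c * P) = C (derivative c) * P + C c * dzA P := by
  ext1 i
  simp [coeff_dzA, derivative_mul]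

theorem dzA_X_pow (n : ℕ) : dzA (X ^ n) = 0 := by
  ext1 i
  rw [coeff_dzA, coeff_X_pow]
  split_ifs <;> simp

theorem dzA_derivative (P : Azx) : dzA (derivative P) = derivative (dzA P) := by
  ext1 i
  rw [coeff_dzA, coeff_derivative, coeff_derivative, coeff_dzA, derivative_mul]
  simp

theorem D4_apply (n : ℕ) (P : Azx) :
    D4 n P = derivative P + (X ^ n - C X) * P := rfl

/-- The `ℂ`-linear operator `P ↦ ∂P/∂z − x·P` on `ℂ[z][x]`. -/
noncomputable def airyConnection : Azx →ₗ[ℂ] Azx :=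
  dzLinear - LinearMap.mulLeft ℂ (X : Azx)

theorem airyConnection_apply (P : Azx) : airyConnection P = dzA P - X * P := rfl

theorem airyConnection_D4 (n : ℕ) (P : Azx) :
    airyConnection (D4 n P) = D4 n (airyConnection P) := by
  simp only [airyConnection_apply, D4_apply, dzA_add, dzA_sub, sub_mul, dzA_X_pow_mul,
    dzA_C_mul, dzA_derivative, derivative_sub, derivative_mul, derivative_X, map_one]
  ring

theorem degree_D4 (n : ℕ) (hn : 0 < n) {P : Azx} (hP : P ≠ 0) :
    (D4 n P).degree = n + P.degree := by
  have hq : ((X : Azx) ^ n - C (X : Rz)).degree = n := degree_X_pow_sub_C hn _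
  have hmul : (((X : Azx) ^ n - C (X : Rz)) * P).degree = n + P.degree := by
    rw [degree_mul, hq]
  rw [D4_apply, degree_add_eq_right_of_degree_lt, hmul]
  rw [hmul]
  refine (degree_derivative_lt hP).trans_le ?_
  exact le_add_of_nonneg_left (by exact_mod_cast Nat.zero_le n)

theorem linearIndependent_mk_X_pow (n : ℕ) (hn : 0 < n) :
    LinearIndependent Rz (fun i : Fin n =>
      Submodule.Quotient.mk (p := LinearMap.range (D4 n)) ((X : Azx) ^ (i : ℕ))) := by
  rw [Fintype.linearIndependent_iff]
  intro g hg i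
  have hmem : ∑ j : Fin n, g j • (X : Azx) ^ (j : ℕ) ∈ LinearMap.range (D4 n) := by
    rw [← Submodule.Quotient.mk_eq_zero, ← hg, ← Submodule.mkQ_apply, map_sum]
    rfl
  obtain ⟨P, hP⟩ := hmem
  have hdeg : (∑ j : Fin n, g j • (X : Azx) ^ (j : ℕ)).degree < n := by
    simp only [smul_eq_C_mul]
    exact degree_sum_fin_lt g
  have hP0 : P = 0 := by
    by_contra h
    rw [← hP, degree_D4 n hn h, degree_eq_natDegree h] at hdeg
    norm_cast at hdeg
    omega
  rw [hP0, map_zero] at hP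
  have hcoeff := congrArg (fun Q : Azx => Q.coeff (i : ℕ)) hP
  simpa [finsetSum_coeff, coeff_X_pow, Fin.val_inj] using hcoeff.symm

theorem mk_X_pow_add (n m : ℕ) :
    Submodule.Quotient.mk (p := LinearMap.range (D4 n)) ((X : Azx) ^ (m + n)) =
      (X : Rz) • Submodule.Quotient.mk ((X : Azx) ^ m)
        - (m : Rz) • Submodule.Quotient.mk ((X : Azx) ^ (m - 1)) := by
  rw [← Submodule.Quotient.mk_smul, ← Submodule.Quotient.mk_smul, ← Submodule.Quotient.mk_sub,
    Submodule.Quotient.eq]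
  refine ⟨X ^ m, ?_⟩
  rw [D4_apply, derivative_X_pow, smul_eq_C_mul, smul_eq_C_mul]
  ring

theorem span_mk_X_pow (n : ℕ) (hn : 0 < n) :
    Submodule.span Rz (Set.range fun i : Fin n =>
      Submodule.Quotient.mk (p := LinearMap.range (D4 n)) ((X : Azx) ^ (i : ℕ))) = ⊤ := by
  set S := Submodule.span Rz (Set.range fun i : Fin n =>
    Submodule.Quotient.mk (p := LinearMap.range (D4 n)) ((X : Azx) ^ (i : ℕ))) with hS
  have hpow : ∀ m : ℕ,
      Submodule.Quotient.mk (p := LinearMap.range (D4 n)) ((X : Azx) ^ m) ∈ S := by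
    intro m
    induction m using Nat.strong_induction_on with
    | _ m ih =>
      by_cases hm : m < n
      · exact Submodule.subset_span ⟨⟨m, hm⟩, rfl⟩
      · obtain ⟨k, rfl⟩ := Nat.exists_eq_add_of_le' (not_lt.mp hm)
        rw [mk_X_pow_add]
        exact S.sub_mem (S.smul_mem _ (ih k (by omega))) (S.smul_mem _ (ih (k - 1) (by omega)))
  rw [eq_top_iff]
  rintro y -
  obtain ⟨P, rfl⟩ := Submodule.Quotient.mk_surjective _ y
  induction P using Polynomial.induction_on' with
  | add P Q hP hQ => exact S.add_mem hP hQ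
  | monomial m c =>
    rw [← C_mul_X_pow_eq_monomial, ← smul_eq_C_mul, Submodule.Quotient.mk_smul]
    exact S.smul_mem _ (hpow m)

/-- The operator `∂_z` induced by `airyConnection` on the cokernel of `D4 n`. -/
noncomputable def cokernelConnection (n : ℕ) :
    (Azx ⧸ LinearMap.range (D4 n)) →ₗ[ℂ] (Azx ⧸ LinearMap.range (D4 n)) :=
  Submodule.mapQ ((LinearMap.range (D4 n)).restrictScalars ℂ)
    ((LinearMap.range (D4 n)).restrictScalars ℂ) airyConnection (by
      rintro _ ⟨P, rfl⟩
      exact ⟨airyConnection P, (airyConnection_D4 n P).symm⟩)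

theorem cokernelConnection_mk (n : ℕ) (P : Azx) :
    cokernelConnection n (Submodule.Quotient.mk P) =
      Submodule.Quotient.mk (dzA P - X * P) := rfl

theorem cokernelConnection_mk_X_pow (n l : ℕ) :
    cokernelConnection n (Submodule.Quotient.mk ((X : Azx) ^ l)) =
      -Submodule.Quotient.mk ((X : Azx) ^ (l + 1)) := by
  rw [cokernelConnection_mk, dzA_X_pow, zero_sub, ← pow_succ', Submodule.Quotient.mk_neg]

theorem cokernelConnection_pow_mk_one (n k : ℕ) :
    (cokernelConnection n ^ k) (Submodule.Quotient.mk (1 : Azx)) =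
      ((-1 : ℂ) ^ k) • Submodule.Quotient.mk ((X : Azx) ^ k) := by
  induction k with
  | zero => simp
  | succ k ih =>
    rw [pow_succ', Module.End.mul_apply, ih, map_smul, cokernelConnection_mk_X_pow,
      pow_succ (-1 : ℂ), mul_smul, neg_one_smul]

/-- The cokernel of `D` is a free `ℂ[z]`-module of rank `n` with basis the classes
`[1], [x], …, [x^{n−1}]`; in it `[xⁿ] = z·[1]`; the formula `∂_z[P] = [∂P/∂z − x·P]` gives a
well-defined `ℂ`-linear operator `T`; `T[x^ℓ] = −[x^{ℓ+1}]` for all `ℓ ≥ 0`; and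
`Tⁿ[1] = (−1)ⁿ·z·[1]` (the generalized Airy equation of order `n`). -/
theorem stmt_4 (n : ℕ) (hn : 2 ≤ n) :
    LinearIndependent Rz (fun i : Fin n =>
        Submodule.Quotient.mk (p := LinearMap.range (D4 n)) ((X : Azx) ^ (i : ℕ)))
    ∧ Submodule.span Rz (Set.range fun i : Fin n =>
        Submodule.Quotient.mk (p := LinearMap.range (D4 n)) ((X : Azx) ^ (i : ℕ))) = ⊤
    ∧ Submodule.Quotient.mk (p := LinearMap.range (D4 n)) ((X : Azx) ^ n)
        = (X : Rz) • Submodule.Quotient.mk (p := LinearMap.range (D4 n)) (1 : Azx)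
    ∧ ∃ T : (Azx ⧸ LinearMap.range (D4 n)) →ₗ[ℂ] (Azx ⧸ LinearMap.range (D4 n)),
        (∀ P : Azx, T (Submodule.Quotient.mk P)
            = Submodule.Quotient.mk (dzA P - (X : Azx) * P))
        ∧ (∀ ℓ : ℕ, T (Submodule.Quotient.mk ((X : Azx) ^ ℓ))
              = - Submodule.Quotient.mk ((X : Azx) ^ (ℓ + 1)))
        ∧ (T ^ n) (Submodule.Quotient.mk (1 : Azx))
            = ((-1 : ℂ) ^ n) •
                ((X : Rz) • Submodule.Quotient.mk (p := LinearMap.range (D4 n)) (1 : Azx)) := by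
  have hn0 : 0 < n := by omega
  have hX : Submodule.Quotient.mk (p := LinearMap.range (D4 n)) ((X : Azx) ^ n)
      = (X : Rz) • Submodule.Quotient.mk (p := LinearMap.range (D4 n)) (1 : Azx) := by
    simpa using mk_X_pow_add n 0
  refine ⟨linearIndependent_mk_X_pow n hn0, span_mk_X_pow n hn0, hX, cokernelConnection n,
    cokernelConnection_mk n, cokernelConnection_mk_X_pow n, ?_⟩
  rw [cokernelConnection_pow_mk_one, hX]
end

section
/- The submodule Λ_ρ⁺ is stable under θ_ρ, and the inclusion of two-term complexes (Λ_ρ⁺, θ_ρ) ⊆ (Λ_ρ, θ_ρ) is a quasi-isomorphism: it induces isomorphisms ker(θ_ρ restricted to Λ_ρ⁺) ≅ ker(θ_ρ on Λ_ρ) and coker(θ_ρ on Λ_ρ⁺) ≅ coker(θ_ρ on Λ_ρ). -/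
/-- The operator `z·d/dz` on the space `ℤ →₀ ℂ` of Laurent polynomials in `z`
(a Laurent polynomial being recorded by its finitely supported coefficient function,
`single n c` standing for `c·zⁿ`): it multiplies the coefficient of `zⁿ` by `n`. -/
noncomputable def zdz : (ℤ →₀ ℂ) →ₗ[ℂ] (ℤ →₀ ℂ) :=
  Finsupp.lsum ℂ fun n => (n : ℂ) • Finsupp.lsingle n

/-- Multiplication by `z^m` on Laurent polynomials. -/
noncomputable def shiftT (m : ℤ) : (ℤ →₀ ℂ) →ₗ[ℂ] (ℤ →₀ ℂ) :=
  Finsupp.lmapDomain ℂ ℂ (· + m)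

/-- The operator `z∂_z` on `Λ_ρ = ⊕_{a=0}^k ℂ[z,z⁻¹]·u_a`, the module of global sections over
`𝔾_m` of `V_ρ` (where `V_0 = Sym^k Ai` and `V_{1/2} = L ⊗ Sym^k Ai`):
`θ_ρ(p·u_a) = z·p′·u_a + p·(ρ·u_a + (k−a)·z·u_{a+1} + a·z²·u_{a−1})`. -/
noncomputable def theta (k : ℕ) (ρ : ℂ) :
    (Fin (k + 1) → (ℤ →₀ ℂ)) →ₗ[ℂ] (Fin (k + 1) → (ℤ →₀ ℂ)) :=
  LinearMap.pi fun b =>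
    zdz.comp (LinearMap.proj b) + ρ • LinearMap.proj b
    + (if 1 ≤ (b : ℕ) then
        ((k - ((b : ℕ) - 1) : ℕ) : ℂ) •
          (shiftT 1).comp (LinearMap.proj ⟨(b : ℕ) - 1, by have := b.isLt; omega⟩)
      else 0)
    + (if h : (b : ℕ) + 1 ≤ k then
        (((b : ℕ) + 1 : ℕ) : ℂ) •
          (shiftT 2).comp (LinearMap.proj ⟨(b : ℕ) + 1, by omega⟩)
      else 0)

/-- The lattice `Λ_ρ⁺ = ⊕_{a=0}^k ℂ[z]·u_a ⊆ Λ_ρ`. -/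
noncomputable def Lplus (k : ℕ) : Submodule ℂ (Fin (k + 1) → (ℤ →₀ ℂ)) :=
  Submodule.pi Set.univ fun _ => Finsupp.supported ℂ ℂ {n : ℤ | 0 ≤ n}

lemma zdz_apply (p : ℤ →₀ ℂ) (n : ℤ) : zdz p n = n * p n := by
  induction p using Finsupp.induction_linear with
  | zero => simp
  | add p q hp hq => simp [hp, hq, mul_add]
  | single m c =>
    by_cases h : m = n
    · subst h; simp [zdz]
    · simp [zdz, h]

lemma shiftT_apply (m : ℤ) (p : ℤ →₀ ℂ) (n : ℤ) : shiftT m p n = p (n - m) := by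
  have h := Finsupp.mapDomain_apply (add_left_injective m) p (n - m)
  simpa [shiftT] using h

lemma mem_Lplus_iff {k : ℕ} {f : Fin (k + 1) → (ℤ →₀ ℂ)} :
    f ∈ Lplus k ↔ ∀ b, ∀ n < 0, f b n = 0 := by
  simp only [Lplus, Submodule.mem_pi, Set.mem_univ, true_imp_iff, Finsupp.mem_supported']
  simp

/-- The operator `θ_ρ` preserves the filtration by the order at `z = 0` and acts on the graded
piece of order `n` as multiplication by `n + ρ`. -/
lemma theta_apply_of_le {k : ℕ} (ρ : ℂ) {f : Fin (k + 1) → (ℤ →₀ ℂ)} {m : ℤ}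
    (hf : ∀ b, ∀ n < m, f b n = 0) (b : Fin (k + 1)) {n : ℤ} (hn : n ≤ m) :
    theta k ρ f b n = (n + ρ) * f b n := by
  have h1 (a) : f a (n - 1) = 0 := hf a _ (by omega)
  have h2 (a) : f a (n - 2) = 0 := hf a _ (by omega)
  simp only [theta, LinearMap.pi_apply]
  split_ifs <;> simp [zdz_apply, shiftT_apply, h1, h2, add_mul]

lemma intCast_add_ne_zero {ρ : ℂ} (hρ : ρ = 0 ∨ ρ = 1 / 2) {n : ℤ} (hn : n < 0) :
    (n : ℂ) + ρ ≠ 0 := by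
  rcases hρ with rfl | rfl
  · simpa using hn.ne
  · intro h
    have h' : ((2 * n + 1 : ℤ) : ℂ) = 0 := by
      push_cast
      linear_combination 2 * h
    rw [Int.cast_eq_zero] at h'
    omega

lemma exists_forall_lt_eq_zero {k : ℕ} (f : Fin (k + 1) → (ℤ →₀ ℂ)) :
    ∃ N : ℕ, ∀ b, ∀ n < -(N : ℤ), f b n = 0 := by
  refine ⟨Finset.univ.sup fun b => (f b).support.sup Int.natAbs, fun b n hn => ?_⟩
  by_contra h
  have h1 : n.natAbs ≤ (f b).support.sup Int.natAbs :=
    Finset.le_sup (Finsupp.mem_support_iff.mpr h)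
  have h2 := Finset.le_sup (f := fun b => (f b).support.sup Int.natAbs) (Finset.mem_univ b)
  omega

lemma mem_Lplus_of_theta_mem {k : ℕ} {ρ : ℂ} (hρ : ρ = 0 ∨ ρ = 1 / 2)
    {f : Fin (k + 1) → (ℤ →₀ ℂ)} (hf : theta k ρ f ∈ Lplus k) : f ∈ Lplus k := by
  rw [mem_Lplus_iff] at hf ⊢
  obtain ⟨N, hN⟩ := exists_forall_lt_eq_zero f
  induction N with
  | zero => simpa using hN
  | succ N ih =>
    refine ih fun b n hn => ?_
    rcases lt_or_ge n (-((N + 1 : ℕ) : ℤ)) with h | h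
    · exact hN b n h
    · have h0 : n < 0 := by omega
      have h1 := theta_apply_of_le ρ hN b (n := n) (by omega)
      rw [hf b n h0, eq_comm, mul_eq_zero] at h1
      exact h1.resolve_left (intCast_add_ne_zero hρ h0)

lemma exists_eq_add_theta {k : ℕ} {ρ : ℂ} (hρ : ρ = 0 ∨ ρ = 1 / 2)
    (f : Fin (k + 1) → (ℤ →₀ ℂ)) : ∃ g ∈ Lplus k, ∃ h, f = g + theta k ρ h := by
  obtain ⟨N, hN⟩ := exists_forall_lt_eq_zero f
  induction N generalizing f with
  | zero => exact ⟨f, mem_Lplus_iff.mpr (by simpa using hN), 0, by simp⟩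
  | succ N ih =>
    set m : ℤ := -((N + 1 : ℕ) : ℤ) with hm
    let h : Fin (k + 1) → (ℤ →₀ ℂ) := fun b => Finsupp.single m (f b m / (m + ρ))
    have hh : ∀ b, ∀ n < m, h b n = 0 := fun b n hn => Finsupp.single_eq_of_ne hn.ne
    obtain ⟨g, hg, h', e⟩ := ih (f - theta k ρ h) fun b n hn => by
      rw [Pi.sub_apply, Finsupp.sub_apply, theta_apply_of_le ρ hh b (by omega)]
      rcases lt_or_ge n m with hlt | hge
      · rw [hN b n hlt, hh b n hlt, mul_zero, sub_zero]
      · obtain rfl : n = m := by omega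
        have hne := intCast_add_ne_zero hρ (n := m) (by omega)
        simp [h, mul_div_cancel₀ _ hne]
    refine ⟨g, hg, h' + h, ?_⟩
    rw [map_add, ← add_assoc, ← e, sub_add_cancel]

/-- `Λ_ρ⁺` is stable under `θ_ρ` and the inclusion `(Λ_ρ⁺, θ_ρ) ⊆ (Λ_ρ, θ_ρ)` is a
quasi-isomorphism: it induces isomorphisms on kernels and cokernels. -/
theorem stmt_5 (k : ℕ) (hk : 1 ≤ k) (ρ : ℂ) (hρ : ρ = 0 ∨ ρ = 1 / 2) :
    -- stability
    (∀ f ∈ Lplus k, theta k ρ f ∈ Lplus k)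
    -- isomorphism on kernels: `ker θ_ρ ⊆ Λ_ρ⁺`
    ∧ (∀ f, theta k ρ f = 0 → f ∈ Lplus k)
    -- the induced map on cokernels is injective
    ∧ (∀ f ∈ Lplus k, f ∈ LinearMap.range (theta k ρ) → ∃ g ∈ Lplus k, theta k ρ g = f)
    -- the induced map on cokernels is surjective
    ∧ (∀ f, ∃ g ∈ Lplus k, ∃ h, f = g + theta k ρ h) := by
  refine ⟨fun f hf => ?_, fun f hf => ?_, ?_, exists_eq_add_theta hρ⟩
  · rw [mem_Lplus_iff] at hf ⊢
    intro b n hn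
    rw [theta_apply_of_le ρ hf b hn.le, hf b n hn, mul_zero]
  · exact mem_Lplus_of_theta_mem hρ (hf ▸ zero_mem _)
  · rintro _ hf ⟨g, rfl⟩
    exact ⟨g, mem_Lplus_of_theta_mem hρ hf, rfl⟩
end

section
/- Assume k is odd, so k = 2k′+1. Then the classes of the k + k′ + 2 elements z^{k′+1}·u_0, z^{k′}·u_0, …, z·u_0, u_0, u_1, …, u_k form a ℂ-basis of coker(θ_ρ : Λ_ρ⁺ → Λ_ρ⁺). -/
open Polynomial

/-- The operator `z∂_z` on `Λ_ρ⁺ = ⊕_{a=0}^k ℂ[z]·u_a`, the polynomial lattice in the module of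
global sections of `V_ρ` over `𝔾_m` (where `V_0 = Sym^k Ai`, `V_{1/2} = L ⊗ Sym^k Ai`):
`θ_ρ(p·u_a) = z·p′·u_a + p·(ρ·u_a + (k−a)·z·u_{a+1} + a·z²·u_{a−1})`. -/
noncomputable def thetaP (k : ℕ) (ρ : ℂ) :
    (Fin (k + 1) → Polynomial ℂ) →ₗ[ℂ] (Fin (k + 1) → Polynomial ℂ) :=
  LinearMap.pi fun b =>
    (LinearMap.mulLeft ℂ (X : Polynomial ℂ)).comp
        ((Polynomial.derivative).comp (LinearMap.proj b))
    + ρ • LinearMap.proj b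
    + (if 1 ≤ (b : ℕ) then
        ((k - ((b : ℕ) - 1) : ℕ) : ℂ) • (LinearMap.mulLeft ℂ (X : Polynomial ℂ)).comp
          (LinearMap.proj ⟨(b : ℕ) - 1, by have := b.isLt; omega⟩)
      else 0)
    + (if h : (b : ℕ) + 1 ≤ k then
        (((b : ℕ) + 1 : ℕ) : ℂ) • (LinearMap.mulLeft ℂ ((X : Polynomial ℂ) ^ 2)).comp
          (LinearMap.proj ⟨(b : ℕ) + 1, by omega⟩)
      else 0)

/-- The basis element `p·u_a` of `Λ_ρ⁺`. -/
noncomputable def eP (k : ℕ) (a : Fin (k + 1)) (p : Polynomial ℂ) :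
    Fin (k + 1) → Polynomial ℂ :=
  fun b => if b = a then p else 0

/-- The family of classes `u_0, z·u_0, …, z^{k′+1}·u_0, u_1, …, u_k` in
`coker(θ_ρ : Λ_ρ⁺ → Λ_ρ⁺)` (for `k` odd). -/
noncomputable def fam7 (k k' : ℕ) (ρ : ℂ) :
    (Fin (k' + 2) ⊕ Fin k) →
      ((Fin (k + 1) → Polynomial ℂ) ⧸ LinearMap.range (thetaP k ρ)) :=
  Sum.elim
    (fun i => Submodule.Quotient.mk (eP k 0 (X ^ (i : ℕ))))
    (fun j => Submodule.Quotient.mk (eP k ⟨(j : ℕ) + 1, by have := j.isLt; omega⟩ 1))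

/-- The element `z^n·u_a` of `Λ_ρ⁺`, which is `0` when `a > k`. -/
noncomputable def monomialSection (k a n : ℕ) : Fin (k + 1) → Polynomial ℂ :=
  fun b => if (b : ℕ) = a then X ^ n else 0

lemma eP_X_pow (k : ℕ) (a : Fin (k + 1)) (n : ℕ) :
    eP k a (X ^ n) = monomialSection k a n := by
  funext b
  simp [eP, monomialSection, Fin.ext_iff]

lemma monomialSection_of_gt {k a : ℕ} (h : k < a) (n : ℕ) : monomialSection k a n = 0 := by
  funext b
  have := b.isLt
  simp [monomialSection, show (b : ℕ) ≠ a by omega]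

lemma thetaP_apply (k : ℕ) (ρ : ℂ) (v : Fin (k + 1) → Polynomial ℂ) (b : Fin (k + 1)) :
    thetaP k ρ v b = X * derivative (v b) + ρ • v b
      + (if 1 ≤ (b : ℕ) then ((k - ((b : ℕ) - 1) : ℕ) : ℂ) •
          (X * v ⟨(b : ℕ) - 1, by have := b.isLt; omega⟩) else 0)
      + (if h : (b : ℕ) + 1 ≤ k then (((b : ℕ) + 1 : ℕ) : ℂ) •
          (X ^ 2 * v ⟨(b : ℕ) + 1, by omega⟩) else 0) := by
  unfold thetaP
  simp only [LinearMap.pi_apply, LinearMap.add_apply, LinearMap.smul_apply, LinearMap.comp_apply,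
    LinearMap.proj_apply, LinearMap.mulLeft_apply]
  congr 1
  · congr 1
    split_ifs <;> simp
  · split_ifs <;> simp

lemma thetaP_monomialSection {k a : ℕ} (ρ : ℂ) (ha : a ≤ k) (n : ℕ) :
    thetaP k ρ (monomialSection k a n) = (n + ρ) • monomialSection k a n
      + ((k - a : ℕ) : ℂ) • monomialSection k (a + 1) (n + 1)
      + (a : ℂ) • monomialSection k (a - 1) (n + 2) := by
  funext b
  rw [thetaP_apply]
  have hb := b.isLt
  simp only [monomialSection, Pi.add_apply, Pi.smul_apply]
  have hder : X * derivative (if (b : ℕ) = a then (X : Polynomial ℂ) ^ n else 0)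
      = (n : ℂ) • (if (b : ℕ) = a then (X : Polynomial ℂ) ^ n else 0) := by
    split_ifs
    · cases n with
      | zero => simp
      | succ n => rw [derivative_X_pow, smul_eq_C_mul]; simp; ring
    · simp
  rw [hder, add_smul]
  congr 1
  · congr 1
    by_cases h : (b : ℕ) = a + 1
    · simp [h, pow_succ']
    · rw [if_neg h, smul_zero]
      split_ifs <;> first | omega | simp
  · by_cases h : (b : ℕ) + 1 = a
    · subst h
      simp [ha, pow_add, mul_comm]
    · by_cases h0 : a = 0
      · subst h0
        simp
      · rw [if_neg (show (b : ℕ) ≠ a - 1 by omega)]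
        simp [h]

/-- The coefficient of `z^m·u_b` in `v`, which is `0` when `b > k`. -/
noncomputable def sectionCoeff {k : ℕ} (v : Fin (k + 1) → Polynomial ℂ) (b m : ℕ) : ℂ :=
  if h : b < k + 1 then (v ⟨b, h⟩).coeff m else 0

lemma sectionCoeff_thetaP_zero {k : ℕ} (hk : 1 ≤ k) (ρ : ℂ) (v : Fin (k + 1) → Polynomial ℂ)
    (m : ℕ) :
    sectionCoeff (thetaP k ρ v) 0 (m + 2)
      = (m + 2 + ρ) * sectionCoeff v 0 (m + 2) + sectionCoeff v 1 m := by
  simp only [sectionCoeff, thetaP_apply]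
  simp [hk, show 0 < k from hk, coeff_X_pow_mul, coeff_X_mul, coeff_derivative]
  ring

lemma sectionCoeff_thetaP_succ_one {k a : ℕ} (ha : a + 1 ≤ k) (ρ : ℂ)
    (v : Fin (k + 1) → Polynomial ℂ) :
    sectionCoeff (thetaP k ρ v) (a + 1) 1
      = (1 + ρ) * sectionCoeff v (a + 1) 1 + ((k - a : ℕ) : ℂ) * sectionCoeff v a 0 := by
  simp only [sectionCoeff, thetaP_apply]
  have hX : ∀ p : Polynomial ℂ, (X * derivative p).coeff 1 = p.coeff 1 := fun p => by
    simp [coeff_X_mul (derivative p) 0, coeff_derivative]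
  have hX1 : ∀ p : Polynomial ℂ, (X * p).coeff 1 = p.coeff 0 := fun p => coeff_X_mul p 0
  have hX2 : ∀ p : Polynomial ℂ, (X ^ 2 * p).coeff 1 = 0 := fun p => by
    simp [coeff_X_pow_mul']
  have h1 : a + 1 < k + 1 := by omega
  have h2 : a < k + 1 := by omega
  by_cases h : a + 1 + 1 ≤ k <;> simp [h, h1, h2, hX, hX1, hX2] <;> ring

lemma sectionCoeff_thetaP_succ {k a : ℕ} (ha : a + 1 ≤ k) (ρ : ℂ)
    (v : Fin (k + 1) → Polynomial ℂ) (m : ℕ) :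
    sectionCoeff (thetaP k ρ v) (a + 1) (m + 2)
      = (m + 2 + ρ) * sectionCoeff v (a + 1) (m + 2)
        + ((k - a : ℕ) : ℂ) * sectionCoeff v a (m + 1) + (a + 2) * sectionCoeff v (a + 2) m := by
  simp only [sectionCoeff, thetaP_apply]
  have h1 : a + 1 < k + 1 := by omega
  have h2 : a < k + 1 := by omega
  by_cases h : a + 1 + 1 ≤ k
  · have h3 : a + 2 < k + 1 := by omega
    simp [h, h1, h2, h3, coeff_X_pow_mul, coeff_X_mul, coeff_derivative]
    ring
  · have h3 : ¬ a + 2 < k + 1 := by omega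
    simp [h, h1, h2, h3, coeff_X_mul, coeff_derivative]
    ring

lemma sectionCoeff_eq_zero_of_gt {k b : ℕ} (v : Fin (k + 1) → Polynomial ℂ) (h : k < b) (m : ℕ) :
    sectionCoeff v b m = 0 := by
  rw [sectionCoeff, dif_neg (by omega)]

lemma eq_zero_of_sectionCoeff {k : ℕ} {v : Fin (k + 1) → Polynomial ℂ}
    (h : ∀ b m, sectionCoeff v b m = 0) : v = 0 := by
  funext b
  ext m
  simpa only [sectionCoeff, b.isLt, dite_true, Fin.eta, Pi.zero_apply, coeff_zero] using h b m

/-- With `z` of weight `2` and `u_a` of weight `a`, the coefficients of `v` have bounded weight. -/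
lemma exists_weight_bound {k : ℕ} (v : Fin (k + 1) → Polynomial ℂ) :
    ∃ D, ∀ b m, D ≤ 2 * m + b → sectionCoeff v b m = 0 := by
  refine ⟨2 * (∑ b, ((v b).natDegree + 1)) + k + 1, fun b m h => ?_⟩
  unfold sectionCoeff
  split_ifs with hb
  · refine coeff_eq_zero_of_natDegree_lt ?_
    have := Finset.single_le_sum (f := fun b => (v b).natDegree + 1) (fun _ _ => Nat.zero_le _)
      (Finset.mem_univ (⟨b, hb⟩ : Fin (k + 1)))
    omega
  · rfl

/-- If the coefficients of `v` of weight `> d` vanish and `θ_ρ v` lies in the span of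
`u_0, z·u_0, …, z^{k′+1}·u_0, u_1, …, u_k`, then so do the coefficients of weight `d`. -/
lemma sectionCoeff_eq_zero_of_weight {k k' : ℕ} (hk : k = 2 * k' + 1) (ρ : ℂ)
    {v : Fin (k + 1) → Polynomial ℂ}
    (h0 : ∀ m, sectionCoeff (thetaP k ρ v) 0 (k' + 2 + m) = 0)
    (hs : ∀ b m, sectionCoeff (thetaP k ρ v) (b + 1) (m + 1) = 0)
    {d : ℕ} (hd : ∀ b m, d < 2 * m + b → sectionCoeff v b m = 0) :
    ∀ b m, 2 * m + b = d → sectionCoeff v b m = 0 := by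
  have hka : ∀ a, a + 1 ≤ k → ((k - a : ℕ) : ℂ) ≠ 0 := fun a h => by
    rw [Nat.cast_ne_zero]; omega
  have hdown : (Even d ∨ d < k) → ∀ m b, 2 * m + b = d → sectionCoeff v b m = 0 := by
    intro hc m
    induction m with
    | zero =>
      intro b hb
      by_cases hbk : k < b
      · exact sectionCoeff_eq_zero_of_gt v hbk _
      have hb1 : b + 1 ≤ k := by
        rcases hc with hc | hc
        · obtain ⟨r, hr⟩ := hc; omega
        · omega
      have e := sectionCoeff_thetaP_succ_one hb1 ρ v
      rw [hs, hd (b + 1) 1 (by omega), mul_zero, zero_add] at e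
      exact (mul_eq_zero.mp e.symm).resolve_left (hka b hb1)
    | succ m ih =>
      intro b hb
      by_cases hbk : k < b
      · exact sectionCoeff_eq_zero_of_gt v hbk _
      have hb1 : b + 1 ≤ k := by
        rcases hc with hc | hc
        · obtain ⟨r, hr⟩ := hc; omega
        · omega
      have e := sectionCoeff_thetaP_succ hb1 ρ v m
      rw [hs, hd (b + 1) (m + 2) (by omega), ih (b + 2) (by omega), mul_zero, zero_add,
        mul_zero, add_zero] at e
      exact (mul_eq_zero.mp e.symm).resolve_left (hka b hb1)
  intro b m hbm
  by_cases hc : Even d ∨ d < k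
  · exact hdown hc m b hbm
  rw [not_or, Nat.not_even_iff_odd, not_lt] at hc
  obtain ⟨⟨r, hr⟩, hdk⟩ := hc
  obtain ⟨j, rfl⟩ : ∃ j, b = 2 * j + 1 := ⟨(b - 1) / 2, by omega⟩
  clear hdown
  induction j generalizing m with
  | zero =>
    have e := sectionCoeff_thetaP_zero (by omega) ρ v m
    obtain ⟨t, rfl⟩ : ∃ t, m = k' + t := ⟨m - k', by omega⟩
    rw [show k' + t + 2 = k' + 2 + t by omega, h0, hd 0 _ (by omega), mul_zero, zero_add] at e
    exact e.symm
  | succ j ih =>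
    by_cases hbk : k < 2 * (j + 1) + 1
    · exact sectionCoeff_eq_zero_of_gt v hbk _
    have e := sectionCoeff_thetaP_succ (a := 2 * j + 1) (by omega) ρ v m
    rw [hs, hd (2 * j + 1 + 1) (m + 2) (by omega), ih (m + 1) (by omega), mul_zero, mul_zero,
      zero_add, zero_add] at e
    refine (mul_eq_zero.mp e.symm).resolve_left ?_
    exact_mod_cast Nat.succ_ne_zero (2 * j + 1 + 1)

lemma eq_zero_of_thetaP {k k' : ℕ} (hk : k = 2 * k' + 1) (ρ : ℂ)
    {v : Fin (k + 1) → Polynomial ℂ}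
    (h0 : ∀ m, sectionCoeff (thetaP k ρ v) 0 (k' + 2 + m) = 0)
    (hs : ∀ b m, sectionCoeff (thetaP k ρ v) (b + 1) (m + 1) = 0) : v = 0 := by
  obtain ⟨D, hD⟩ := exists_weight_bound v
  refine eq_zero_of_sectionCoeff ?_
  induction D with
  | zero => exact fun b m => hD b m (Nat.zero_le _)
  | succ d ih =>
    refine ih fun b m h => ?_
    rcases h.eq_or_lt with h | h
    · exact sectionCoeff_eq_zero_of_weight hk ρ h0 hs hD b m h.symm
    · exact hD b m h

/-- The monomials `z^n·u_a` form a basis of `Λ_ρ⁺`. -/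
noncomputable def monomialBasis (k : ℕ) :
    Module.Basis (Σ _ : Fin (k + 1), ℕ) ℂ (Fin (k + 1) → Polynomial ℂ) :=
  Pi.basis fun _ => Polynomial.basisMonomials ℂ

lemma monomialBasis_apply (k : ℕ) (i : Σ _ : Fin (k + 1), ℕ) :
    monomialBasis k i = monomialSection k i.1 i.2 := by
  funext b
  simp only [monomialBasis, Pi.basis_apply, coe_basisMonomials, monomialSection, Pi.single_apply,
    Fin.ext_iff, monomial_one_right_eq_X_pow]

/-- The exponents of `u_0, z·u_0, …, z^{k′+1}·u_0, u_1, …, u_k`. -/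
def famIndex (k k' : ℕ) : Fin (k' + 2) ⊕ Fin k → Σ _ : Fin (k + 1), ℕ :=
  Sum.elim (fun i => ⟨0, i⟩) (fun j => ⟨j.succ, 0⟩)

lemma famIndex_injective (k k' : ℕ) : Function.Injective (famIndex k k') := by
  rintro (i | i) (j | j) h
  · simpa [famIndex, Fin.ext_iff] using h
  · exact absurd (congrArg Sigma.fst h).symm (Fin.succ_ne_zero j)
  · exact absurd (congrArg Sigma.fst h) (Fin.succ_ne_zero i)
  · simpa [famIndex, Fin.ext_iff] using h

lemma fam7_eq (k k' : ℕ) (ρ : ℂ) :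
    fam7 k k' ρ = (LinearMap.range (thetaP k ρ)).mkQ ∘ (monomialBasis k ∘ famIndex k k') := by
  funext i
  rcases i with i | j
  · simp [fam7, famIndex, monomialBasis_apply, eP_X_pow]
  · have := eP_X_pow k j.succ 0
    rw [pow_zero] at this
    simp only [fam7, famIndex, Function.comp_apply, Sum.elim_inr, monomialBasis_apply, ← this]
    rfl

lemma sectionCoeff_eq_zero_of_mem_span {k k' : ℕ} {w : Fin (k + 1) → Polynomial ℂ}
    (hw : w ∈ Submodule.span ℂ (Set.range (monomialBasis k ∘ famIndex k k'))) :
    (∀ m, sectionCoeff w 0 (k' + 2 + m) = 0) ∧ ∀ b m, sectionCoeff w (b + 1) (m + 1) = 0 := by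
  induction hw using Submodule.span_induction with
  | mem w hw =>
    obtain ⟨i, rfl⟩ := hw
    rw [Function.comp_apply, monomialBasis_apply]
    rcases i with i | j
    · refine ⟨fun m => ?_, fun b m => ?_⟩
      · have := i.isLt
        simp [sectionCoeff, famIndex, monomialSection, coeff_X_pow,
          show k' + 2 + m ≠ (i : ℕ) by omega]
      · simp [sectionCoeff, famIndex, monomialSection]
    · refine ⟨fun m => ?_, fun b m => ?_⟩
      · simp [sectionCoeff, famIndex, monomialSection]
      · simp only [sectionCoeff, famIndex, monomialSection]
        split_ifs <;> simp [apply_ite (fun p : Polynomial ℂ => p.coeff (m + 1)), coeff_one]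
  | zero => simp [sectionCoeff]
  | add x y _ _ hx hy =>
    have hadd : ∀ b m, sectionCoeff (x + y) b m = sectionCoeff x b m + sectionCoeff y b m :=
      fun b m => by unfold sectionCoeff; split_ifs <;> simp
    exact ⟨fun m => by rw [hadd, hx.1, hy.1, add_zero],
      fun b m => by rw [hadd, hx.2, hy.2, add_zero]⟩
  | smul c x _ hx =>
    have hsmul : ∀ b m, sectionCoeff (c • x) b m = c * sectionCoeff x b m :=
      fun b m => by unfold sectionCoeff; split_ifs <;> simp
    exact ⟨fun m => by rw [hsmul, hx.1, mul_zero], fun b m => by rw [hsmul, hx.2, mul_zero]⟩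

/-- A subspace of `Λ_ρ⁺` containing `range θ_ρ` and `u_0, z·u_0, …, z^{k′+1}·u_0, u_1, …, u_k`
contains all monomials. -/
lemma monomialSection_mem {k k' : ℕ} (hk : k = 2 * k' + 1) (ρ : ℂ)
    {T : Submodule ℂ (Fin (k + 1) → Polynomial ℂ)} (hT : LinearMap.range (thetaP k ρ) ≤ T)
    (h0 : ∀ n, n < k' + 2 → monomialSection k 0 n ∈ T) (hu : ∀ a, monomialSection k a 0 ∈ T)
    (a n : ℕ) : monomialSection k a n ∈ T := by
  obtain ⟨d, hd⟩ : ∃ d, 2 * n + a = d := ⟨_, rfl⟩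
  induction d using Nat.strong_induction_on generalizing a n with
  | _ d ih =>
  have hrel : ∀ b m, b ≤ k → 2 * m + b < d →
      ((k - b : ℕ) : ℂ) • monomialSection k (b + 1) (m + 1)
        + (b : ℂ) • monomialSection k (b - 1) (m + 2) ∈ T := by
    intro b m hb hlt
    have h := hT ⟨monomialSection k b m, rfl⟩
    rw [thetaP_monomialSection ρ hb, add_assoc] at h
    exact (T.add_mem_iff_right (T.smul_mem _ (ih _ hlt b m rfl))).mp h
  have hup : ∀ b m, b + 2 ≤ k → 2 * m + b + 4 = d → monomialSection k b (m + 2) ∈ T →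
      monomialSection k (b + 2) (m + 1) ∈ T := by
    intro b m hb hbm h
    have hr := hrel (b + 1) m (by omega) (by omega)
    have := (T.add_mem_iff_left (T.smul_mem _ h)).mp hr
    refine (T.smul_mem_iff ?_).mp this
    rw [Nat.cast_ne_zero]; omega
  have hdown : ∀ b m, b + 1 ≤ k → 2 * m + b + 4 = d → monomialSection k (b + 2) (m + 1) ∈ T →
      monomialSection k b (m + 2) ∈ T := by
    intro b m hb hbm h
    have hr := hrel (b + 1) m (by omega) (by omega)
    have := (T.add_mem_iff_right (T.smul_mem _ h)).mp hr
    exact (T.smul_mem_iff (Nat.cast_ne_zero.mpr (Nat.succ_ne_zero b))).mp this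
  have hzero : ∀ m, 2 * m = d → monomialSection k 0 m ∈ T := by
    intro m hm
    by_cases hmk : m < k' + 2
    · exact h0 m hmk
    have hchain : ∀ i j, i + j = k' + 1 → monomialSection k (2 * j) (m - j) ∈ T := by
      intro i
      induction i with
      | zero =>
        intro j hj
        rw [monomialSection_of_gt (by omega)]
        exact T.zero_mem
      | succ i ihi =>
        intro j hj
        have h := ihi (j + 1) (by omega)
        have := hdown (2 * j) (m - j - 2) (by omega) (by omega)
        rw [show m - j - 2 + 2 = m - j by omega, show m - j - 2 + 1 = m - (j + 1) by omega] at this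
        exact this h
    simpa using hchain (k' + 1) 0 (by omega)
  by_cases hak : k < a
  · rw [monomialSection_of_gt hak]
    exact T.zero_mem
  induction a using Nat.twoStepInduction generalizing n with
  | zero => exact hzero n (by omega)
  | one =>
    cases n with
    | zero => exact hu 1
    | succ n =>
      have hr := hrel 0 n (by omega) (by omega)
      rw [Nat.cast_zero, zero_smul, add_zero] at hr
      refine (T.smul_mem_iff ?_).mp hr
      rw [Nat.cast_ne_zero]; omega
  | more a iha _ =>
    cases n with
    | zero => exact hu _
    | succ n => exact hup a n (by omega) (by omega) (iha (n + 2) (by omega) (by omega))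

/-- For `k = 2k′+1` odd, the classes of `z^{k′+1}·u_0, …, z·u_0, u_0, u_1, …, u_k` form a
`ℂ`-basis of `coker(θ_ρ : Λ_ρ⁺ → Λ_ρ⁺)`. -/
theorem stmt_7 (k k' : ℕ) (hk : k = 2 * k' + 1) (ρ : ℂ) (hρ : ρ = 0 ∨ ρ = 1 / 2) :
    LinearIndependent ℂ (fam7 k k' ρ)
    ∧ Submodule.span ℂ (Set.range (fam7 k k' ρ)) = ⊤ := by
  rw [fam7_eq]
  constructor
  · refine ((monomialBasis k).linearIndependent.comp _ (famIndex_injective k k')).map ?_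
    rw [Submodule.ker_mkQ, Submodule.disjoint_def]
    rintro _ hw ⟨v, rfl⟩
    obtain ⟨h0, hs⟩ := sectionCoeff_eq_zero_of_mem_span hw
    rw [eq_zero_of_thetaP hk ρ h0 hs, map_zero]
  · rw [Set.range_comp, ← Submodule.map_span, Submodule.map_mkQ_eq_top, eq_top_iff,
      ← (monomialBasis k).span_eq, Submodule.span_le]
    rintro _ ⟨i, rfl⟩
    rw [monomialBasis_apply]
    have hmem : ∀ i, monomialSection k (famIndex k k' i).1 (famIndex k k' i).2 ∈
        LinearMap.range (thetaP k ρ) ⊔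
          Submodule.span ℂ (Set.range (monomialBasis k ∘ famIndex k k')) := fun i =>
      Submodule.mem_sup_right (Submodule.subset_span ⟨i, by simp [monomialBasis_apply]⟩)
    refine monomialSection_mem hk ρ le_sup_left (fun n hn => hmem (Sum.inl ⟨n, hn⟩))
      (fun a => ?_) _ _
    rcases a with _ | a
    · exact hmem (Sum.inl 0)
    · by_cases ha : a < k
      · exact hmem (Sum.inr ⟨a, ha⟩)
      · rw [monomialSection_of_gt (by omega)]
        exact Submodule.zero_mem _
end

section
/- Assume k is even, so k = 2k′+2. Then the classes of the k + k′ + 1 elements z^{k′}·u_0, …, z·u_0, u_0, u_1, …, u_k form a ℂ-basis of coker(θ_ρ : Λ_ρ⁺ → Λ_ρ⁺). -/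
open Polynomial

/-- The family of classes `u_0, z·u_0, …, z^{k′}·u_0, u_1, …, u_k` in
`coker(θ_ρ : Λ_ρ⁺ → Λ_ρ⁺)` (for `k` even). -/
noncomputable def fam8 (k k' : ℕ) (ρ : ℂ) :
    (Fin (k' + 1) ⊕ Fin k) →
      ((Fin (k + 1) → Polynomial ℂ) ⧸ LinearMap.range (thetaP k ρ)) :=
  Sum.elim
    (fun i => Submodule.Quotient.mk (eP k 0 (X ^ (i : ℕ))))
    (fun j => Submodule.Quotient.mk (eP k ⟨(j : ℕ) + 1, by have := j.isLt; omega⟩ 1))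

namespace AiryCoker

/-- The operator `z∂_z + ρ` on `ℂ[z]`. -/
noncomputable def euler (ρ : ℂ) : ℂ[X] →ₗ[ℂ] ℂ[X] :=
  (LinearMap.mulLeft ℂ X).comp derivative + ρ • LinearMap.id

lemma euler_apply (ρ : ℂ) (f : ℂ[X]) : euler ρ f = X * derivative f + C ρ * f := by
  simp [euler, smul_eq_C_mul]

lemma coeff_X_mul_derivative (f : ℂ[X]) (j : ℕ) :
    (X * derivative f).coeff j = j * f.coeff j := by
  cases j with
  | zero => simp
  | succ j => rw [coeff_X_mul, coeff_derivative]; push_cast; ring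

lemma coeff_euler (ρ : ℂ) (f : ℂ[X]) (j : ℕ) :
    (euler ρ f).coeff j = (j + ρ) * f.coeff j := by
  rw [euler_apply, coeff_add, coeff_X_mul_derivative, coeff_C_mul]; ring

/-- The connection matrix of `Sym^k Ai`, with vectors indexed by `ℕ`. -/
noncomputable def conn (k : ℕ) : (ℕ → ℂ[X]) →ₗ[ℂ[X]] (ℕ → ℂ[X]) :=
  LinearMap.pi fun b =>
    C (if b = 0 then 0 else (k : ℂ) + 1 - b) • LinearMap.proj (b - 1)
      + (C ((b : ℂ) + 1) * X) • LinearMap.proj (b + 1)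

lemma conn_zero (k : ℕ) (f : ℕ → ℂ[X]) : conn k f 0 = X * f 1 := by
  simp [conn]

lemma conn_succ (k : ℕ) (f : ℕ → ℂ[X]) (b : ℕ) :
    conn k f (b + 1) = C ((k : ℂ) - b) * f b + C ((b : ℂ) + 2) * X * f (b + 2) := by
  simp only [conn, LinearMap.pi_apply, LinearMap.add_apply, LinearMap.smul_apply,
    LinearMap.proj_apply, smul_eq_mul, Nat.add_sub_cancel, if_neg (Nat.succ_ne_zero b)]
  congr 3
  · push_cast; ring_nf
  · push_cast; ring_nf

/-- The operator `θ_ρ`, with vectors indexed by `ℕ`. -/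
noncomputable def theta (k : ℕ) (ρ : ℂ) (f : ℕ → ℂ[X]) : ℕ → ℂ[X] :=
  fun b => euler ρ (f b) + X * conn k f b

lemma theta_sub (k : ℕ) (ρ : ℂ) (f g : ℕ → ℂ[X]) :
    theta k ρ (f - g) = theta k ρ f - theta k ρ g := by
  funext b
  simp only [theta, map_sub, Pi.sub_apply]
  ring

lemma theta_neg (k : ℕ) (ρ : ℂ) (f : ℕ → ℂ[X]) : theta k ρ (-f) = -theta k ρ f := by
  funext b
  simp only [theta, map_neg, Pi.neg_apply]
  ring

lemma theta_eq_zero {k : ℕ} {ρ : ℂ} {f : ℕ → ℂ[X]} (hf : ∀ b, k < b → f b = 0) {b : ℕ}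
    (hb : k < b) : theta k ρ f b = 0 := by
  obtain ⟨b, rfl⟩ := Nat.exists_eq_succ_of_ne_zero (show b ≠ 0 by omega)
  rw [theta, Nat.succ_eq_add_one, conn_succ, hf (b + 1) hb, hf (b + 2) (by omega)]
  rcases (Nat.lt_succ_iff.1 hb).eq_or_lt with rfl | h
  · simp
  · simp [hf b h]

/-- Absolute values of the coefficients of the row vector annihilated by the connection matrix. -/
noncomputable def dualCoeff (n : ℕ) : ℕ → ℝ
  | 0 => 1
  | i + 1 => dualCoeff n i * ((2 * i + 1) / (2 * n - 1 - 2 * i))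

lemma dualCoeff_pos (n : ℕ) : ∀ i ≤ n, 0 < dualCoeff n i
  | 0, _ => one_pos
  | i + 1, h => by
    have h' : (i : ℝ) + 1 ≤ n := by exact_mod_cast h
    exact mul_pos (dualCoeff_pos n i (by omega)) (div_pos (by positivity) (by linarith))

lemma dualCoeff_succ_mul (n i : ℕ) (h : i < n) :
    dualCoeff n (i + 1) * (2 * n - 1 - 2 * i) = dualCoeff n i * (2 * i + 1) := by
  have h' : (i : ℝ) + 1 ≤ n := by exact_mod_cast h
  have : (2 * n - 1 - 2 * i : ℝ) ≠ 0 := by linarith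
  rw [dualCoeff]; field_simp

/-- The `ℂ[z]`-linear functional annihilating the image of the connection matrix
of `Sym^{2n} Ai`. -/
noncomputable def dual (n : ℕ) : (ℕ → ℂ[X]) →ₗ[ℂ[X]] ℂ[X] :=
  ∑ i ∈ Finset.range (n + 1),
    (C ((-1) ^ i * (dualCoeff n i : ℂ)) * X ^ i) • LinearMap.proj (2 * i)

lemma dual_apply (n : ℕ) (f : ℕ → ℂ[X]) :
    dual n f = ∑ i ∈ Finset.range (n + 1),
      C ((-1) ^ i * (dualCoeff n i : ℂ)) * X ^ i * f (2 * i) := by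
  simp [dual]

lemma dual_conn {n : ℕ} {f : ℕ → ℂ[X]} (hf : f (2 * n + 1) = 0) :
    dual n (conn (2 * n) f) = 0 := by
  have key : ∀ N ≤ n, ∑ i ∈ Finset.range (N + 1),
      C ((-1) ^ i * (dualCoeff n i : ℂ)) * X ^ i * conn (2 * n) f (2 * i)
        = C ((-1) ^ N * (dualCoeff n N : ℂ) * (2 * N + 1)) * X ^ (N + 1) * f (2 * N + 1) := by
    intro N
    induction N with
    | zero => intro _; simp [conn_zero, dualCoeff]
    | succ N ih =>
      intro hN
      have e : ((dualCoeff n (N + 1) : ℝ) : ℂ) * (2 * n - 1 - 2 * N)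
          = dualCoeff n N * (2 * N + 1) := by
        exact_mod_cast congrArg (fun x : ℝ => (x : ℂ)) (dualCoeff_succ_mul n N hN)
      have e' := congrArg (fun x : ℂ => C x) e
      rw [Finset.sum_range_succ, ih (by omega), show 2 * (N + 1) = 2 * N + 1 + 1 by ring,
        conn_succ]
      push_cast at e' ⊢
      simp only [map_mul, map_add, map_sub, map_pow, map_neg, map_one] at e' ⊢
      linear_combination (-1) ^ (N + 1) * X ^ (N + 1) * f (2 * N + 1) * e'
  rw [dual_apply, key n le_rfl, hf, mul_zero]

lemma coeff_dual_eq_zero {n d : ℕ} {f : ℕ → ℂ[X]}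
    (hf : ∀ b j, d ≤ b + 2 * j → (f b).coeff j = 0) {j : ℕ} (hj : d ≤ 2 * j) :
    (dual n f).coeff j = 0 := by
  rw [dual_apply, finsetSum_coeff]
  refine Finset.sum_eq_zero fun i _ => ?_
  rw [mul_assoc, coeff_C_mul, coeff_X_pow_mul']
  split_ifs with h
  · rw [hf _ _ (by omega), mul_zero]
  · simp

lemma dual_eq_apply_zero {n : ℕ} {f : ℕ → ℂ[X]} (hf : ∀ b, f (b + 1) = 0) :
    dual n f = f 0 := by
  rw [dual_apply, Finset.sum_eq_single 0]
  · simp [dualCoeff]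
  · intro i _ hi
    obtain ⟨b, hb⟩ := Nat.exists_eq_succ_of_ne_zero (show 2 * i ≠ 0 by omega)
    rw [hb, hf, mul_zero]
  · simp

/-- The horizontal section `(u_1² - z u_0²)^n` of the connection matrix of `Sym^{2n} Ai`. -/
noncomputable def kerVec (n : ℕ) : ℕ → ℂ[X] := fun b =>
  if Even b then C ((-1) ^ (n - b / 2) * (n.choose (b / 2) : ℂ)) * X ^ (n - b / 2) else 0

lemma kerVec_even (n i : ℕ) :
    kerVec n (2 * i) = C ((-1) ^ (n - i) * (n.choose i : ℂ)) * X ^ (n - i) := by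
  simp [kerVec]

lemma kerVec_odd (n i : ℕ) : kerVec n (2 * i + 1) = 0 := by
  simp [kerVec]

lemma kerVec_top (n : ℕ) : kerVec n (2 * n) = 1 := by
  simp [kerVec_even]

lemma kerVec_eq_zero {n b : ℕ} (h : 2 * n < b) : kerVec n b = 0 := by
  rcases Nat.even_or_odd' b with ⟨i, rfl | rfl⟩
  · simp [kerVec_even, Nat.choose_eq_zero_of_lt (show n < i by omega)]
  · exact kerVec_odd n i

lemma conn_kerVec (n : ℕ) : conn (2 * n) (kerVec n) = 0 := by
  funext b
  rcases Nat.even_or_odd' b with ⟨i, rfl | rfl⟩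
  · cases i with
    | zero => simpa [conn_zero] using kerVec_odd n 0
    | succ i =>
      rw [show 2 * (i + 1) = 2 * i + 1 + 1 by ring, conn_succ, kerVec_odd,
        show 2 * i + 1 + 2 = 2 * (i + 1) + 1 by ring, kerVec_odd]
      simp
  · rw [conn_succ, kerVec_even, show 2 * i + 2 = 2 * (i + 1) by ring, kerVec_even]
    rcases lt_trichotomy i n with h | rfl | h
    · obtain ⟨m, rfl⟩ : ∃ m, n = i + 1 + m := ⟨n - (i + 1), by omega⟩
      rw [show i + 1 + m - i = m + 1 by omega, show i + 1 + m - (i + 1) = m by omega]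
      have e : (((i + 1 + m).choose (i + 1) : ℂ)) * (i + 1)
          = (i + 1 + m).choose i * (m + 1) := by
        have := Nat.choose_succ_right_eq (i + 1 + m) i
        rw [show i + 1 + m - i = m + 1 by omega] at this
        exact_mod_cast this
      have e' := congrArg (fun x : ℂ => C x) e
      push_cast
      simp only [map_mul, map_add, map_sub, map_pow, map_neg, map_one, map_natCast,
        Pi.zero_apply, map_ofNat] at e' ⊢
      linear_combination 2 * (-1) ^ m * X ^ (m + 1) * e'
    · simp
    · simp [Nat.choose_eq_zero_of_lt h, Nat.choose_eq_zero_of_lt (show n < i + 1 by omega)]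

/-- The correction of `θ_ρ(p·w)` by a multiple of `u_{2n}`, `w` being the horizontal section,
that vanishes at `z = 0`. -/
noncomputable def kerTheta (n : ℕ) (ρ : ℂ) (p : ℂ[X]) : ℕ → ℂ[X] := fun b =>
  euler ρ (p * kerVec n b) - if b = 2 * n then C (ρ * p.coeff 0) else 0

lemma kerTheta_sub (n : ℕ) (ρ : ℂ) (p q : ℂ[X]) :
    kerTheta n ρ (p - q) = kerTheta n ρ p - kerTheta n ρ q := by
  funext b
  simp only [kerTheta, sub_mul, map_sub, coeff_sub, mul_sub, Pi.sub_apply]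
  split_ifs <;> ring

lemma kerTheta_eq_zero {n b : ℕ} (ρ : ℂ) (p : ℂ[X]) (h : 2 * n < b) :
    kerTheta n ρ p b = 0 := by
  simp [kerTheta, kerVec_eq_zero h, h.ne']

lemma coeff_zero_kerTheta (n : ℕ) (ρ : ℂ) (p : ℂ[X]) (b : ℕ) :
    (kerTheta n ρ p b).coeff 0 = 0 := by
  rw [kerTheta, coeff_sub, coeff_euler, mul_coeff_zero]
  rcases Nat.even_or_odd' b with ⟨i, rfl | rfl⟩
  · rw [kerVec_even]
    rcases lt_trichotomy i n with h | rfl | h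
    · rw [if_neg (by omega), coeff_C_mul, coeff_X_pow, if_neg (by omega)]; simp
    · simp
    · rw [if_neg (by omega)]; simp [Nat.choose_eq_zero_of_lt h]
  · rw [kerVec_odd, if_neg (by omega)]; simp

/-- The weighted-degree filtration: `z` has degree `2` and `u_b` has degree `b`. -/
def DegLT (d : ℕ) (f : ℕ → ℂ[X]) : Prop := ∀ b j, d ≤ b + 2 * j → (f b).coeff j = 0

lemma DegLT.eq_zero {f : ℕ → ℂ[X]} (hf : DegLT 0 f) : f = 0 := by
  funext b; ext j; simp [hf b j (Nat.zero_le _)]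

lemma exists_degLT {k : ℕ} {f : ℕ → ℂ[X]} (hf : ∀ b, k < b → f b = 0) : ∃ d, DegLT d f := by
  refine ⟨k + 2 * (∑ b ∈ Finset.range (k + 1), (f b).natDegree) + 1, fun b j h => ?_⟩
  by_cases hb : k < b
  · simp [hf b hb]
  · have := Finset.single_le_sum (f := fun b => (f b).natDegree) (fun _ _ => Nat.zero_le _)
      (Finset.mem_range.2 (show b < k + 1 by omega))
    exact coeff_eq_zero_of_natDegree_lt (by omega)

lemma degLT_kerTheta {n d : ℕ} (ρ : ℂ) {p : ℂ[X]}
    (hp : ∀ m, d ≤ 2 * (m + n) → p.coeff m = 0) : DegLT d (kerTheta n ρ p) := by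
  intro b j h
  rw [kerTheta, coeff_sub, coeff_euler]
  have h1 : (p * kerVec n b).coeff j = 0 := by
    rcases Nat.even_or_odd' b with ⟨i, rfl | rfl⟩
    · rw [kerVec_even]
      by_cases hi : i ≤ n
      · rw [mul_left_comm, coeff_C_mul, coeff_mul_X_pow']
        split_ifs with hj
        · rw [hp _ (by omega), mul_zero]
        · simp
      · simp [Nat.choose_eq_zero_of_lt (not_le.1 hi)]
    · simp [kerVec_odd]
  have h2 : (if b = 2 * n then C (ρ * p.coeff 0) else 0 : ℂ[X]).coeff j = 0 := by
    split_ifs with hb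
    · rw [coeff_C]
      split_ifs with hj
      · rw [hp 0 (by omega), mul_zero]
      · rfl
    · simp
  rw [h1, h2]; simp

/-- The diagonal entries of `p ↦ dual (kerTheta p)` in the monomial basis, up to sign. -/
noncomputable def diagEntry (n : ℕ) (r : ℝ) (m : ℕ) : ℝ :=
  (∑ i ∈ Finset.range (n + 1), dualCoeff n i * n.choose i * (m + (n - i : ℕ) + r))
    - if m = 0 then dualCoeff n n * r else 0

lemma diagEntry_pos {n : ℕ} (hn : 0 < n) {r : ℝ} (hr : 0 ≤ r) (m : ℕ) :
    0 < diagEntry n r m := by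
  have hpos : 0 < ∑ i ∈ Finset.range n, dualCoeff n i * n.choose i * (m + (n - i : ℕ) + r) := by
    refine Finset.sum_pos (fun i hi => ?_) ⟨0, Finset.mem_range.2 hn⟩
    have hi := Finset.mem_range.1 hi
    have h1 := dualCoeff_pos n i hi.le
    have h2 : (0 : ℝ) < n.choose i := by exact_mod_cast Nat.choose_pos hi.le
    have h3 : (0 : ℝ) < (n - i : ℕ) := by exact_mod_cast Nat.sub_pos_of_lt hi
    positivity
  have hn' := dualCoeff_pos n n le_rfl
  rw [diagEntry, Finset.sum_range_succ]
  split_ifs with h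
  · subst h; simp only [Nat.choose_self, Nat.sub_self]; push_cast at hpos ⊢; linarith
  · have : 0 ≤ dualCoeff n n * n.choose n * (m + (n - n : ℕ) + r) := by positivity
    linarith

lemma coeff_dual_kerTheta (n : ℕ) (r : ℝ) (p : ℂ[X]) (j : ℕ) :
    (dual n (kerTheta n r p)).coeff j
      = if n ≤ j then (-1) ^ n * (diagEntry n r (j - n) : ℂ) * p.coeff (j - n) else 0 := by
  have h1 : ∀ i ∈ Finset.range (n + 1),
      (C ((-1) ^ i * (dualCoeff n i : ℂ)) * X ^ i * euler r (p * kerVec n (2 * i))).coeff j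
      = if n ≤ j then (-1) ^ n * ((dualCoeff n i : ℂ) * n.choose i
          * ((j - n : ℕ) + (n - i : ℕ) + r)) * p.coeff (j - n) else 0 := by
    intro i hi
    have hi : i ≤ n := Nat.lt_succ_iff.1 (Finset.mem_range.1 hi)
    rw [kerVec_even, mul_assoc, coeff_C_mul, coeff_X_pow_mul', mul_left_comm p, coeff_euler,
      coeff_C_mul, coeff_mul_X_pow']
    by_cases hj : n ≤ j
    · rw [if_pos (by omega), if_pos (by omega), if_pos hj,
        show j - i - (n - i) = j - n by omega, show j - i = j - n + (n - i) by omega]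
      have : ((-1 : ℂ)) ^ n = (-1) ^ i * (-1) ^ (n - i) := by rw [← pow_add]; congr 1; omega
      rw [this]; push_cast; ring
    · rw [if_neg hj]
      split_ifs
      · omega
      · simp
      · simp
  have h2 : dual n (kerTheta n r p)
      = ∑ i ∈ Finset.range (n + 1),
          C ((-1) ^ i * (dualCoeff n i : ℂ)) * X ^ i * euler r (p * kerVec n (2 * i))
        - C ((-1) ^ n * (dualCoeff n n : ℂ) * (r * p.coeff 0)) * X ^ n := by
    simp only [dual_apply, kerTheta, mul_sub, Finset.sum_sub_distrib]
    congr 1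
    rw [Finset.sum_eq_single n]
    · simp only [if_true, map_mul]; ring
    · intro i _ hi; rw [if_neg (by omega), mul_zero]
    · simp
  rw [h2, coeff_sub, finsetSum_coeff, Finset.sum_congr rfl h1, coeff_C_mul, coeff_X_pow]
  by_cases hj : n ≤ j
  · simp only [if_pos hj]
    rw [← Finset.sum_mul, ← Finset.mul_sum, diagEntry]
    by_cases hj' : j = n
    · subst hj'; simp; ring
    · rw [if_neg hj', if_neg (by omega)]; push_cast; ring
  · simp only [if_neg hj, if_neg (show j ≠ n by omega)]; simp

/-- The coefficients solving `conn (2n) c = f` from the top component downwards. -/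
noncomputable def descend (k : ℕ) (f : ℕ → ℂ[X]) : ℕ → ℂ[X]
  | 0 => 0
  | 1 => f k
  | t + 2 => C ((t : ℂ) + 2)⁻¹ * (f (k - t - 1) - C ((k : ℂ) - t) * X * descend k f t)

lemma conn_descend {n : ℕ} {f : ℕ → ℂ[X]} (hf : ∀ b, 2 * n < b → f b = 0)
    (hdual : dual n f = 0) :
    conn (2 * n) (fun b => descend (2 * n) f (2 * n - b)) = f := by
  set c : ℕ → ℂ[X] := fun b => descend (2 * n) f (2 * n - b) with hc
  have hc0 : ∀ b, 2 * n ≤ b → c b = 0 := fun b hb => by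
    simp only [hc, Nat.sub_eq_zero_of_le hb, descend]
  have hsucc : ∀ b, conn (2 * n) c (b + 1) = f (b + 1) := by
    intro b
    rw [conn_succ]
    rcases lt_trichotomy (b + 1) (2 * n) with h | h | h
    · obtain ⟨t, ht⟩ : ∃ t, 2 * n = b + 2 + t := ⟨2 * n - (b + 2), by omega⟩
      have e1 : c b = descend (2 * n) f (t + 2) := by simp only [hc]; congr 1; omega
      have e2 : c (b + 2) = descend (2 * n) f t := by simp only [hc]; congr 1; omega
      have e3 : ((2 * n : ℕ) : ℂ) = b + 2 + t := by rw [ht]; push_cast; ring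
      have e4 : C ((t : ℂ) + 2) * C ((t : ℂ) + 2)⁻¹ = 1 := by
        rw [← C_mul, mul_inv_cancel₀ (by exact_mod_cast (Nat.succ_ne_zero (t + 1))), C_1]
      rw [e1, e2, descend, e3, show 2 * n - t - 1 = b + 1 by omega,
        show (b + 2 + t - b : ℂ) = t + 2 by ring, show (b + 2 + t - t : ℂ) = b + 2 by ring]
      linear_combination (f (b + 1) - C ((b : ℂ) + 2) * X * descend (2 * n) f t) * e4
    · have e1 : c b = f (2 * n) := by
        simp only [hc, show 2 * n - b = 1 by omega, descend]
      rw [hc0 (b + 2) (by omega), e1, ← h]; push_cast; simp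
    · rw [hc0 b (by omega), hc0 (b + 2) (by omega), hf _ h]; simp
  have h0 : conn (2 * n) c 0 - f 0 = 0 := by
    have h1 : dual n (conn (2 * n) c - f) = (conn (2 * n) c - f) 0 :=
      dual_eq_apply_zero fun b => by simp [hsucc]
    rw [map_sub, dual_conn (hc0 _ (by omega)), hdual] at h1
    simpa using h1.symm
  funext b
  cases b with
  | zero => exact sub_eq_zero.1 h0
  | succ b => exact hsucc b

lemma coeff_descend {k d : ℕ} {f : ℕ → ℂ[X]}
    (hf : ∀ b j, d ≤ b + 2 * j + 2 → (f b).coeff j = 0) :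
    ∀ t j, t ≤ k → d ≤ k - t + 2 * j + 3 → (descend k f t).coeff j = 0
  | 0, j, _, _ => by simp [descend]
  | 1, j, _, h => by rw [descend]; exact hf _ _ (by omega)
  | t + 2, j, ht, h => by
    rw [descend, coeff_C_mul, coeff_sub, hf _ _ (by omega), mul_assoc, coeff_C_mul]
    cases j with
    | zero => simp
    | succ j =>
      rw [coeff_X_mul, coeff_descend hf t j (by omega) (by omega)]; simp

lemma eq_zero_of_conn_eq_zero {k : ℕ} {c : ℕ → ℂ[X]} (hc : ∀ b, k ≤ b → c b = 0)
    (h : conn k c = 0) : c = 0 := by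
  have key : ∀ t b, k ≤ b + t → c b = 0 := by
    intro t
    induction t with
    | zero => exact hc
    | succ t ih =>
      intro b hb
      by_cases hbk : k ≤ b
      · exact hc b hbk
      have e := congrFun h (b + 1)
      rw [conn_succ, ih (b + 2) (by omega), mul_zero, add_zero, Pi.zero_apply,
        mul_eq_zero, C_eq_zero, sub_eq_zero] at e
      exact e.resolve_left fun e => hbk (Nat.cast_injective e).le
  funext b
  exact key k b (by omega)

/-- The span of `u_0, …, z^{n-1}u_0, u_1, …, u_{2n}`. -/
structure IsRep (n : ℕ) (s : ℕ → ℂ[X]) : Prop where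
  zero : ∀ j, n ≤ j → (s 0).coeff j = 0
  succ : ∀ b j, (s (b + 1)).coeff (j + 1) = 0
  support : ∀ b, 2 * n < b → s b = 0

lemma IsRep.sub {n : ℕ} {s t : ℕ → ℂ[X]} (hs : IsRep n s) (ht : IsRep n t) :
    IsRep n (s - t) where
  zero j hj := by simp [hs.zero j hj, ht.zero j hj]
  succ b j := by simp [hs.succ b j, ht.succ b j]
  support b hb := by simp [hs.support b hb, ht.support b hb]

lemma IsRep.add_single {n : ℕ} (hn : 0 < n) {s : ℕ → ℂ[X]} (hs : IsRep n s) (a : ℂ) :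
    IsRep n (fun b => s b + if b = 2 * n then C a else 0) where
  zero j hj := by simp [hs.zero j hj, hn.ne']
  succ b j := by
    rw [coeff_add, hs.succ]
    split_ifs <;> simp
  support b hb := by simp [hs.support b hb, hb.ne']

section

variable {n : ℕ} {r : ℝ}

lemma symbol_injective (hn : 0 < n) (hr : 0 ≤ r) {s c : ℕ → ℂ[X]} {p : ℂ[X]}
    (hs : IsRep n s) (hc : ∀ b, 2 * n ≤ b → c b = 0)
    (h : s + (X : ℂ[X]) • conn (2 * n) c + kerTheta n r p = 0) : s = 0 ∧ c = 0 ∧ p = 0 := by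
  have hsucc : ∀ b, s (b + 1) = 0 := by
    intro b
    ext j
    cases j with
    | zero =>
      have := congrArg (fun f : ℂ[X] => f.coeff 0) (congrFun h (b + 1))
      simpa [coeff_zero_kerTheta] using this
    | succ j => simpa using hs.succ b j
  have hdual := congrArg (dual n) h
  rw [map_add, map_add, map_smul, dual_conn (hc _ (by omega)), dual_eq_apply_zero hsucc,
    smul_zero, add_zero, map_zero] at hdual
  have hcoeff : ∀ j, (s 0).coeff j + (dual n (kerTheta n r p)).coeff j = 0 := fun j => by
    rw [← coeff_add, hdual, coeff_zero]
  have hp : p = 0 := by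
    ext m
    have := hcoeff (m + n)
    rw [hs.zero _ (by omega), coeff_dual_kerTheta, if_pos (by omega), Nat.add_sub_cancel,
      zero_add] at this
    have hne : ((diagEntry n r m : ℝ) : ℂ) ≠ 0 := by
      exact_mod_cast (diagEntry_pos hn hr m).ne'
    simpa [hne] using this
  subst hp
  have hk : kerTheta n r 0 = 0 := by funext b; simp [kerTheta]
  have hs0 : s = 0 := by
    funext b
    cases b with
    | zero => ext j; simpa [hk] using hcoeff j
    | succ b => exact hsucc b
  subst hs0
  refine ⟨rfl, eq_zero_of_conn_eq_zero hc ?_, rfl⟩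
  rw [hk, zero_add, add_zero] at h
  exact (smul_eq_zero.1 h).resolve_left X_ne_zero

lemma symbol_surjective (hn : 0 < n) (hr : 0 ≤ r) {d : ℕ} {f : ℕ → ℂ[X]}
    (hf : ∀ b, 2 * n < b → f b = 0) (hd : DegLT d f) :
    ∃ s c p, IsRep n s ∧ (∀ b, 2 * n ≤ b → c b = 0) ∧ DegLT (d - 3) c ∧
      f = s + (X : ℂ[X]) • conn (2 * n) c + kerTheta n r p := by
  set μ : ℕ → ℂ[X] := fun b => f b - if b = 0 then 0 else C ((f b).coeff 0) with hμ
  have hμd : DegLT d μ := by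
    intro b j h
    simp only [hμ, coeff_sub, hd b j h]
    split_ifs
    · simp
    · rw [coeff_C]
      split_ifs with hj
      · rw [hd b 0 (by omega), sub_zero]
      · simp
  set q := dual n μ with hq
  have hqd : ∀ j, d ≤ 2 * j → q.coeff j = 0 := fun j hj => coeff_dual_eq_zero hμd hj
  have hne : ∀ m, (-1) ^ n * ((diagEntry n r m : ℝ) : ℂ) ≠ 0 := fun m =>
    mul_ne_zero (pow_ne_zero _ (by norm_num)) (by exact_mod_cast (diagEntry_pos hn hr m).ne')
  obtain ⟨p, hp⟩ : ∃ p : ℂ[X], ∀ m,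
      (-1) ^ n * ((diagEntry n r m : ℝ) : ℂ) * p.coeff m = q.coeff (m + n) := by
    refine ⟨∑ m ∈ Finset.range (q.natDegree + 1),
      monomial m (q.coeff (m + n) / ((-1) ^ n * ((diagEntry n r m : ℝ) : ℂ))), fun m => ?_⟩
    simp only [finsetSum_coeff, coeff_monomial, Finset.sum_ite_eq', Finset.mem_range]
    split_ifs with h
    · exact mul_div_cancel₀ _ (hne m)
    · rw [mul_zero, coeff_eq_zero_of_natDegree_lt (by omega)]
  have hpd : ∀ m, d ≤ 2 * (m + n) → p.coeff m = 0 := fun m hm => by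
    have := hp m
    rw [hqd _ hm] at this
    exact (mul_eq_zero.1 this).resolve_left (hne m)
  set σ : ℂ[X] := q - dual n (kerTheta n r p) with hσ
  have hσc : ∀ j, σ.coeff j = if n ≤ j then 0 else q.coeff j := by
    intro j
    rw [hσ, coeff_sub, coeff_dual_kerTheta]
    split_ifs with h
    · rw [hp, Nat.sub_add_cancel h, sub_self]
    · rw [sub_zero]
  set s : ℕ → ℂ[X] := fun b => if b = 0 then σ else C ((f b).coeff 0) with hs
  have hsrep : IsRep n s := by
    refine ⟨fun j hj => ?_, fun b j => ?_, fun b hb => ?_⟩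
    · simp [hs, hσc, hj]
    · simp [hs]
    · simp [hs, hf b hb, (show b ≠ 0 by omega)]
  set e : ℕ → ℂ[X] := fun b => if b = 0 then σ else 0 with he
  set ν : ℕ → ℂ[X] := μ - e - kerTheta n r p with hν
  have hfν : f = s + ν + kerTheta n r p := by
    funext b
    simp only [hν, hs, hμ, he, Pi.add_apply, Pi.sub_apply]
    split_ifs <;> ring
  have hνdual : dual n ν = 0 := by
    rw [hν, map_sub, map_sub, dual_eq_apply_zero (f := e) (fun b => by simp [he])]
    simp [he, hσ, ← hq]
  have hνsucc : ∀ b, (ν (b + 1)).coeff 0 = 0 := fun b => by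
    simp [hν, hμ, he, coeff_zero_kerTheta]
  have hν0 : (ν 0).coeff 0 = 0 := by
    have := congrArg (fun f : ℂ[X] => f.coeff 0) hνdual
    rw [dual_apply] at this
    simpa [Finset.sum_range_succ', finsetSum_coeff, mul_coeff_zero, dualCoeff] using this
  have hνd : DegLT d ν := by
    intro b j h
    simp only [hν, Pi.sub_apply, coeff_sub, hμd b j h, degLT_kerTheta (r : ℂ) hpd b j h, he]
    split_ifs with hb
    · rw [hσc]
      split_ifs
      · simp
      · rw [hqd _ (by omega)]; simp
    · simp
  have hνs : ∀ b, 2 * n < b → ν b = 0 := fun b hb => by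
    simp [hν, hμ, he, hf b hb, kerTheta_eq_zero _ _ hb, (show b ≠ 0 by omega)]
  set η : ℕ → ℂ[X] := fun b => (ν b).divX with hη
  have hXη : (X : ℂ[X]) • η = ν := by
    funext b
    have hb : (ν b).coeff 0 = 0 := by
      cases b with
      | zero => exact hν0
      | succ b => exact hνsucc b
    have := X_mul_divX_add (ν b)
    rwa [hb, C_0, add_zero] at this
  have hηdual : dual n η = 0 := by
    rw [← hXη, map_smul] at hνdual
    exact (smul_eq_zero.1 hνdual).resolve_left X_ne_zero
  refine ⟨s, fun b => descend (2 * n) η (2 * n - b), p, hsrep, fun b hb => ?_,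
    fun b j h => ?_, ?_⟩
  · simp only [Nat.sub_eq_zero_of_le hb, descend]
  · by_cases hb : b ≤ 2 * n
    · refine coeff_descend (d := d) (fun b j h => ?_) _ _ (by omega) (by omega)
      rw [hη, coeff_divX]
      exact hνd _ _ (by omega)
    · simp only [Nat.sub_eq_zero_of_le (not_le.1 hb).le, descend, coeff_zero]
  · rw [conn_descend (fun b hb => by simp [hη, hνs b hb]) hηdual, hXη, ← hfν]

lemma theta_add_kerVec (s c : ℕ → ℂ[X]) (p : ℂ[X]) :
    s + theta (2 * n) r (c + p • kerVec n)
      = (fun b => s b + if b = 2 * n then C (r * p.coeff 0) else 0)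
        + (X : ℂ[X]) • conn (2 * n) c + kerTheta n r p + fun b => euler r (c b) := by
  funext b
  simp only [theta, map_add, map_smul, conn_kerVec, kerTheta, Pi.add_apply, Pi.smul_apply,
    smul_eq_mul, smul_zero, Pi.zero_apply]
  ring

lemma DegLT.euler {d : ℕ} {c : ℕ → ℂ[X]} (hc : DegLT d c) (ρ : ℂ) :
    DegLT d (fun b => euler ρ (c b)) := fun b j h => by
  rw [coeff_euler, hc b j h, mul_zero]

lemma DegLT.neg {d : ℕ} {c : ℕ → ℂ[X]} (hc : DegLT d c) : DegLT d (-c) := fun b j h => by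
  simp [hc b j h]

lemma exists_rep_add_theta (hn : 0 < n) (hr : 0 ≤ r) (d : ℕ) :
    ∀ f : ℕ → ℂ[X], (∀ b, 2 * n < b → f b = 0) → DegLT d f →
      ∃ s v, IsRep n s ∧ (∀ b, 2 * n < b → v b = 0) ∧ f = s + theta (2 * n) r v := by
  induction d using Nat.strong_induction_on with
  | _ d ih =>
    intro f hf hd
    rcases Nat.eq_zero_or_pos d with rfl | hpos
    · refine ⟨0, 0, ⟨by simp, by simp, by simp⟩, by simp, ?_⟩
      rw [hd.eq_zero]
      funext b
      simp [theta]
    obtain ⟨s, c, p, hs, hc, hcd, rfl⟩ := symbol_surjective hn hr hf hd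
    obtain ⟨s₁, v₁, hs₁, hv₁, e⟩ := ih (d - 3) (by omega) (fun b => euler r (c b))
      (fun b hb => by simp [hc b hb.le]) (hcd.euler r)
    refine ⟨_, c + p • kerVec n - v₁, (hs.add_single hn (-(r * p.coeff 0))).sub hs₁,
      fun b hb => ?_, ?_⟩
    · simp [hc b hb.le, kerVec_eq_zero hb, hv₁ b hb]
    · have h := theta_add_kerVec (n := n) (r := r)
        (fun b => s b + if b = 2 * n then C (-(r * p.coeff 0)) else 0) c p
      have hs' : (fun b => (s b + if b = 2 * n then C (-((r : ℂ) * p.coeff 0)) else 0)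
          + if b = 2 * n then C ((r : ℂ) * p.coeff 0) else 0) = s := by
        funext b
        split_ifs <;> simp
      rw [hs', e] at h
      rw [theta_sub]
      linear_combination (exp := 1) -h

lemma rep_eq_zero_of_add_theta_eq_zero (hn : 0 < n) (hr : 0 ≤ r) {s v : ℕ → ℂ[X]}
    (hs : IsRep n s) (hv : ∀ b, 2 * n < b → v b = 0) (h : s + theta (2 * n) r v = 0) :
    s = 0 := by
  set p := v (2 * n) with hp
  set c : ℕ → ℂ[X] := v - p • kerVec n with hc
  have hcs : ∀ b, 2 * n ≤ b → c b = 0 := by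
    intro b hb
    rcases hb.eq_or_lt with rfl | hb
    · simp [hc, hp, kerVec_top]
    · simp [hc, hv b hb, kerVec_eq_zero hb]
  have hs' := hs.add_single hn ((r : ℂ) * p.coeff 0)
  rw [show v = c + p • kerVec n by simp [hc], theta_add_kerVec] at h
  have hzero : ∀ d, DegLT d c → c = 0 := by
    intro d
    induction d using Nat.strong_induction_on with
    | _ d ih =>
      intro hd
      rcases Nat.eq_zero_or_pos d with rfl | hpos
      · exact hd.eq_zero
      obtain ⟨s₁, c₁, p₁, hs₁, hc₁, hd₁, e⟩ := symbol_surjective hn hr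
        (f := -fun b => euler r (c b)) (fun b hb => by simp [hcs b hb.le]) (hd.euler r).neg
      have hcc : c - c₁ = 0 := by
        refine (symbol_injective (p := p - p₁) hn hr (hs'.sub hs₁)
          (fun b hb => by simp [hcs b hb, hc₁ b hb]) ?_).2.1
        rw [map_sub, smul_sub, kerTheta_sub]
        linear_combination (exp := 1) h + e
      rw [sub_eq_zero.1 hcc] at ih ⊢
      exact ih _ (by omega) hd₁
  obtain ⟨d, hd⟩ := exists_degLT (k := 2 * n) (fun b hb => hcs b hb.le)
  have hc0 := hzero d hd
  have he : (fun b => euler r (c b)) = 0 := by funext b; simp [hc0]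
  rw [he, add_zero] at h
  obtain ⟨h1, -, h3⟩ := symbol_injective hn hr hs' hcs h
  funext b
  simpa [h3] using congrFun h1 b

end

/-- Truncation to the components `0, …, k`. -/
def restrict (k : ℕ) (f : ℕ → ℂ[X]) : Fin (k + 1) → ℂ[X] := fun b => f b

/-- Extension by zero. -/
noncomputable def extend (k : ℕ) (v : Fin (k + 1) → ℂ[X]) : ℕ → ℂ[X] := fun b =>
  if h : b < k + 1 then v ⟨b, h⟩ else 0

lemma restrict_extend (k : ℕ) (v : Fin (k + 1) → ℂ[X]) : restrict k (extend k v) = v := by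
  funext b; simp only [restrict, extend, dif_pos b.isLt]

lemma extend_eq_zero {k b : ℕ} (v : Fin (k + 1) → ℂ[X]) (hb : k < b) : extend k v b = 0 := by
  rw [extend, dif_neg (by omega)]

lemma thetaP_restrict {k : ℕ} (ρ : ℂ) {f : ℕ → ℂ[X]} (hf : f (k + 1) = 0) :
    thetaP k ρ (restrict k f) = restrict k (theta k ρ f) := by
  funext ⟨b, hb⟩
  have hnext : ((if h : b + 1 ≤ k then
        ((b + 1 : ℕ) : ℂ) • (LinearMap.mulLeft ℂ ((X : ℂ[X]) ^ 2)).comp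
          (LinearMap.proj (⟨b + 1, by omega⟩ : Fin (k + 1)))
      else 0 : (Fin (k + 1) → ℂ[X]) →ₗ[ℂ] ℂ[X])) (restrict k f)
      = C ((b : ℂ) + 1) * X ^ 2 * f (b + 1) := by
    split_ifs with h
    · simp [restrict, smul_eq_C_mul, mul_assoc]
    · obtain rfl : b = k := by omega
      simp [hf]
  simp only [thetaP, LinearMap.pi_apply, LinearMap.add_apply]
  rw [hnext]
  cases b with
  | zero =>
    simp [restrict, theta, conn_zero, euler_apply, smul_eq_C_mul]
    ring
  | succ b =>
    have hc : ((k - b : ℕ) : ℂ[X]) = k - b := Nat.cast_sub (by omega)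
    simp [restrict, theta, conn_succ, euler_apply, smul_eq_C_mul, hc, C_ofNat]
    ring

/-- The element with coordinates `g` in the family `fam8`. -/
noncomputable def rep (n : ℕ) (g : Fin n ⊕ Fin (2 * n) → ℂ) : ℕ → ℂ[X]
  | 0 => ∑ i : Fin n, C (g (Sum.inl i)) * X ^ (i : ℕ)
  | b + 1 => if h : b < 2 * n then C (g (Sum.inr ⟨b, h⟩)) else 0

lemma coeff_rep_zero (n : ℕ) (g : Fin n ⊕ Fin (2 * n) → ℂ) (j : ℕ) :
    (rep n g 0).coeff j = if h : j < n then g (Sum.inl ⟨j, h⟩) else 0 := by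
  simp only [rep, finsetSum_coeff, coeff_C_mul, coeff_X_pow, mul_ite, mul_one, mul_zero]
  split_ifs with h
  · rw [Finset.sum_eq_single ⟨j, h⟩]
    · simp
    · intro i _ hi
      rw [if_neg fun e => hi (Fin.ext e.symm)]
    · simp
  · exact Finset.sum_eq_zero fun i _ => if_neg (by have := i.isLt; omega)

lemma isRep_rep (n : ℕ) (g : Fin n ⊕ Fin (2 * n) → ℂ) : IsRep n (rep n g) where
  zero j hj := by rw [coeff_rep_zero, dif_neg (by omega)]
  succ b j := by rw [rep]; split_ifs <;> simp
  support b hb := by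
    obtain ⟨b, rfl⟩ := Nat.exists_eq_succ_of_ne_zero (show b ≠ 0 by omega)
    rw [rep, dif_neg (by omega)]

lemma IsRep.exists_eq_rep {n : ℕ} {s : ℕ → ℂ[X]} (hs : IsRep n s) : ∃ g, s = rep n g := by
  refine ⟨Sum.elim (fun i => (s 0).coeff i) (fun j => (s (j + 1)).coeff 0), ?_⟩
  funext b
  cases b with
  | zero =>
    ext j
    rw [coeff_rep_zero]
    split_ifs with h
    · rfl
    · exact hs.zero j (by omega)
  | succ b =>
    rw [rep]
    split_ifs with h
    · ext j
      cases j with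
      | zero => simp
      | succ j => simp [hs.succ b j]
    · exact hs.support _ (by omega)

lemma eq_zero_of_rep_eq_zero {n : ℕ} {g : Fin n ⊕ Fin (2 * n) → ℂ} (h : rep n g = 0) :
    g = 0 := by
  funext x
  rcases x with i | j
  · have := congrArg (fun f : ℂ[X] => f.coeff i) (congrFun h 0)
    simpa [coeff_rep_zero] using this
  · have := congrFun h (j + 1)
    rw [rep, dif_pos j.isLt] at this
    simpa using this

lemma sum_smul_fam8 (k' : ℕ) (ρ : ℂ) (g : Fin (k' + 1) ⊕ Fin (2 * (k' + 1)) → ℂ) :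
    ∑ x, g x • fam8 (2 * (k' + 1)) k' ρ x
      = Submodule.Quotient.mk (restrict (2 * (k' + 1)) (rep (k' + 1) g)) := by
  simp only [Fintype.sum_sum_type, fam8, Sum.elim_inl, Sum.elim_inr,
    ← Submodule.mkQ_apply, ← map_smul, ← map_sum, ← map_add]
  congr 1
  funext ⟨b, hb⟩
  simp only [Pi.add_apply, Finset.sum_apply, Pi.smul_apply, eP, restrict, Fin.ext_iff,
    Fin.val_zero, smul_eq_C_mul, mul_ite, mul_one, mul_zero]
  cases b with
  | zero => simp [rep]
  | succ b =>
    rw [rep, dif_pos (by omega), Finset.sum_eq_single (a := (⟨b, by omega⟩ : Fin _))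
      (s := Finset.univ) (M := ℂ[X]) (f := fun x => if b + 1 = x.1 + 1 then C (g (Sum.inr x)) else 0)]
    · simp
    · intro x _ hx
      exact if_neg fun e => hx (Fin.ext (by simpa using e.symm))
    · simp

end AiryCoker

/-- For `k = 2k′+2` even, the classes of `z^{k′}·u_0, …, z·u_0, u_0, u_1, …, u_k` form a
`ℂ`-basis of `coker(θ_ρ : Λ_ρ⁺ → Λ_ρ⁺)`. -/
theorem stmt_8 (k k' : ℕ) (hk : k = 2 * k' + 2) (ρ : ℂ) (hρ : ρ = 0 ∨ ρ = 1 / 2) :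
    LinearIndependent ℂ (fam8 k k' ρ)
    ∧ Submodule.span ℂ (Set.range (fam8 k k' ρ)) = ⊤ := by
  obtain rfl : k = 2 * (k' + 1) := by omega
  obtain ⟨r, hr, rfl⟩ : ∃ r : ℝ, 0 ≤ r ∧ ρ = r := by
    rcases hρ with rfl | rfl
    · exact ⟨0, le_rfl, by simp⟩
    · exact ⟨1 / 2, by norm_num, by simp⟩
  have hn : 0 < k' + 1 := k'.succ_pos
  constructor
  · rw [Fintype.linearIndependent_iff]
    intro g hg
    refine congrFun (AiryCoker.eq_zero_of_rep_eq_zero ?_)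
    rw [AiryCoker.sum_smul_fam8, Submodule.Quotient.mk_eq_zero] at hg
    obtain ⟨v, hv⟩ := hg
    set w := AiryCoker.extend (2 * (k' + 1)) v with hw
    have hws : ∀ b, 2 * (k' + 1) < b → w b = 0 := fun b hb => AiryCoker.extend_eq_zero v hb
    rw [← AiryCoker.restrict_extend _ v, AiryCoker.thetaP_restrict _ (hws _ (by omega))] at hv
    have hrep := AiryCoker.isRep_rep (k' + 1) g
    refine AiryCoker.rep_eq_zero_of_add_theta_eq_zero hn hr (v := -w) hrep
      (fun b hb => by simp [hws b hb]) ?_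
    have hrange : AiryCoker.rep (k' + 1) g = AiryCoker.theta (2 * (k' + 1)) r w := by
      funext b
      by_cases hb : b < 2 * (k' + 1) + 1
      · exact (congrFun hv ⟨b, hb⟩).symm
      · rw [hrep.support b (by omega), AiryCoker.theta_eq_zero hws (by omega)]
    rw [AiryCoker.theta_neg, hrange, add_neg_cancel]
  · rw [eq_top_iff]
    rintro x -
    obtain ⟨f, rfl⟩ := Submodule.Quotient.mk_surjective _ x
    obtain ⟨d, hd⟩ := AiryCoker.exists_degLT fun b hb => AiryCoker.extend_eq_zero f hb
    obtain ⟨s, v, hs, hv, e⟩ := AiryCoker.exists_rep_add_theta hn hr d _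
      (fun b hb => AiryCoker.extend_eq_zero f hb) hd
    obtain ⟨g, rfl⟩ := hs.exists_eq_rep
    have hf : f = AiryCoker.restrict _ (AiryCoker.rep (k' + 1) g)
        + thetaP _ r (AiryCoker.restrict _ v) := by
      rw [AiryCoker.thetaP_restrict _ (hv _ (by omega)), ← AiryCoker.restrict_extend _ f]
      exact congrArg (AiryCoker.restrict _) e
    have hmk : (Submodule.Quotient.mk f : _ ⧸ LinearMap.range (thetaP (2 * (k' + 1)) (r : ℂ)))
        = ∑ x, g x • fam8 (2 * (k' + 1)) k' r x := by
      rw [AiryCoker.sum_smul_fam8, Submodule.Quotient.eq, hf, add_sub_cancel_left]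
      exact ⟨_, rfl⟩
    rw [hmk]
    exact Submodule.sum_mem _ fun x _ =>
      Submodule.smul_mem _ _ (Submodule.subset_span (Set.mem_range_self x))
end
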